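/- Let p > 2, n = 1 and Ω = (−1,1). Suppose u₀ ∈ X is such that: (a) there is no classical solution of u_t − u_xx = |u_x|^p with zero Dirichlet data and initial data u₀ on [−1,1] × [0,∞) (i.e., T*(u₀) < ∞); and (b) for every family (u_j)_{j≥1} of classical solutions of the regularized problems with data u₀, for every t > 0, sup_{j≥1} u_j(x,t) → 0 as x → −1⁺ and as x → 1⁻ (no loss of boundary conditions for the global viscosity solution with data u₀). Let v₀ ∈ X with v₀ ≥ u₀ on [−1,1] and v₀ ≢ u₀, and let (v_j)_{j≥1} be any family of classical solutions of the regularized problems with data v₀. Then there exist x₀ ∈ {−1,1} and t > 0 such that liminf_{x→x₀, x∈(−1,1)} sup_{j≥1} v_j(x,t) > 0, i.e., the global viscosity solution with data v₀ loses the boundary conditions at some boundary point. -/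

import Mathlib

open Set Filter Metric MeasureTheory Topology

noncomputable section

/-- Membership in the class `X` for `Ω = (-1,1) ⊂ ℝ`: `v ∈ C¹([-1,1])`, `v ≥ 0`,
`v(-1) = v(1) = 0`. -/
def MemX1 (v : ℝ → ℝ) : Prop :=
  ContDiffOn ℝ 1 v (Icc (-1:ℝ) 1) ∧ (∀ x ∈ Icc (-1:ℝ) 1, 0 ≤ v x) ∧ v (-1) = 0 ∧ v 1 = 0

/-- The regularized Hamiltonian `F_j(ξ) = min(|ξ|^p, j^{p-2}ξ²)`. -/
def Fj1 (p : ℝ) (j : ℕ) (ξ : ℝ) : ℝ :=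
  min (|ξ| ^ p) ((j : ℝ) ^ (p - 2) * ξ ^ 2)

/-- `u` is a classical solution of the `j`-th regularized problem on `[-1,1] × [0,∞)`:
`∂ₜu = ∂ₓₓu + F_j(∂ₓu)` in `(-1,1) × (0,∞)`, `u(±1,t) = 0` for `t > 0`, `u(·,0) = u₀`. -/
structure IsRegSol1 (p : ℝ) (j : ℕ) (u0 : ℝ → ℝ) (u : ℝ → ℝ → ℝ) : Prop where
  cont : ContinuousOn (fun q : ℝ × ℝ => u q.1 q.2) (Icc (-1:ℝ) 1 ×ˢ Ici (0:ℝ))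
  nonneg : ∀ x ∈ Icc (-1:ℝ) 1, ∀ t ∈ Ici (0:ℝ), 0 ≤ u x t
  time_reg : ∀ x ∈ Ioo (-1:ℝ) 1, ContDiffOn ℝ 1 (fun s => u x s) (Ioi (0:ℝ))
  space_reg : ∀ t ∈ Ioi (0:ℝ), ContDiffOn ℝ 2 (fun y => u y t) (Ioo (-1:ℝ) 1)
  eqn : ∀ x ∈ Ioo (-1:ℝ) 1, ∀ t ∈ Ioi (0:ℝ),
    deriv (fun s => u x s) t
      = deriv (deriv (fun y => u y t)) x + Fj1 p j (deriv (fun y => u y t) x)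
  bc : ∀ t ∈ Ioi (0:ℝ), u (-1) t = 0 ∧ u 1 t = 0
  ic : ∀ x ∈ Icc (-1:ℝ) 1, u x 0 = u0 x

/-- `u` is a global classical solution of the Dirichlet problem
`∂ₜu = ∂ₓₓu + |∂ₓu|^p` in `(-1,1) × (0,∞)`, `u(±1,·) = 0`, `u(·,0) = u₀`, with `u` and `∂ₓu`
extending continuously to `[-1,1] × [0,∞)`. Its existence means `T*(u₀) = ∞`. -/
structure IsClassicalSol1Global (p : ℝ) (u0 : ℝ → ℝ) (u : ℝ → ℝ → ℝ) : Prop where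
  cont : ContinuousOn (fun q : ℝ × ℝ => u q.1 q.2) (Icc (-1:ℝ) 1 ×ˢ Ici (0:ℝ))
  deriv_cont : ∃ G : ℝ × ℝ → ℝ, ContinuousOn G (Icc (-1:ℝ) 1 ×ˢ Ici (0:ℝ)) ∧
    ∀ x ∈ Ioo (-1:ℝ) 1, ∀ t ∈ Ioi (0:ℝ), G (x, t) = deriv (fun y => u y t) x
  time_reg : ∀ x ∈ Ioo (-1:ℝ) 1, ContDiffOn ℝ 1 (fun s => u x s) (Ioi (0:ℝ))
  space_reg : ∀ t ∈ Ioi (0:ℝ), ContDiffOn ℝ 2 (fun y => u y t) (Ioo (-1:ℝ) 1)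
  eqn : ∀ x ∈ Ioo (-1:ℝ) 1, ∀ t ∈ Ioi (0:ℝ),
    deriv (fun s => u x s) t
      = deriv (deriv (fun y => u y t)) x + |deriv (fun y => u y t) x| ^ p
  bc : ∀ t ∈ Ici (0:ℝ), u (-1) t = 0 ∧ u 1 t = 0
  ic : ∀ x ∈ Icc (-1:ℝ) 1, u x 0 = u0 x

/-- The pointwise supremum `U(x,t) = sup_{j ≥ 1} u_j(x,t)` of a family of approximating
solutions; on `(-1,1) × (0,∞)` this coincides with the global viscosity solution. -/
def Usup1 (u : ℕ → ℝ → ℝ → ℝ) (x t : ℝ) : ℝ :=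
  ⨆ j : {j : ℕ // 1 ≤ j}, u j.1 x t

/-- The function `u` of space and time has at `(x, t)` the time derivative `ut` and the first and
second space derivatives `ux`, `uxx`. -/
structure HasJet (u : ℝ → ℝ → ℝ) (x t ut ux uxx : ℝ) : Prop where
  time : HasDerivAt (fun s => u x s) ut t
  space : ∃ g : ℝ → ℝ, (∀ᶠ y in 𝓝 x, HasDerivAt (fun y => u y t) (g y) y) ∧ g x = ux ∧
    HasDerivAt g uxx x

namespace HasJet

variable {u v : ℝ → ℝ → ℝ} {x t ut ux uxx vt vx vxx : ℝ}

theorem add (hu : HasJet u x t ut ux uxx) (hv : HasJet v x t vt vx vxx) :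
    HasJet (fun x t => u x t + v x t) x t (ut + vt) (ux + vx) (uxx + vxx) := by
  obtain ⟨g, hg, hgx, hgd⟩ := hu.space
  obtain ⟨k, hk, hkx, hkd⟩ := hv.space
  refine ⟨hu.time.add hv.time, fun y => g y + k y, ?_, by simp only [hgx, hkx], hgd.add hkd⟩
  filter_upwards [hg, hk] with y h1 h2 using h1.add h2

theorem sub (hu : HasJet u x t ut ux uxx) (hv : HasJet v x t vt vx vxx) :
    HasJet (fun x t => u x t - v x t) x t (ut - vt) (ux - vx) (uxx - vxx) := by
  obtain ⟨g, hg, hgx, hgd⟩ := hu.space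
  obtain ⟨k, hk, hkx, hkd⟩ := hv.space
  refine ⟨hu.time.sub hv.time, fun y => g y - k y, ?_, by simp only [hgx, hkx], hgd.sub hkd⟩
  filter_upwards [hg, hk] with y h1 h2 using h1.sub h2

theorem const_mul (c : ℝ) (hu : HasJet u x t ut ux uxx) :
    HasJet (fun x t => c * u x t) x t (c * ut) (c * ux) (c * uxx) := by
  obtain ⟨g, hg, hgx, hgd⟩ := hu.space
  refine ⟨hu.time.const_mul c, fun y => c * g y, ?_, by simp only [hgx], hgd.const_mul c⟩
  filter_upwards [hg] with y h1 using h1.const_mul c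

theorem shift (a b : ℝ) (hu : HasJet u (x + a) (t + b) ut ux uxx) :
    HasJet (fun x t => u (x + a) (t + b)) x t ut ux uxx := by
  obtain ⟨g, hg, hgx, hgd⟩ := hu.space
  refine ⟨hu.time.comp_add_const t b, fun y => g (y + a), ?_, hgx, hgd.comp_add_const x a⟩
  have hc : Tendsto (fun y => y + a) (𝓝 x) (𝓝 (x + a)) :=
    (continuous_id.add continuous_const).tendsto x
  filter_upwards [hc.eventually hg] with y h1 using h1.comp_add_const y a

theorem reflect (hu : HasJet u (-x) t ut ux uxx) :
    HasJet (fun x t => u (-x) t) x t ut (-ux) uxx := by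
  obtain ⟨g, hg, hgx, hgd⟩ := hu.space
  refine ⟨hu.time, fun y => - g (-y), ?_, by simp only [hgx], ?_⟩
  · filter_upwards [(continuous_neg.tendsto x).eventually hg] with y h1
    simpa [Function.comp_def] using h1.comp y (hasDerivAt_neg y)
  · simpa [Function.comp_def] using (hgd.comp x (hasDerivAt_neg x)).fun_neg

/-- A function of the space variable only. -/
theorem of_space {f f' : ℝ → ℝ} {f'' : ℝ} (hf : ∀ᶠ y in 𝓝 x, HasDerivAt f (f' y) y)
    (hf' : HasDerivAt f' f'' x) : HasJet (fun x _ => f x) x t 0 (f' x) f'' :=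
  ⟨hasDerivAt_const t _, f', hf, rfl, hf'⟩

/-- A function of the time variable only. -/
theorem of_time {f : ℝ → ℝ} {f' : ℝ} (hf : HasDerivAt f f' t) :
    HasJet (fun _ t => f t) x t f' 0 0 :=
  ⟨hf, fun _ => 0, Eventually.of_forall fun y => hasDerivAt_const y _, rfl, hasDerivAt_const x _⟩

end HasJet

/-- At a local maximum where the function is twice differentiable the first derivative vanishes
and the second one is nonpositive. -/
theorem IsLocalMax.second_deriv_nonpos {f g : ℝ → ℝ} {x c : ℝ} (h : IsLocalMax f x)
    (hf : ∀ᶠ y in 𝓝 x, HasDerivAt f (g y) y) (hg : HasDerivAt g c x) : g x = 0 ∧ c ≤ 0 := by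
  have hgx : g x = 0 := h.hasDerivAt_eq_zero hf.self_of_nhds
  refine ⟨hgx, ?_⟩
  by_contra! hc
  have hdf : deriv f =ᶠ[𝓝 x] g := hf.mono fun y hy => hy.deriv
  have hdd : deriv (deriv f) x = c := hdf.deriv_eq.trans hg.deriv
  have hmin : IsLocalMin f x := isLocalMin_of_deriv_deriv_pos (by rw [hdd]; exact hc)
    (by rw [hf.self_of_nhds.deriv, hgx]) hf.self_of_nhds.continuousAt
  have hconst : f =ᶠ[𝓝 x] fun _ => f x := by
    filter_upwards [h, hmin] with y h1 h2 using le_antisymm h1 h2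
  have h1 : deriv f =ᶠ[𝓝 x] fun _ => 0 := by
    filter_upwards [hconst.eventually_nhds] with y hy
    rw [Filter.EventuallyEq.deriv_eq hy]; simp
  have : deriv (deriv f) x = 0 := by rw [h1.deriv_eq]; simp
  linarith

/-- The weak parabolic maximum principle on a rectangle, for a function whose equation is only
known at spatial critical points. -/
theorem parabolic_max_principle {w : ℝ → ℝ → ℝ} {a b T : ℝ}
    (hw : ContinuousOn (fun q : ℝ × ℝ => w q.1 q.2) (Icc a b ×ˢ Icc 0 T))
    (h0 : ∀ x ∈ Icc a b, w x 0 ≤ 0) (ha : ∀ t ∈ Icc 0 T, w a t ≤ 0)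
    (hb : ∀ t ∈ Icc 0 T, w b t ≤ 0)
    (hInt : ∀ x ∈ Ioo a b, ∀ t ∈ Ioc 0 T, ∃ wt wx wxx, HasJet w x t wt wx wxx ∧
      (wx = 0 → wxx ≤ 0 → wt ≤ 0)) :
    ∀ x ∈ Icc a b, ∀ t ∈ Icc 0 T, w x t ≤ 0 := by
  intro x₀ hx₀ t₀ ht₀
  by_contra! hpos
  have hT : 0 ≤ T := ht₀.1.trans ht₀.2
  set ε := w x₀ t₀ / (2 * (T + 1)) with hε
  have hεpos : 0 < ε := by positivity
  have hεT : ε * T < w x₀ t₀ := by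
    have : ε * (2 * (T + 1)) = w x₀ t₀ := by rw [hε]; field_simp
    nlinarith
  obtain ⟨⟨x, t⟩, ⟨hx, ht⟩, hmax⟩ := (isCompact_Icc.prod isCompact_Icc).exists_isMaxOn
    ⟨(x₀, t₀), hx₀, ht₀⟩ (hw.sub (f := fun q : ℝ × ℝ => w q.1 q.2)
      (g := fun q : ℝ × ℝ => ε * q.2) (by fun_prop))
  simp only at hx ht
  have hM : ∀ y ∈ Icc a b, ∀ s ∈ Icc 0 T, w y s - ε * s ≤ w x t - ε * t := by
    intro y hy s hs
    exact hmax (show (y, s) ∈ Icc a b ×ˢ Icc 0 T from ⟨hy, hs⟩)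
  have hwpos : 0 < w x t := by
    have h1 := hM x₀ hx₀ t₀ ht₀
    have : ε * t₀ ≤ ε * T := by gcongr; exact ht₀.2
    have : 0 ≤ ε * t := mul_nonneg hεpos.le ht.1
    linarith
  have hxa : x ≠ a := by rintro rfl; exact absurd (ha t ht) (not_le.2 hwpos)
  have hxb : x ≠ b := by rintro rfl; exact absurd (hb t ht) (not_le.2 hwpos)
  have ht0 : t ≠ 0 := by rintro rfl; exact absurd (h0 x hx) (not_le.2 hwpos)
  have hx' : x ∈ Ioo a b := ⟨lt_of_le_of_ne hx.1 (Ne.symm hxa), lt_of_le_of_ne hx.2 hxb⟩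
  have ht' : t ∈ Ioc 0 T := ⟨lt_of_le_of_ne ht.1 (Ne.symm ht0), ht.2⟩
  obtain ⟨wt, wx, wxx, hj, himp⟩ := hInt x hx' t ht'
  obtain ⟨g, hg, hgx, hgd⟩ := hj.space
  have hlm : IsLocalMax (fun y => w y t) x := by
    filter_upwards [Ioo_mem_nhds hx'.1 hx'.2] with y hy
    have := hM y (Ioo_subset_Icc_self hy) t ht
    linarith
  obtain ⟨h1, h2⟩ := hlm.second_deriv_nonpos hg hgd
  have hwt := himp (hgx ▸ h1) h2
  have hd : HasDerivAt (fun s => w x s - ε * s) (wt - ε) t := by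
    simpa using hj.time.fun_sub ((hasDerivAt_id' t).const_mul ε)
  have hneg : wt - ε < 0 := by linarith
  have hsl := (hasDerivWithinAt_iff_tendsto_slope' self_notMem_Iio).1
    (hd.hasDerivWithinAt (s := Iio t))
  obtain ⟨s, hs1, hs2⟩ := ((hsl.eventually_lt_const hneg).and (Ioo_mem_nhdsLT ht'.1)).exists
  have h3 := hM x hx s ⟨hs2.1.le, hs2.2.le.trans ht.2⟩
  rw [slope_def_field, div_neg_iff] at hs1
  rcases hs1 with h4 | h4 <;> linarith [hs2.2]

/-- Comparison of sub- and supersolutions of `u_t = u_xx + H(u_x)` on a rectangle. -/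
theorem parabolic_comparison {H : ℝ → ℝ} {u v : ℝ → ℝ → ℝ} {a b T : ℝ}
    (hu : ContinuousOn (fun q : ℝ × ℝ => u q.1 q.2) (Icc a b ×ˢ Icc 0 T))
    (hv : ContinuousOn (fun q : ℝ × ℝ => v q.1 q.2) (Icc a b ×ˢ Icc 0 T))
    (h0 : ∀ x ∈ Icc a b, u x 0 ≤ v x 0) (ha : ∀ t ∈ Icc 0 T, u a t ≤ v a t)
    (hb : ∀ t ∈ Icc 0 T, u b t ≤ v b t)
    (hsub : ∀ x ∈ Ioo a b, ∀ t ∈ Ioc 0 T, ∃ ut ux uxx, HasJet u x t ut ux uxx ∧ ut ≤ uxx + H ux)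
    (hsup : ∀ x ∈ Ioo a b, ∀ t ∈ Ioc 0 T, ∃ vt vx vxx, HasJet v x t vt vx vxx ∧
      vxx + H vx ≤ vt) :
    ∀ x ∈ Icc a b, ∀ t ∈ Icc 0 T, u x t ≤ v x t := by
  have := parabolic_max_principle (w := fun x t => u x t - v x t) (hu.sub hv)
    (fun x hx => sub_nonpos.2 (h0 x hx)) (fun t ht => sub_nonpos.2 (ha t ht))
    (fun t ht => sub_nonpos.2 (hb t ht)) (fun x hx t ht => by
      obtain ⟨ut, ux, uxx, hj, h1⟩ := hsub x hx t ht
      obtain ⟨vt, vx, vxx, hk, h2⟩ := hsup x hx t ht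
      refine ⟨_, _, _, hj.sub hk, fun h3 h4 => ?_⟩
      rw [sub_eq_zero] at h3
      subst h3
      linarith)
  exact fun x hx t ht => sub_nonpos.1 (this x hx t ht)

/-- The standard Gaussian measure on the line. -/
abbrev stdGauss : Measure ℝ := ProbabilityTheory.gaussianReal 0 1

theorem stdGauss_integrable_pow (n : ℕ) : Integrable (fun ζ : ℝ => ζ ^ n) stdGauss := by
  have h := (ProbabilityTheory.memLp_id_gaussianReal' (μ := 0) (v := 1) (n : ENNReal)
    (by simp)).integrable_norm_pow'
  refine h.mono (by fun_prop) (Eventually.of_forall fun ζ => ?_)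
  simp

theorem stdGauss_integrable_quartic :
    Integrable (fun ζ : ℝ => (1 + ζ ^ 2) ^ 2) stdGauss := by
  have := ((integrable_const (1 : ℝ)).add ((stdGauss_integrable_pow 2).const_mul 2)).add
    (stdGauss_integrable_pow 4)
  refine this.congr (Eventually.of_forall fun ζ => ?_)
  simp only [Pi.add_apply]; ring

theorem stdGauss_integral_sq : ∫ ζ, ζ ^ 2 ∂stdGauss = 1 := by
  have h := ProbabilityTheory.variance_fun_id_gaussianReal (μ := 0) (v := 1)
  rw [ProbabilityTheory.variance_eq_integral (by fun_prop)] at h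
  simpa [ProbabilityTheory.integral_id_gaussianReal] using h

theorem stdGauss_integral_one_add_sq : ∫ ζ, (1 + ζ ^ 2) ∂stdGauss = 2 := by
  rw [integral_add (integrable_const _) (stdGauss_integrable_pow 2), stdGauss_integral_sq]
  simp; norm_num

/-- The constant `∫ (1 + ζ²)² dγ`. -/
def gaussQuartic : ℝ := ∫ ζ, (1 + ζ ^ 2) ^ 2 ∂stdGauss

/-- Gaussian average of `f` at scale `σ` around `x`, with weight `k`. -/
def heatAvg (k : ℝ → ℝ) (σ : ℝ) (f : ℝ → ℝ) (x : ℝ) : ℝ :=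
  ∫ ζ, k ζ * f (x + σ * ζ) ∂stdGauss

/-- The weights allowed in `heatAvg`. -/
structure GaussWeight (k : ℝ → ℝ) : Prop where
  cont : Continuous k
  bound : ∀ ζ, |k ζ| ≤ 1 + ζ ^ 2

theorem gaussWeight_one : GaussWeight fun _ => 1 :=
  ⟨continuous_const, fun ζ => by simp; positivity⟩

theorem gaussWeight_id : GaussWeight fun ζ => ζ :=
  ⟨continuous_id, fun ζ => abs_le.2 ⟨by nlinarith [sq_nonneg (ζ + 1)],
    by nlinarith [sq_nonneg (ζ - 1)]⟩⟩

theorem gaussWeight_hermite : GaussWeight fun ζ => ζ ^ 2 - 1 :=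
  ⟨by fun_prop, fun ζ => abs_le.2 ⟨by nlinarith [sq_nonneg ζ], by nlinarith⟩⟩

theorem growth_bound {N x σ ζ f : ℝ} (hN : 0 ≤ N) (hσ : 0 ≤ σ)
    (hf : |f| ≤ N * (1 + |x + σ * ζ|)) : |f| ≤ N * (1 + |x| + σ) * (1 + ζ ^ 2) := by
  have h1 : |x + σ * ζ| ≤ |x| + σ * |ζ| := by
    refine (abs_add_le _ _).trans ?_
    rw [abs_mul, abs_of_nonneg hσ]
  have h2 : |ζ| ≤ 1 + ζ ^ 2 := gaussWeight_id.bound ζ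
  have h3 : 1 + |x + σ * ζ| ≤ (1 + |x| + σ) * (1 + ζ ^ 2) := by
    nlinarith [abs_nonneg x, sq_nonneg ζ, mul_le_mul_of_nonneg_left h2 hσ,
      mul_nonneg (abs_nonneg x) (sq_nonneg ζ)]
  calc |f| ≤ N * (1 + |x + σ * ζ|) := hf
    _ ≤ N * ((1 + |x| + σ) * (1 + ζ ^ 2)) := by gcongr
    _ = _ := by ring

namespace GaussWeight

variable {k : ℝ → ℝ}

theorem integrable_mul (hk : GaussWeight k) {g : ℝ → ℝ} {C : ℝ}
    (hg : AEStronglyMeasurable g stdGauss) (hC : ∀ ζ, |g ζ| ≤ C * (1 + ζ ^ 2)) :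
    Integrable (fun ζ => k ζ * g ζ) stdGauss := by
  refine (stdGauss_integrable_quartic.const_mul C).mono'
    (hk.cont.aestronglyMeasurable.mul hg) (Eventually.of_forall fun ζ => ?_)
  rw [Real.norm_eq_abs, abs_mul]
  have := hk.bound ζ
  have h2 := hC ζ
  calc |k ζ| * |g ζ| ≤ (1 + ζ ^ 2) * (C * (1 + ζ ^ 2)) := by gcongr
    _ = _ := by ring

theorem integrable_bdd (hk : GaussWeight k) {f : ℝ → ℝ} (hf : Measurable f) {N : ℝ}
    (hN : ∀ x, |f x| ≤ N) (σ x : ℝ) :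
    Integrable (fun ζ => k ζ * f (x + σ * ζ)) stdGauss := by
  refine hk.integrable_mul (C := N) (hf.comp (by fun_prop)).aestronglyMeasurable fun ζ => ?_
  have h0 : 0 ≤ N := (abs_nonneg _).trans (hN 0)
  exact (hN _).trans (by nlinarith [mul_nonneg h0 (sq_nonneg ζ)])

theorem abs_heatAvg_le (hk : GaussWeight k) {f : ℝ → ℝ} {N : ℝ}
    (hN : ∀ x, |f x| ≤ N) (σ x : ℝ) : |heatAvg k σ f x| ≤ 2 * N := by
  have h0 : 0 ≤ N := (abs_nonneg _).trans (hN 0)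
  have hi : Integrable (fun ζ : ℝ => (1 + ζ ^ 2) * N) stdGauss :=
    ((integrable_const _).add (stdGauss_integrable_pow 2)).mul_const N
  have := norm_integral_le_of_norm_le (f := fun ζ => k ζ * f (x + σ * ζ)) hi
    (Eventually.of_forall fun ζ => by
      rw [Real.norm_eq_abs, abs_mul]
      exact mul_le_mul (hk.bound ζ) (hN _) (abs_nonneg _) (by positivity))
  rw [integral_mul_const, stdGauss_integral_one_add_sq] at this
  exact this

/-- Joint continuity of Gaussian averages in the parameters. -/
theorem continuousAt_heatAvg (hk : GaussWeight k) {f : ℝ → ℝ → ℝ} {N : ℝ}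
    (hf : ∀ s, Measurable fun x => f x s) (hN : ∀ x s, |f x s| ≤ N * (1 + |x|))
    {x₀ s₀ σ₀ : ℝ} (hσ : 0 ≤ σ₀)
    (hc : ∀ᵐ ζ ∂stdGauss, ContinuousAt (fun q : ℝ × ℝ => f q.1 q.2) (x₀ + σ₀ * ζ, s₀)) :
    ContinuousAt (fun q : ℝ × ℝ × ℝ => heatAvg k |q.2.2| (fun y => f y q.2.1) q.1)
      (x₀, s₀, σ₀) := by
  have h0 : 0 ≤ N := by simpa using (abs_nonneg _).trans (hN 0 0)
  have hev : ∀ᶠ q : ℝ × ℝ × ℝ in 𝓝 (x₀, s₀, σ₀), |q.1| ≤ |x₀| + 1 ∧ |q.2.2| ≤ σ₀ + 1 := by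
    have h1 : ContinuousAt (fun q : ℝ × ℝ × ℝ => |q.1|) (x₀, s₀, σ₀) := by fun_prop
    have h2 : ContinuousAt (fun q : ℝ × ℝ × ℝ => |q.2.2|) (x₀, s₀, σ₀) := by fun_prop
    refine (h1.eventually_le_const (show _ < |x₀| + 1 by simp)).and
      (h2.eventually_le_const (show _ < σ₀ + 1 by simp [abs_of_nonneg hσ]))
  refine continuousAt_of_dominated
    (bound := fun ζ => (N * (1 + (|x₀| + 1) + (σ₀ + 1))) * (1 + ζ ^ 2) ^ 2) ?_ ?_
    (stdGauss_integrable_quartic.const_mul _) ?_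
  · refine Eventually.of_forall fun q => ?_
    exact hk.cont.aestronglyMeasurable.mul ((hf _).comp (by fun_prop)).aestronglyMeasurable
  · filter_upwards [hev] with q hq
    refine Eventually.of_forall fun ζ => ?_
    rw [Real.norm_eq_abs, abs_mul]
    have h2 := growth_bound h0 (abs_nonneg _) (hN (q.1 + |q.2.2| * ζ) q.2.1)
    calc |k ζ| * |f (q.1 + |q.2.2| * ζ) q.2.1|
        ≤ (1 + ζ ^ 2) * (N * (1 + |q.1| + |q.2.2|) * (1 + ζ ^ 2)) := by
          gcongr; exact hk.bound ζ
      _ ≤ (1 + ζ ^ 2) * (N * (1 + (|x₀| + 1) + (σ₀ + 1)) * (1 + ζ ^ 2)) := by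
          gcongr <;> linarith [hq.1, hq.2]
      _ = _ := by ring
  · filter_upwards [hc] with ζ hζ
    refine continuousAt_const.mul ?_
    have h3 : ContinuousAt (fun q : ℝ × ℝ × ℝ => (q.1 + |q.2.2| * ζ, q.2.1)) (x₀, s₀, σ₀) := by
      fun_prop
    exact ContinuousAt.comp (g := fun q : ℝ × ℝ => f q.1 q.2)
      (by simpa [abs_of_nonneg hσ] using hζ) h3

end GaussWeight

theorem heatAvg_eq_lebesgue {k : ℝ → ℝ} {σ : ℝ} (hσ : 0 < σ) (f : ℝ → ℝ) (x : ℝ) :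
    heatAvg k σ f x = (√(2 * Real.pi))⁻¹ *
      ∫ z, k (z - x / σ) * Real.exp (-(z - x / σ) ^ 2 / 2) * f (σ * z) := by
  rw [heatAvg, stdGauss, ProbabilityTheory.integral_gaussianReal_eq_integral_smul one_ne_zero,
    ← integral_const_mul, ← integral_sub_right_eq_self _ (x / σ)]
  congr 1 with z
  rw [ProbabilityTheory.gaussianPDFReal]
  have : x + σ * (z - x / σ) = σ * z := by field_simp; ring
  rw [this]
  simp
  ring

theorem abs_le_four_exp (ζ : ℝ) : (1 + ζ ^ 2) * Real.exp (-ζ ^ 2 / 2) ≤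
    4 * Real.exp (-ζ ^ 2 / 4) := by
  have h1 : 1 + ζ ^ 2 ≤ 4 * Real.exp (ζ ^ 2 / 4) := by
    have := Real.add_one_le_exp (ζ ^ 2 / 4)
    nlinarith
  calc (1 + ζ ^ 2) * Real.exp (-ζ ^ 2 / 2) ≤ 4 * Real.exp (ζ ^ 2 / 4) * Real.exp (-ζ ^ 2 / 2) := by
        gcongr
    _ = 4 * Real.exp (-ζ ^ 2 / 4) := by
        rw [mul_assoc, ← Real.exp_add]; congr 2; ring

theorem exp_shift_le {z y y₀ : ℝ} (h : |y - y₀| ≤ 1) :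
    Real.exp (-(z - y) ^ 2 / 4) ≤ Real.exp (1 / 4) * Real.exp (-(1 / 8) * (z - y₀) ^ 2) := by
  rw [← Real.exp_add, Real.exp_le_exp]
  have := abs_le.1 h
  nlinarith [sq_nonneg (z - y - (y - y₀)), sq_nonneg (z - y + (y - y₀)),
    mul_nonneg (sub_nonneg.2 this.1) (sub_nonneg.2 this.2)]

/-- Differentiation of a Gaussian average in the space variable, the derivative falling on the
kernel. -/
theorem hasDerivAt_heatAvg {k k₁ k' : ℝ → ℝ} (hk : GaussWeight k) (hk₁ : GaussWeight k₁)
    (hd : ∀ ζ, HasDerivAt k (k' ζ) ζ) (hkk : ∀ ζ, k' ζ - ζ * k ζ = - k₁ ζ)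
    {f : ℝ → ℝ} (hf : Measurable f) {N : ℝ} (hN : ∀ x, |f x| ≤ N) {σ : ℝ} (hσ : 0 < σ) (x : ℝ) :
    HasDerivAt (heatAvg k σ f) (σ⁻¹ * heatAvg k₁ σ f x) x := by
  have h0 : 0 ≤ N := (abs_nonneg _).trans (hN 0)
  set Φ : ℝ → ℝ → ℝ := fun y z => k (z - y) * Real.exp (-(z - y) ^ 2 / 2) * f (σ * z)
  set Φ₁ : ℝ → ℝ → ℝ := fun y z => k₁ (z - y) * Real.exp (-(z - y) ^ 2 / 2) * f (σ * z)
  have hmeas : ∀ {m : ℝ → ℝ}, Continuous m → ∀ y : ℝ, AEStronglyMeasurable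
      (fun z => m (z - y) * Real.exp (-(z - y) ^ 2 / 2) * f (σ * z)) volume := by
    intro m hm y
    have h1 : Measurable fun z => f (σ * z) := hf.comp (by fun_prop)
    have h2 : Continuous fun z => m (z - y) * Real.exp (-(z - y) ^ 2 / 2) := by fun_prop
    exact (h2.measurable.mul h1).aestronglyMeasurable
  have hbd : ∀ {m : ℝ → ℝ}, GaussWeight m → ∀ y₀ : ℝ, ∀ y ∈ closedBall y₀ 1, ∀ z,
      ‖m (z - y) * Real.exp (-(z - y) ^ 2 / 2) * f (σ * z)‖
        ≤ 4 * Real.exp (1 / 4) * N * Real.exp (-(1 / 8) * (z - y₀) ^ 2) := by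
    intro m hm y₀ y hy z
    rw [Real.norm_eq_abs, abs_mul, abs_mul, Real.abs_exp]
    have h1 := hm.bound (z - y)
    calc _ ≤ (1 + (z - y) ^ 2) * Real.exp (-(z - y) ^ 2 / 2) * N := by gcongr; exact hN _
      _ ≤ (4 * Real.exp (-(z - y) ^ 2 / 4)) * N :=
          mul_le_mul_of_nonneg_right (abs_le_four_exp _) h0
      _ ≤ (4 * (Real.exp (1 / 4) * Real.exp (-(1 / 8) * (z - y₀) ^ 2))) * N := by
          gcongr
          exact exp_shift_le (by simpa [Real.dist_eq] using hy)
      _ = _ := by ring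
  have hInt : ∀ y₀ : ℝ, Integrable
      (fun z => 4 * Real.exp (1 / 4) * N * Real.exp (-(1 / 8) * (z - y₀) ^ 2)) := fun y₀ =>
    ((integrable_exp_neg_mul_sq (by norm_num : (0 : ℝ) < 1 / 8)).comp_sub_right y₀).const_mul _
  have hder : HasDerivAt (fun y => ∫ z, Φ y z) (∫ z, Φ₁ (x / σ) z) (x / σ) := by
    refine (hasDerivAt_integral_of_dominated_loc_of_deriv_le (F := Φ) (F' := Φ₁)
      (closedBall_mem_nhds (x / σ) one_pos)
      (Eventually.of_forall fun y => hmeas hk.cont y) ?_ (hmeas hk₁.cont _)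
      (Eventually.of_forall fun z y hy => hbd hk₁ (x / σ) y hy z) (hInt _)
      (Eventually.of_forall fun z y _ => ?_)).2
    · exact (hInt (x / σ)).mono' (hmeas hk.cont _)
        (Eventually.of_forall fun z => hbd hk _ _ (mem_closedBall_self zero_le_one) z)
    · have e1 : HasDerivAt (fun y => z - y) (-1) y := by
        simpa using (hasDerivAt_id' y).const_sub z
      have e2 : HasDerivAt (fun y => k (z - y)) (-k' (z - y)) y := by
        have := (hd (z - y)).comp y e1
        rwa [mul_neg_one] at this
      have e3 : HasDerivAt (fun y => -(z - y) ^ 2 / 2) (z - y) y := by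
        have := ((e1.fun_pow 2).fun_neg).div_const 2
        refine this.congr_deriv ?_
        push_cast; ring
      have e4 := ((e2.fun_mul e3.exp).mul_const (f (σ * z)))
      refine e4.congr_deriv ?_
      have : k₁ (z - y) = (z - y) * k (z - y) - k' (z - y) := by linarith [hkk (z - y)]
      simp only [Φ₁, this]; ring
  have h1 : HasDerivAt (fun x => x / σ) (σ⁻¹) x := by simpa using (hasDerivAt_id' x).div_const σ
  have h2 := (hder.comp x h1).const_mul (√(2 * Real.pi))⁻¹
  have h3 : heatAvg k σ f = fun x => (√(2 * Real.pi))⁻¹ * ∫ z, Φ (x / σ) z :=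
    funext fun x => heatAvg_eq_lebesgue hσ f x
  rw [h3, heatAvg_eq_lebesgue hσ]
  refine h2.congr_deriv ?_
  simp only [Φ₁]
  ring

theorem hasDerivAt_heatAvg_one {f : ℝ → ℝ} (hf : Measurable f) {N : ℝ} (hN : ∀ x, |f x| ≤ N)
    {σ : ℝ} (hσ : 0 < σ) (x : ℝ) : HasDerivAt (heatAvg (fun _ => 1) σ f)
      (σ⁻¹ * heatAvg (fun ζ => ζ) σ f x) x :=
  hasDerivAt_heatAvg (k' := fun _ => 0) gaussWeight_one gaussWeight_id
    (fun ζ => hasDerivAt_const ζ _) (fun ζ => by ring) hf hN hσ x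

theorem hasDerivAt_heatAvg_id {f : ℝ → ℝ} (hf : Measurable f) {N : ℝ} (hN : ∀ x, |f x| ≤ N)
    {σ : ℝ} (hσ : 0 < σ) (x : ℝ) : HasDerivAt (heatAvg (fun ζ => ζ) σ f)
      (σ⁻¹ * heatAvg (fun ζ => ζ ^ 2 - 1) σ f x) x :=
  hasDerivAt_heatAvg (k' := fun _ => 1) gaussWeight_id gaussWeight_hermite
    (fun ζ => hasDerivAt_id' ζ) (fun ζ => by ring) hf hN hσ x

/-- The average of a `C¹` function with bounded derivative, the derivative falling on the
function. -/
theorem hasDerivAt_heatAvg_of_hasDerivAt {k : ℝ → ℝ} (hk : GaussWeight k) {f f' : ℝ → ℝ}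
    (hd : ∀ x, HasDerivAt f (f' x) x) (hf' : Measurable f') {N : ℝ} (hN : ∀ x, |f' x| ≤ N)
    {C : ℝ} (hC : 0 ≤ C) (hf : ∀ x, |f x| ≤ C * (1 + |x|)) {σ : ℝ} (hσ : 0 ≤ σ) (x : ℝ) :
    HasDerivAt (heatAvg k σ f) (heatAvg k σ f' x) x := by
  have hcf : Continuous f := continuous_iff_continuousAt.2 fun x => (hd x).continuousAt
  have h0 : 0 ≤ N := (abs_nonneg _).trans (hN 0)
  refine (hasDerivAt_integral_of_dominated_loc_of_deriv_le (μ := stdGauss)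
    (F := fun x ζ => k ζ * f (x + σ * ζ)) (F' := fun x ζ => k ζ * f' (x + σ * ζ))
    (bound := fun ζ => (1 + ζ ^ 2) * N) univ_mem
    (Eventually.of_forall fun y => ?_) ?_ ?_ (Eventually.of_forall fun ζ y _ => ?_)
    (((integrable_const _).add (stdGauss_integrable_pow 2)).mul_const N)
    (Eventually.of_forall fun ζ y _ => ?_)).2
  · exact (hk.cont.mul (by fun_prop)).aestronglyMeasurable
  · exact hk.integrable_mul (C := C * (1 + |x| + σ)) (by fun_prop)
      fun ζ => growth_bound hC hσ (hf _)
  · exact hk.cont.aestronglyMeasurable.mul (hf'.comp (by fun_prop)).aestronglyMeasurable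
  · rw [Real.norm_eq_abs, abs_mul]
    exact mul_le_mul (hk.bound ζ) (hN _) (abs_nonneg _) (by positivity)
  · exact ((hd (y + σ * ζ)).comp_add_const y (σ * ζ)).const_mul (k ζ)

/-- The semigroup property of Gaussian averages. -/
theorem heatAvg_heatAvg {f : ℝ → ℝ} (hf : Measurable f) {C : ℝ} (hC : 0 ≤ C)
    (hfb : ∀ x, |f x| ≤ C * (1 + |x|)) (a b x : ℝ) :
    heatAvg (fun _ => 1) a (heatAvg (fun _ => 1) b f) x =
      heatAvg (fun _ => 1) (√(a ^ 2 + b ^ 2)) f x := by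
  have hmap : ∀ c : ℝ, stdGauss.map (c * ·) =
      ProbabilityTheory.gaussianReal 0 (Real.toNNReal (c ^ 2)) := by
    intro c
    rw [stdGauss, ProbabilityTheory.gaussianReal_map_const_mul]
    congr 1
    · simp
    · ext; simp [sq_nonneg]
  have hconv : (stdGauss.map (a * ·)) ∗ (stdGauss.map (b * ·)) =
      stdGauss.map (√(a ^ 2 + b ^ 2) * ·) := by
    rw [hmap, hmap, hmap, ProbabilityTheory.gaussianReal_conv_gaussianReal, add_zero,
      Real.sq_sqrt (by positivity), Real.toNNReal_add (sq_nonneg _) (sq_nonneg _)]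
  have hmf : Measurable fun w => f (x + w) := hf.comp (by fun_prop)
  have hmm : ∀ c : ℝ, Measurable fun y : ℝ => c * y := fun c => by fun_prop
  have hpull : ∀ c : ℝ, ∀ g : ℝ → ℝ, Measurable g →
      ∫ w, g w ∂(stdGauss.map (c * ·)) = ∫ ζ, g (c * ζ) ∂stdGauss := fun c g hg =>
    integral_map (hmm c).aemeasurable hg.aestronglyMeasurable
  have hintc : Integrable (fun w => f (x + w))
      ((stdGauss.map (a * ·)) ∗ (stdGauss.map (b * ·))) := by
    rw [hconv]
    refine (integrable_map_measure hmf.aestronglyMeasurable (hmm _).aemeasurable).2 ?_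
    have := gaussWeight_one.integrable_mul (C := C * (1 + |x| + √(a ^ 2 + b ^ 2)))
      (g := fun ζ => f (x + √(a ^ 2 + b ^ 2) * ζ))
      (hf.comp (by fun_prop)).aestronglyMeasurable
      fun ζ => growth_bound hC (Real.sqrt_nonneg _) (hfb _)
    simpa [Function.comp_def] using this
  have h1 := integral_conv hintc
  rw [hconv, hpull _ _ hmf] at h1
  have hmeas2 : Measurable fun u => ∫ w, f (x + (u + w)) ∂(stdGauss.map (b * ·)) := by
    have hm2 : Measurable fun q : ℝ × ℝ => f (x + (q.1 + q.2)) := hf.comp (by fun_prop)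
    have : IsProbabilityMeasure (stdGauss.map (b * ·)) :=
      Measure.isProbabilityMeasure_map (hmm b).aemeasurable
    exact hm2.stronglyMeasurable.integral_prod_right.measurable
  rw [hpull _ _ hmeas2] at h1
  simp only [heatAvg, one_mul]
  rw [h1]
  congr 1 with ζ
  rw [hpull b (fun w => f (x + (a * ζ + w))) (hf.comp (by fun_prop))]
  simp only [add_assoc]

/-- Admissible right-hand sides for Duhamel's formula. -/
structure HeatSource (f : ℝ → ℝ → ℝ) (N : ℝ) : Prop where
  meas : Measurable fun q : ℝ × ℝ => f q.1 q.2
  bound : ∀ x s, |f x s| ≤ N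
  zero : ∀ x s, s ≤ 0 → f x s = 0
  cont : ∃ Z : Set ℝ, Z.Countable ∧ ∀ x, x ∉ Z → ∀ s, s ≠ 0 →
    ContinuousAt (fun q : ℝ × ℝ => f q.1 q.2) (x, s)

/-- The integrand of Duhamel's formula. -/
def duhamelIntegrand (k : ℝ → ℝ) (m : ℕ) (f : ℝ → ℝ → ℝ) (x t τ : ℝ) : ℝ :=
  (√(2 * τ))⁻¹ ^ m * heatAvg k (√(2 * τ)) (fun y => f y (t - τ)) x

/-- Duhamel's integral. -/
def duhamel (k : ℝ → ℝ) (m : ℕ) (f : ℝ → ℝ → ℝ) (x t : ℝ) : ℝ :=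
  ∫ τ in Ioi (0 : ℝ), duhamelIntegrand k m f x t τ

theorem sqrt_two_mul_pos {τ : ℝ} (hτ : 0 < τ) : 0 < √(2 * τ) := Real.sqrt_pos.2 (by linarith)

theorem stdGauss_ae_notMem {Z : Set ℝ} (hZ : Z.Countable) {σ : ℝ} (hσ : 0 < σ) (x : ℝ) :
    ∀ᵐ ζ ∂stdGauss, x + σ * ζ ∉ Z := by
  have hc : ((fun ζ => x + σ * ζ) ⁻¹' Z).Countable :=
    hZ.preimage fun a b hab => by simpa [hσ.ne'] using hab
  have : NullMeasurableSet ((fun ζ => x + σ * ζ) ⁻¹' Z) stdGauss :=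
    hc.measurableSet.nullMeasurableSet
  have : NullSingletonClass stdGauss :=
    ProbabilityTheory.nullSingletonClass_gaussianReal one_ne_zero
  exact measure_eq_zero_iff_ae_notMem.1 (hc.measure_zero stdGauss)

theorem integrableOn_inv_sqrt (T : ℝ) : IntegrableOn (fun τ : ℝ => (√(2 * τ))⁻¹) (Ioc 0 T) := by
  rcases le_or_gt T 0 with h | h
  · simp [Ioc_eq_empty (not_lt.2 h)]
  · have h1 := (intervalIntegral.intervalIntegrable_rpow' (a := 0) (b := T)
      (by norm_num : (-1 : ℝ) < -(1 / 2))).1.const_mul (√2)⁻¹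
    refine IntegrableOn.congr_fun h1 (fun τ hτ => ?_) measurableSet_Ioc
    rw [Real.sqrt_mul zero_le_two, mul_inv, Real.rpow_neg hτ.1.le, Real.sqrt_eq_rpow τ]

theorem integrableOn_inv_sqrt_mul_sqrt (T : ℝ) :
    IntegrableOn (fun τ : ℝ => (√(2 * τ))⁻¹ * √((√(2 * τ))⁻¹)) (Ioc 0 T) := by
  rcases le_or_gt T 0 with h | h
  · simp [Ioc_eq_empty (not_lt.2 h)]
  · have h1 := (intervalIntegral.intervalIntegrable_rpow' (a := 0) (b := T)
      (by norm_num : (-1 : ℝ) < -(3 / 4))).1.const_mul ((2:ℝ) ^ (-(3 / 4) : ℝ))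
    refine IntegrableOn.congr_fun h1 (fun τ hτ => ?_) measurableSet_Ioc
    have h2 : (0:ℝ) < 2 * τ := by linarith [hτ.1]
    rw [← Real.mul_rpow zero_le_two hτ.1.le, Real.sqrt_eq_rpow, Real.sqrt_eq_rpow,
      ← Real.rpow_neg h2.le, ← Real.rpow_mul h2.le, ← Real.rpow_add h2]
    norm_num

namespace HeatSource

variable {f : ℝ → ℝ → ℝ} {N : ℝ}

theorem nonneg (hf : HeatSource f N) : 0 ≤ N := (abs_nonneg _).trans (hf.bound 0 0)

theorem meas_slice (hf : HeatSource f N) (s : ℝ) : Measurable fun x => f x s :=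
  hf.meas.comp (by fun_prop : Measurable fun x : ℝ => (x, s))

theorem measurable_integrand (hf : HeatSource f N) {k : ℝ → ℝ} (hk : GaussWeight k) (m : ℕ)
    (x t : ℝ) : Measurable (duhamelIntegrand k m f x t) := by
  have h1 : Measurable fun q : ℝ × ℝ => k q.2 * f (x + √(2 * q.1) * q.2) (t - q.1) := by
    have h2 : Measurable fun q : ℝ × ℝ => (x + √(2 * q.1) * q.2, t - q.1) := by fun_prop
    have h3 : Measurable fun q : ℝ × ℝ => k q.2 := hk.cont.measurable.comp measurable_snd
    exact h3.mul (hf.meas.comp h2)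
  have h4 : Measurable fun τ : ℝ => heatAvg k (√(2 * τ)) (fun y => f y (t - τ)) x :=
    h1.stronglyMeasurable.integral_prod_right.measurable
  unfold duhamelIntegrand
  fun_prop

theorem abs_integrand_le (hf : HeatSource f N) {k : ℝ → ℝ} (hk : GaussWeight k) (m : ℕ)
    (x t τ : ℝ) : |duhamelIntegrand k m f x t τ| ≤ (√(2 * τ))⁻¹ ^ m * (2 * N) := by
  rw [duhamelIntegrand, abs_mul, abs_of_nonneg (by positivity)]
  gcongr
  exact hk.abs_heatAvg_le (fun y => hf.bound _ _) _ _

theorem integrand_eq_zero (hf : HeatSource f N) {k : ℝ → ℝ} (m : ℕ)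
    (x : ℝ) {t τ : ℝ} (h : t ≤ τ) : duhamelIntegrand k m f x t τ = 0 := by
  simp [duhamelIntegrand, heatAvg, hf.zero _ _ (sub_nonpos.2 h)]

theorem duhamel_of_nonpos (hf : HeatSource f N) {k : ℝ → ℝ} (m : ℕ) (x : ℝ) {t : ℝ}
    (h : t ≤ 0) : duhamel k m f x t = 0 := by
  rw [duhamel, setIntegral_congr_fun measurableSet_Ioi
    (fun τ hτ => hf.integrand_eq_zero m x (h.trans (le_of_lt hτ)))]
  simp

/-- Domination by a function supported in a bounded interval. -/
theorem abs_integrand_le_indicator (hf : HeatSource f N) {k : ℝ → ℝ} {m : ℕ} {x t T : ℝ}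
    (hT : t ≤ T) {b : ℝ → ℝ}
    (hb : ∀ τ, 0 < τ → τ ≤ T → |duhamelIntegrand k m f x t τ| ≤ b τ) :
    ∀ τ, 0 < τ → |duhamelIntegrand k m f x t τ| ≤ (Ioc 0 T).indicator b τ := by
  intro τ hτ
  by_cases h : τ ≤ T
  · rw [indicator_of_mem (mem_Ioc.2 ⟨hτ, h⟩)]
    exact hb τ hτ h
  · rw [indicator_of_notMem (fun h' => h h'.2),
      hf.integrand_eq_zero m x (hT.trans (not_le.1 h).le), abs_zero]

theorem integrableOn_indicator {b : ℝ → ℝ} {T : ℝ} (hb : IntegrableOn b (Ioc 0 T)) :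
    IntegrableOn ((Ioc 0 T).indicator b) (Ioi 0) :=
  (hb.integrable_indicator measurableSet_Ioc).integrableOn

theorem integrableOn_bound_zero (N T : ℝ) :
    IntegrableOn (fun τ : ℝ => (√(2 * τ))⁻¹ ^ 0 * (2 * N)) (Ioc 0 T) := by
  simp only [pow_zero]
  exact integrableOn_const (by simp)

theorem integrableOn_bound_one (N T : ℝ) :
    IntegrableOn (fun τ : ℝ => (√(2 * τ))⁻¹ ^ 1 * (2 * N)) (Ioc 0 T) := by
  simp only [pow_one]
  exact (integrableOn_inv_sqrt T).mul_const _

theorem integrableOn_of_bound (hf : HeatSource f N) {k : ℝ → ℝ} (hk : GaussWeight k) {m : ℕ}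
    {x t : ℝ} {b : ℝ → ℝ} (hb : IntegrableOn b (Ioi 0))
    (h : ∀ τ, 0 < τ → |duhamelIntegrand k m f x t τ| ≤ b τ) :
    IntegrableOn (duhamelIntegrand k m f x t) (Ioi 0) :=
  Integrable.mono' hb (hf.measurable_integrand hk m x t).aestronglyMeasurable
    ((ae_restrict_iff' measurableSet_Ioi).2 (Eventually.of_forall fun τ hτ => h τ hτ))

theorem continuousAt_duhamel_of_bound (hf : HeatSource f N) {k : ℝ → ℝ} (hk : GaussWeight k)
    {m : ℕ} {x₀ t₀ : ℝ} {b : ℝ → ℝ} (hb : IntegrableOn b (Ioi 0))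
    (h : ∀ᶠ q : ℝ × ℝ in 𝓝 (x₀, t₀), ∀ τ, 0 < τ → |duhamelIntegrand k m f q.1 q.2 τ| ≤ b τ) :
    ContinuousAt (fun q : ℝ × ℝ => duhamel k m f q.1 q.2) (x₀, t₀) := by
  obtain ⟨Z, hZ, hfc⟩ := hf.cont
  refine continuousAt_of_dominated (bound := b)
    (Eventually.of_forall fun q => (hf.measurable_integrand hk m _ _).aestronglyMeasurable)
    ?_ hb ?_
  · filter_upwards [h] with q hq
    exact (ae_restrict_iff' measurableSet_Ioi).2 (Eventually.of_forall fun τ hτ => hq τ hτ)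
  · refine (ae_restrict_iff' measurableSet_Ioi).2 ?_
    filter_upwards [compl_mem_ae_iff.2 (measure_singleton (μ := volume) t₀)] with τ hτ hτ0
    have hs : t₀ - τ ≠ 0 := sub_ne_zero.2 fun h => hτ (by simp [h])
    have hσ := sqrt_two_mul_pos hτ0
    have h1 := hk.continuousAt_heatAvg (f := f) (N := N) (x₀ := x₀) (s₀ := t₀ - τ)
      hf.meas_slice (fun x s => (hf.bound x s).trans
        (le_mul_of_one_le_right hf.nonneg (by linarith [abs_nonneg x]))) hσ.le
      ((stdGauss_ae_notMem hZ hσ x₀).mono fun ζ hζ => hfc _ hζ _ hs)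
    have h2 : ContinuousAt (fun q : ℝ × ℝ => (q.1, q.2 - τ, √(2 * τ))) (x₀, t₀) := by fun_prop
    have h3 := ContinuousAt.comp (x := ((x₀, t₀) : ℝ × ℝ)) (f := fun q : ℝ × ℝ => (q.1, q.2 - τ, √(2 * τ))) h1 h2
    simp only [Function.comp_def, abs_of_pos hσ] at h3
    exact continuousAt_const.mul h3

theorem hasDerivAt_duhamel_of_bound (hf : HeatSource f N) {k k₁ : ℝ → ℝ} (hk : GaussWeight k)
    (hk₁ : GaussWeight k₁) {m : ℕ} {x₀ t r : ℝ} (hr : 0 < r)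
    (hder : ∀ {φ : ℝ → ℝ}, Measurable φ → (∀ x, |φ x| ≤ N) → ∀ {σ : ℝ}, 0 < σ → ∀ x,
      HasDerivAt (heatAvg k σ φ) (σ⁻¹ * heatAvg k₁ σ φ x) x)
    (hInt : IntegrableOn (duhamelIntegrand k m f x₀ t) (Ioi 0))
    {b : ℝ → ℝ} (hb : IntegrableOn b (Ioi 0))
    (h : ∀ x ∈ ball x₀ r, ∀ τ, 0 < τ → |duhamelIntegrand k₁ (m + 1) f x t τ| ≤ b τ) :
    HasDerivAt (fun x => duhamel k m f x t) (duhamel k₁ (m + 1) f x₀ t) x₀ := by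
  refine (hasDerivAt_integral_of_dominated_loc_of_deriv_le
    (F := fun x τ => duhamelIntegrand k m f x t τ)
    (F' := fun x τ => duhamelIntegrand k₁ (m + 1) f x t τ) (bound := b)
    (ball_mem_nhds x₀ hr)
    (Eventually.of_forall fun x => (hf.measurable_integrand hk m _ _).aestronglyMeasurable)
    hInt (hf.measurable_integrand hk₁ _ _ _).aestronglyMeasurable ?_ hb ?_).2
  · exact (ae_restrict_iff' measurableSet_Ioi).2
      (Eventually.of_forall fun τ hτ x hx => h x hx τ hτ)
  · refine (ae_restrict_iff' measurableSet_Ioi).2 (Eventually.of_forall fun τ hτ x hx => ?_)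
    have := (hder (hf.meas_slice (t - τ)) (fun x => hf.bound x _) (sqrt_two_mul_pos hτ) x).const_mul
      ((√(2 * τ))⁻¹ ^ m)
    refine this.congr_deriv ?_
    rw [duhamelIntegrand]; ring

theorem integrable_zero (hf : HeatSource f N) {k : ℝ → ℝ} (hk : GaussWeight k) (x t : ℝ) :
    IntegrableOn (duhamelIntegrand k 0 f x t) (Ioi 0) :=
  hf.integrableOn_of_bound hk (integrableOn_indicator (integrableOn_bound_zero N t))
    (hf.abs_integrand_le_indicator le_rfl fun τ _ _ => hf.abs_integrand_le hk 0 x t τ)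

theorem integrable_one (hf : HeatSource f N) {k : ℝ → ℝ} (hk : GaussWeight k) (x t : ℝ) :
    IntegrableOn (duhamelIntegrand k 1 f x t) (Ioi 0) :=
  hf.integrableOn_of_bound hk (integrableOn_indicator (integrableOn_bound_one N t))
    (hf.abs_integrand_le_indicator le_rfl fun τ _ _ => hf.abs_integrand_le hk 1 x t τ)

theorem eventually_snd_le (x₀ t₀ : ℝ) : ∀ᶠ q : ℝ × ℝ in 𝓝 (x₀, t₀), q.2 ≤ t₀ + 1 :=
  (continuousAt_snd (p := ((x₀, t₀) : ℝ × ℝ))).eventually_le_const (by simp)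

theorem continuous_duhamel_zero (hf : HeatSource f N) {k : ℝ → ℝ} (hk : GaussWeight k) :
    Continuous fun q : ℝ × ℝ => duhamel k 0 f q.1 q.2 :=
  continuous_iff_continuousAt.2 fun ⟨x₀, t₀⟩ => hf.continuousAt_duhamel_of_bound hk
    (integrableOn_indicator (integrableOn_bound_zero N (t₀ + 1)))
    ((eventually_snd_le x₀ t₀).mono fun _ hq => hf.abs_integrand_le_indicator hq
      fun τ _ _ => hf.abs_integrand_le hk 0 _ _ τ)

theorem continuous_duhamel_one (hf : HeatSource f N) {k : ℝ → ℝ} (hk : GaussWeight k) :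
    Continuous fun q : ℝ × ℝ => duhamel k 1 f q.1 q.2 :=
  continuous_iff_continuousAt.2 fun ⟨x₀, t₀⟩ => hf.continuousAt_duhamel_of_bound hk
    (integrableOn_indicator (integrableOn_bound_one N (t₀ + 1)))
    ((eventually_snd_le x₀ t₀).mono fun _ hq => hf.abs_integrand_le_indicator hq
      fun τ _ _ => hf.abs_integrand_le hk 1 _ _ τ)

theorem hasDerivAt_duhamel (hf : HeatSource f N) (x t : ℝ) :
    HasDerivAt (fun x => duhamel (fun _ => 1) 0 f x t) (duhamel (fun ζ => ζ) 1 f x t) x :=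
  hf.hasDerivAt_duhamel_of_bound gaussWeight_one gaussWeight_id one_pos
    (fun hφ hN _ hσ => hasDerivAt_heatAvg_one hφ hN hσ)
    (hf.integrable_zero gaussWeight_one x t)
    (integrableOn_indicator (integrableOn_bound_one N t))
    fun y _ => hf.abs_integrand_le_indicator le_rfl
      fun τ _ _ => hf.abs_integrand_le gaussWeight_id 1 y t τ

end HeatSource

theorem le_sqrt_mul_of_le {a b c : ℝ} (ha : 0 ≤ a) (hb : a ≤ b) (hc : a ≤ c) :
    a ≤ √(b * c) := by
  apply Real.le_sqrt_of_sq_le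
  rw [sq]
  exact mul_le_mul hb hc ha (ha.trans hb)

/-- Gaussian averages with weight `ζ` of bounded functions are Hölder continuous. -/
theorem abs_heatAvg_id_sub_le {f : ℝ → ℝ} (hf : Measurable f) {N : ℝ} (hN : ∀ x, |f x| ≤ N)
    {σ : ℝ} (hσ : 0 < σ) (x y : ℝ) :
    |heatAvg (fun ζ => ζ) σ f x - heatAvg (fun ζ => ζ) σ f y| ≤
      4 * N * (√(σ⁻¹) * √|x - y|) := by
  have h0 : 0 ≤ N := (abs_nonneg _).trans (hN 0)
  have h1 : |heatAvg (fun ζ => ζ) σ f x - heatAvg (fun ζ => ζ) σ f y| ≤ 4 * N := by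
    have h2 := gaussWeight_id.abs_heatAvg_le hN σ x
    have h3 := gaussWeight_id.abs_heatAvg_le hN σ y
    have := abs_sub (heatAvg (fun ζ => ζ) σ f x) (heatAvg (fun ζ => ζ) σ f y)
    linarith
  have h2 : |heatAvg (fun ζ => ζ) σ f x - heatAvg (fun ζ => ζ) σ f y| ≤
      4 * N * (σ⁻¹ * |x - y|) := by
    have := convex_univ.norm_image_sub_le_of_norm_hasDerivWithin_le (f := heatAvg (fun ζ => ζ) σ f)
      (C := σ⁻¹ * (2 * N))
      (fun z _ => (hasDerivAt_heatAvg_id hf hN hσ z).hasDerivWithinAt) (fun z _ => by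
        rw [Real.norm_eq_abs, abs_mul, abs_of_pos (inv_pos.2 hσ)]
        gcongr
        exact gaussWeight_hermite.abs_heatAvg_le hN σ z) (mem_univ y) (mem_univ x)
    simp only [Real.norm_eq_abs] at this
    refine this.trans ?_
    have : 0 ≤ N * (σ⁻¹ * |x - y|) := by positivity
    linarith
  refine (le_sqrt_mul_of_le (abs_nonneg _) h1 h2).trans (le_of_eq ?_)
  rw [show 4 * N * (4 * N * (σ⁻¹ * |x - y|)) = (4 * N) ^ 2 * (σ⁻¹ * |x - y|) by ring,
    Real.sqrt_mul (by positivity), Real.sqrt_sq (by positivity), Real.sqrt_mul (by positivity)]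

theorem stdGauss_integral_hermite : ∫ ζ, (ζ ^ 2 - 1) ∂stdGauss = 0 := by
  rw [integral_sub (stdGauss_integrable_pow 2) (integrable_const _), stdGauss_integral_sq]
  simp

/-- The smoothing effect of the second Hermite weight on Hölder continuous functions. -/
theorem abs_heatAvg_hermite_le {f : ℝ → ℝ} (hf : Measurable f) {N C : ℝ} (hN : ∀ x, |f x| ≤ N)
    {σ : ℝ} (hσ : 0 ≤ σ) {x : ℝ} (hC : ∀ z, |f z - f x| ≤ C * √|z - x|) :
    |heatAvg (fun ζ => ζ ^ 2 - 1) σ f x| ≤ C * gaussQuartic * √σ := by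
  have h0 : 0 ≤ C := by
    have := (abs_nonneg _).trans (hC (x + 1))
    simpa using this
  have h1 : heatAvg (fun ζ => ζ ^ 2 - 1) σ f x =
      ∫ ζ, (ζ ^ 2 - 1) * (f (x + σ * ζ) - f x) ∂stdGauss := by
    have h2 : Integrable (fun ζ : ℝ => (ζ ^ 2 - 1) * f x) stdGauss :=
      ((stdGauss_integrable_pow 2).sub (integrable_const _)).mul_const _
    simp_rw [mul_sub]
    rw [integral_sub (gaussWeight_hermite.integrable_bdd hf hN σ x) h2,
      integral_mul_const, stdGauss_integral_hermite, zero_mul, sub_zero, heatAvg]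
  rw [h1, gaussQuartic, ← Real.norm_eq_abs,
    show C * (∫ ζ, (1 + ζ ^ 2) ^ 2 ∂stdGauss) * √σ = ∫ ζ, C * √σ * (1 + ζ ^ 2) ^ 2 ∂stdGauss by
      rw [integral_const_mul]; ring]
  refine norm_integral_le_of_norm_le (stdGauss_integrable_quartic.const_mul _)
    (Eventually.of_forall fun ζ => ?_)
  rw [Real.norm_eq_abs, abs_mul]
  have h2 := gaussWeight_hermite.bound ζ
  have h3 : √|ζ| ≤ 1 + ζ ^ 2 := by
    rw [Real.sqrt_le_left (by positivity)]
    have := gaussWeight_id.bound ζ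
    nlinarith [sq_nonneg ζ]
  have h4 : |f (x + σ * ζ) - f x| ≤ C * (√σ * (1 + ζ ^ 2)) := by
    refine (hC _).trans ?_
    rw [add_sub_cancel_left, abs_mul, abs_of_nonneg hσ, Real.sqrt_mul hσ]
    gcongr
  calc _ ≤ (1 + ζ ^ 2) * (C * (√σ * (1 + ζ ^ 2))) := by gcongr
    _ = _ := by ring

namespace HeatSource

variable {f : ℝ → ℝ → ℝ} {N : ℝ}

/-- Hölder continuity in space of the gradient part of Duhamel's integral. -/
theorem exists_abs_duhamel_one_sub_le (hf : HeatSource f N) (T : ℝ) : ∃ C, ∀ t ≤ T, ∀ x y,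
    |duhamel (fun ζ => ζ) 1 f x t - duhamel (fun ζ => ζ) 1 f y t| ≤ C * √|x - y| := by
  refine ⟨∫ τ in Ioi (0:ℝ), (Ioc 0 T).indicator
    (fun τ => (√(2 * τ))⁻¹ * √((√(2 * τ))⁻¹) * (4 * N)) τ, fun t ht x y => ?_⟩
  rw [duhamel, duhamel, ← integral_sub (hf.integrable_one gaussWeight_id x t)
    (hf.integrable_one gaussWeight_id y t), ← integral_mul_const, ← Real.norm_eq_abs]
  refine norm_integral_le_of_norm_le ((integrableOn_indicator
    ((integrableOn_inv_sqrt_mul_sqrt T).mul_const (4 * N))).mul_const _)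
    ((ae_restrict_iff' measurableSet_Ioi).2 (Eventually.of_forall fun τ hτ => ?_))
  by_cases h : τ ≤ T
  · rw [indicator_of_mem (mem_Ioc.2 ⟨hτ, h⟩), Real.norm_eq_abs, duhamelIntegrand, duhamelIntegrand,
      ← mul_sub, abs_mul, pow_one, abs_of_nonneg (by positivity)]
    calc _ ≤ (√(2 * τ))⁻¹ * (4 * N * (√((√(2 * τ))⁻¹) * √|x - y|)) := by
          gcongr
          exact abs_heatAvg_id_sub_le (hf.meas_slice _) (fun z => hf.bound z _)
            (sqrt_two_mul_pos hτ) x y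
      _ = _ := by ring
  · rw [indicator_of_notMem (fun h' => h h'.2),
      hf.integrand_eq_zero 1 x (ht.trans (not_le.1 h).le),
      hf.integrand_eq_zero 1 y (ht.trans (not_le.1 h).le)]
    simp

/-- If the source is Hölder continuous near `x₀`, locally uniformly in positive times, then the
second derivative kernel is integrable. -/
theorem exists_hermite_bound (hf : HeatSource f N) {x₀ t₀ r : ℝ} (ht₀ : 0 < t₀)
    (hH : ∀ δ T, 0 < δ → ∃ C, ∀ s, δ ≤ s → s ≤ T → ∀ x ∈ ball x₀ r, ∀ z,
      |f z s - f x s| ≤ C * √|z - x|) :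
    ∃ b : ℝ → ℝ, IntegrableOn b (Ioi 0) ∧ ∀ x ∈ ball x₀ r, ∀ t ∈ Icc (t₀ / 2) (t₀ + 1),
      ∀ τ, 0 < τ → |duhamelIntegrand (fun ζ => ζ ^ 2 - 1) 2 f x t τ| ≤ b τ := by
  obtain ⟨C, hC⟩ := hH (t₀ / 4) (t₀ + 1) (by linarith)
  refine ⟨(Ioc 0 (t₀ + 1)).indicator fun τ => (√(2 * τ))⁻¹ * √((√(2 * τ))⁻¹) *
    (|C| * gaussQuartic) + 2 / t₀ * (2 * N), integrableOn_indicator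
      (((integrableOn_inv_sqrt_mul_sqrt _).mul_const _).add (integrableOn_const (by simp))),
    fun x hx t ht => hf.abs_integrand_le_indicator ht.2 fun τ hτ _ => ?_⟩
  have hσ := sqrt_two_mul_pos hτ
  have hq : 0 ≤ gaussQuartic := integral_nonneg fun ζ => by positivity
  have hN := hf.nonneg
  rcases le_or_gt τ (t₀ / 4) with h | h
  · have h1 := abs_heatAvg_hermite_le (hf.meas_slice (t - τ)) (fun z => hf.bound z _) hσ.le
      (x := x) (C := |C|) fun z => (hC (t - τ) (by linarith [ht.1]) (by linarith [ht.2]) x hx z).trans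
        (by gcongr; exact le_abs_self C)
    rw [duhamelIntegrand, abs_mul, abs_of_nonneg (by positivity)]
    have h2 : (√(2 * τ))⁻¹ ^ 2 * √(√(2 * τ)) = (√(2 * τ))⁻¹ * √((√(2 * τ))⁻¹) := by
      rw [Real.sqrt_inv, sq, mul_assoc]
      congr 1
      have h3 : √(√(2 * τ)) ≠ 0 := (Real.sqrt_pos.2 hσ).ne'
      have h4 : √(√(2 * τ)) ^ 2 = √(2 * τ) := Real.sq_sqrt hσ.le
      field_simp
      exact h4
    calc _ ≤ (√(2 * τ))⁻¹ ^ 2 * (|C| * gaussQuartic * √(√(2 * τ))) := by gcongr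
      _ = (√(2 * τ))⁻¹ ^ 2 * √(√(2 * τ)) * (|C| * gaussQuartic) := by ring
      _ ≤ _ := by rw [h2]; exact le_add_of_nonneg_right (by positivity)
  · refine (hf.abs_integrand_le gaussWeight_hermite 2 x t τ).trans ?_
    have h3 : (√(2 * τ))⁻¹ ^ 2 ≤ 2 / t₀ := by
      rw [inv_pow, Real.sq_sqrt (by linarith), inv_eq_one_div, div_le_div_iff₀ (by linarith) ht₀]
      linarith
    refine (mul_le_mul_of_nonneg_right h3 (by positivity)).trans
      (le_add_of_nonneg_left (by positivity))

theorem hasDerivAt_duhamel_one (hf : HeatSource f N) {x₀ t₀ r : ℝ} (hr : 0 < r) (ht₀ : 0 < t₀)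
    (hH : ∀ δ T, 0 < δ → ∃ C, ∀ s, δ ≤ s → s ≤ T → ∀ x ∈ ball x₀ r, ∀ z,
      |f z s - f x s| ≤ C * √|z - x|) :
    HasDerivAt (fun x => duhamel (fun ζ => ζ) 1 f x t₀)
      (duhamel (fun ζ => ζ ^ 2 - 1) 2 f x₀ t₀) x₀ := by
  obtain ⟨b, hb, hbd⟩ := hf.exists_hermite_bound ht₀ hH
  exact hf.hasDerivAt_duhamel_of_bound gaussWeight_id gaussWeight_hermite hr
    (fun hφ hN _ hσ => hasDerivAt_heatAvg_id hφ hN hσ) (hf.integrable_one gaussWeight_id x₀ t₀)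
    hb fun x hx => hbd x hx t₀ ⟨by linarith, by linarith⟩

theorem continuousAt_duhamel_two (hf : HeatSource f N) {x₀ t₀ r : ℝ} (hr : 0 < r) (ht₀ : 0 < t₀)
    (hH : ∀ δ T, 0 < δ → ∃ C, ∀ s, δ ≤ s → s ≤ T → ∀ x ∈ ball x₀ r, ∀ z,
      |f z s - f x s| ≤ C * √|z - x|) :
    ContinuousAt (fun q : ℝ × ℝ => duhamel (fun ζ => ζ ^ 2 - 1) 2 f q.1 q.2) (x₀, t₀) := by
  obtain ⟨b, hb, hbd⟩ := hf.exists_hermite_bound ht₀ hH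
  refine hf.continuousAt_duhamel_of_bound gaussWeight_hermite hb ?_
  have : ball x₀ r ×ˢ Icc (t₀ / 2) (t₀ + 1) ∈ 𝓝 (x₀, t₀) :=
    prod_mem_nhds (ball_mem_nhds _ hr) (Icc_mem_nhds (by linarith) (by linarith))
  filter_upwards [this] with q hq
  exact hbd q.1 hq.1 q.2 hq.2

end HeatSource

theorem stdGauss_integral_id : ∫ ζ, ζ ∂stdGauss = 0 :=
  ProbabilityTheory.integral_id_gaussianReal

/-- Second order Taylor expansion at a point. -/
theorem taylor_two_isBigO {U g : ℝ → ℝ} {x c : ℝ} (hU : ∀ y, HasDerivAt U (g y) y)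
    (hg : HasDerivAt g c x) {ε : ℝ} (hε : 0 < ε) : ∃ δ > 0, ∀ y, |y| ≤ δ →
      |U (x + y) - U x - g x * y - c / 2 * y ^ 2| ≤ ε * y ^ 2 := by
  have h1 := hg.isLittleO.bound hε
  rw [Metric.eventually_nhds_iff_ball] at h1
  obtain ⟨δ, hδ, h1⟩ := h1
  refine ⟨δ / 2, by linarith, fun y hy => ?_⟩
  have h2 : ∀ z ∈ Icc (-|y|) |y|, HasDerivWithinAt
      (fun z => U (x + z) - U x - g x * z - c / 2 * z ^ 2) (g (x + z) - g x - c * z)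
      (Icc (-|y|) |y|) z := fun z _ => by
    have e1 := ((hU (x + z)).comp_const_add x z)
    have e2 := ((e1.sub_const (U x)).fun_sub ((hasDerivAt_id' z).const_mul (g x))).fun_sub
      (((hasDerivAt_id' z).fun_pow 2).const_mul (c / 2))
    refine (e2.congr_deriv ?_).hasDerivWithinAt
    push_cast; ring
  have h3 := (convex_Icc (-|y|) |y|).norm_image_sub_le_of_norm_hasDerivWithin_le h2
    (C := ε * |y|) (fun z hz => by
      have h4 := h1 (x + z) (by
        rw [mem_ball, Real.dist_eq, add_sub_cancel_left]
        exact (abs_le.2 hz).trans_lt (by linarith))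
      simp only [add_sub_cancel_left, smul_eq_mul, Real.norm_eq_abs] at h4
      rw [mul_comm z c] at h4
      rw [Real.norm_eq_abs]
      exact h4.trans (mul_le_mul_of_nonneg_left (abs_le.2 hz) hε.le))
    (⟨by simp, by simp⟩ : (0:ℝ) ∈ Icc (-|y|) |y|) (abs_le.1 le_rfl : y ∈ Icc (-|y|) |y|)
  simp only [Real.norm_eq_abs] at h3
  simpa [mul_assoc, ← sq] using h3

/-- The generator of the heat semigroup is the second derivative. -/
theorem tendsto_heatAvg_quotient {U g : ℝ → ℝ} {A x c : ℝ} (hU : ∀ y, HasDerivAt U (g y) y)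
    (hA : ∀ y, |g y| ≤ A) (hg : HasDerivAt g c x) :
    Tendsto (fun h => (heatAvg (fun _ => 1) (√(2 * h)) U x - U x) / h) (𝓝[>] 0) (𝓝 c) := by
  have hcU : Continuous U := continuous_iff_continuousAt.2 fun y => (hU y).continuousAt
  have hA0 : 0 ≤ A := (abs_nonneg _).trans (hA 0)
  have hLip : ∀ y, |U (x + y) - U x| ≤ A * |y| := fun y => by
    have := convex_univ.norm_image_sub_le_of_norm_hasDerivWithin_le (f := U) (C := A)
      (fun z _ => (hU z).hasDerivWithinAt) (fun z _ => hA z) (mem_univ x) (mem_univ (x + y))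
    simpa using this
  set E : ℝ → ℝ := fun y => U (x + y) - U x - g x * y with hE
  have hcE : Continuous E := by fun_prop
  obtain ⟨B, hB⟩ : ∃ B, ∀ y, |E y| ≤ B * y ^ 2 := by
    obtain ⟨δ, hδ, h1⟩ := taylor_two_isBigO hU hg one_pos
    refine ⟨max (1 + |c / 2|) (2 * A / δ), fun y => ?_⟩
    rcases le_or_gt |y| δ with h | h
    · have h2 := h1 y h
      have h3 : |E y| ≤ 1 * y ^ 2 + |c / 2| * y ^ 2 := by
        have := abs_add_le (U (x + y) - U x - g x * y - c / 2 * y ^ 2) (c / 2 * y ^ 2)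
        rw [sub_add_cancel, abs_mul, abs_of_nonneg (sq_nonneg y)] at this
        linarith
      rw [← add_mul] at h3
      exact h3.trans (by gcongr; exact le_max_left _ _)
    · have h3 : |E y| ≤ 2 * A * |y| := by
        have h4 := abs_sub (U (x + y) - U x) (g x * y)
        rw [abs_mul] at h4
        have h5 : |g x| * |y| ≤ A * |y| := by gcongr; exact hA x
        have := hLip y
        simp only [hE]; linarith
      calc |E y| ≤ 2 * A * |y| := h3
        _ ≤ 2 * A / δ * y ^ 2 := by
          rw [div_mul_eq_mul_div, le_div_iff₀ hδ, mul_assoc]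
          gcongr
          rw [← sq_abs, sq]
          gcongr
        _ ≤ _ := by gcongr; exact le_max_right _ _
  have hlim : ∀ ζ, Tendsto (fun h => E (√(2 * h) * ζ) / h) (𝓝[>] 0) (𝓝 (c * ζ ^ 2)) := by
    intro ζ
    rw [Metric.tendsto_nhds]
    intro ε hε
    have hε' : 0 < ε / (2 * ζ ^ 2 + 1) := by positivity
    obtain ⟨δ, hδ, h1⟩ := taylor_two_isBigO hU hg hε'
    have h2 : Tendsto (fun h : ℝ => |√(2 * h) * ζ|) (𝓝[>] 0) (𝓝 0) := by
      have : Continuous fun h : ℝ => |√(2 * h) * ζ| := by fun_prop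
      simpa using (this.tendsto 0).mono_left nhdsWithin_le_nhds
    filter_upwards [h2.eventually_le_const hδ, self_mem_nhdsWithin] with h hh hpos
    have hpos : 0 < h := hpos
    have h3 := h1 _ hh
    have h4 : (√(2 * h) * ζ) ^ 2 = 2 * h * ζ ^ 2 := by
      rw [mul_pow, Real.sq_sqrt (by linarith)]
    rw [h4] at h3
    rw [Real.dist_eq, show E (√(2 * h) * ζ) / h - c * ζ ^ 2 =
      (E (√(2 * h) * ζ) - c / 2 * (2 * h * ζ ^ 2)) / h by field_simp, abs_div, abs_of_pos hpos,
      div_lt_iff₀ hpos]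
    refine h3.trans_lt ?_
    rw [div_mul_eq_mul_div, div_lt_iff₀ (by positivity)]
    nlinarith [mul_pos hε hpos]
  have hmain : Tendsto (fun h => ∫ ζ, E (√(2 * h) * ζ) / h ∂stdGauss) (𝓝[>] 0)
      (𝓝 (∫ ζ, c * ζ ^ 2 ∂stdGauss)) := by
    refine tendsto_integral_filter_of_dominated_convergence (fun ζ => 2 * B * ζ ^ 2)
      (Eventually.of_forall fun h => by
        exact (Continuous.aestronglyMeasurable (by fun_prop)))
      ?_ ((stdGauss_integrable_pow 2).const_mul _) (Eventually.of_forall hlim)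
    filter_upwards [self_mem_nhdsWithin] with h hpos
    have hpos : 0 < h := hpos
    refine Eventually.of_forall fun ζ => ?_
    rw [Real.norm_eq_abs, abs_div, abs_of_pos hpos, div_le_iff₀ hpos]
    refine (hB _).trans (le_of_eq ?_)
    rw [mul_pow, Real.sq_sqrt (by linarith)]; ring
  rw [integral_const_mul, stdGauss_integral_sq, mul_one] at hmain
  refine hmain.congr' ?_
  filter_upwards [self_mem_nhdsWithin] with h hpos
  have hint1 : Integrable (fun ζ => U (x + √(2 * h) * ζ)) stdGauss := by
    have := gaussWeight_one.integrable_mul (g := fun ζ => U (x + √(2 * h) * ζ))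
      (C := |U x| + A * √(2 * h)) (Continuous.aestronglyMeasurable (by fun_prop)) (fun ζ => by
        have h1 := hLip (√(2 * h) * ζ)
        rw [abs_mul, abs_of_nonneg (Real.sqrt_nonneg _)] at h1
        have h2 := abs_sub_abs_le_abs_sub (U (x + √(2 * h) * ζ)) (U x)
        have h3 := gaussWeight_id.bound ζ
        have h4 : A * (√(2 * h) * |ζ|) ≤ A * (√(2 * h) * (1 + ζ ^ 2)) := by gcongr
        nlinarith [mul_nonneg (abs_nonneg (U x)) (sq_nonneg ζ)])
    simpa using this
  have hint2 : Integrable (fun ζ : ℝ => g x * (√(2 * h) * ζ)) stdGauss := by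
    have := (stdGauss_integrable_pow 1).const_mul (g x * √(2 * h))
    simpa [mul_assoc] using this
  have hint3 : Integrable (fun ζ => U (x + √(2 * h) * ζ) - U x) stdGauss :=
    hint1.sub (integrable_const _)
  simp only [hE]
  rw [integral_div, integral_sub hint3 hint2, integral_sub hint1 (integrable_const _),
    integral_const_mul, integral_const_mul, stdGauss_integral_id]
  simp [heatAvg]

/-- A continuous function with a continuous right derivative is differentiable. -/
theorem hasDerivAt_of_right_deriv {F w : ℝ → ℝ} (hF : ContinuousOn F (Ioi 0))
    (hw : ContinuousOn w (Ioi 0)) (h : ∀ t, 0 < t → HasDerivWithinAt F (w t) (Ioi t) t) {t : ℝ}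
    (ht : 0 < t) : HasDerivAt F (w t) t := by
  have hsub : ∀ s, 0 < s → uIcc (t / 2) s ⊆ Ioi 0 := fun s hs x hx =>
    (lt_min (by linarith) hs).trans_le hx.1
  have hii : ∀ s, 0 < s → IntervalIntegrable w volume (t / 2) s := fun s hs =>
    (hw.mono (hsub s hs)).intervalIntegrable
  have h1 : ∀ s, 0 < s → F (t / 2) + ∫ r in (t / 2)..s, w r = F s := fun s hs => by
    rw [intervalIntegral.integral_eq_sub_of_hasDeriv_right (hF.mono (hsub s hs))
      (fun x hx => h x (hsub s hs (Ioo_subset_Icc_self hx))) (hii s hs)]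
    ring
  have h2 : HasDerivAt (fun s => F (t / 2) + ∫ r in (t / 2)..s, w r) (w t) t :=
    (intervalIntegral.integral_hasDerivAt_right (hii t ht)
      (hw.stronglyMeasurableAtFilter isOpen_Ioi t ht)
      (hw.continuousAt (Ioi_mem_nhds ht))).const_add _
  refine h2.congr_of_eventuallyEq ?_
  filter_upwards [Ioi_mem_nhds ht] with s hs
  exact (h1 s hs).symm

namespace HeatSource

variable {f : ℝ → ℝ → ℝ} {N : ℝ}

theorem tendsto_short_time (hf : HeatSource f N) {x t : ℝ}
    (hc : ContinuousAt (fun q : ℝ × ℝ => f q.1 q.2) (x, t)) :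
    Tendsto (fun h => (∫ τ in Ioc 0 h, duhamelIntegrand (fun _ => 1) 0 f x (t + h) τ) / h)
      (𝓝[>] 0) (𝓝 (f x t)) := by
  rw [Metric.tendsto_nhds]
  intro ε hε
  have h1 := gaussWeight_one.continuousAt_heatAvg (f := f) (N := N) (x₀ := x) (s₀ := t)
      hf.meas_slice (fun x s => (hf.bound x s).trans
        (le_mul_of_one_le_right hf.nonneg (by linarith [abs_nonneg x]))) le_rfl
      (Eventually.of_forall fun ζ => by simpa using hc)
  have h2 : heatAvg (fun _ => 1) |0| (fun y => f y t) x = f x t := by simp [heatAvg]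
  have h3 := Metric.continuousAt_iff'.1 h1 (ε / 2) (by linarith)
  simp only [h2] at h3
  rw [nhds_prod_eq, nhds_prod_eq] at h3
  obtain ⟨P, hP, Q, hQ, hPQ⟩ := eventually_prod_iff.1 h3
  obtain ⟨P', hP', Q', hQ', hPQ'⟩ := eventually_prod_iff.1 hQ
  rw [Metric.eventually_nhds_iff_ball] at hP' hQ'
  obtain ⟨δ, hδ, hP'⟩ := hP'
  have h4 : Tendsto (fun h : ℝ => √(2 * h)) (𝓝[>] 0) (𝓝 0) := by
    have : Continuous fun h : ℝ => √(2 * h) := by fun_prop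
    simpa using (this.tendsto 0).mono_left nhdsWithin_le_nhds
  obtain ⟨δ', hδ', hQ'⟩ := hQ'
  filter_upwards [Ioo_mem_nhdsGT hδ, h4.eventually_lt_const hδ', self_mem_nhdsWithin]
    with h hh hh' hpos
  have hpos : 0 < h := hpos
  have hInt : IntegrableOn (duhamelIntegrand (fun _ => 1) 0 f x (t + h)) (Ioc 0 h) :=
    (hf.integrable_zero gaussWeight_one x (t + h)).mono_set Ioc_subset_Ioi_self
  have h5 : ‖∫ τ in Ioc 0 h, (duhamelIntegrand (fun _ => 1) 0 f x (t + h) τ - f x t)‖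
      ≤ ε / 2 * h := by
    have := norm_setIntegral_le_of_norm_le_const (μ := volume) (s := Ioc 0 h)
      (f := fun τ => duhamelIntegrand (fun _ => 1) 0 f x (t + h) τ - f x t) (C := ε / 2)
      (by simp) (fun τ hτ => by
        have h6 := hPQ hP.self_of_nhds (hPQ' (hP' (t + h - τ) (by
          rw [mem_ball, Real.dist_eq, abs_lt]; constructor <;> linarith [hτ.1, hτ.2, hh.2]))
          (hQ' (√(2 * τ)) (by
            rw [mem_ball, Real.dist_eq, sub_zero, abs_of_nonneg (Real.sqrt_nonneg _)]
            refine (Real.sqrt_le_sqrt ?_).trans_lt hh'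
            linarith [hτ.2])))
        simp only [abs_of_nonneg (Real.sqrt_nonneg _)] at h6
        rw [Real.dist_eq] at h6
        simpa [duhamelIntegrand] using h6.le)
    simpa [hpos.le] using this
  rw [integral_sub hInt (integrableOn_const (by simp))] at h5
  simp only [integral_const, Real.norm_eq_abs, MeasurableSet.univ, measureReal_restrict_apply,
    univ_inter, Real.volume_real_Ioc_of_le hpos.le, sub_zero, smul_eq_mul] at h5
  rw [Real.dist_eq, show (∫ τ in Ioc 0 h, duhamelIntegrand (fun _ => 1) 0 f x (t + h) τ) / h - f x t
    = ((∫ τ in Ioc 0 h, duhamelIntegrand (fun _ => 1) 0 f x (t + h) τ) - h * f x t) / h by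
      field_simp, abs_div, abs_of_pos hpos, div_lt_iff₀ hpos]
  exact h5.trans_lt (by nlinarith)

end HeatSource

theorem GaussWeight.abs_heatAvg_le_growth {k : ℝ → ℝ} (hk : GaussWeight k) {f : ℝ → ℝ} {C : ℝ}
    (hC : 0 ≤ C) (hf : ∀ x, |f x| ≤ C * (1 + |x|)) {σ : ℝ} (hσ : 0 ≤ σ) (x : ℝ) :
    |heatAvg k σ f x| ≤ C * (1 + σ) * gaussQuartic * (1 + |x|) := by
  have h1 : ‖∫ ζ, k ζ * f (x + σ * ζ) ∂stdGauss‖ ≤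
      ∫ ζ, C * (1 + |x| + σ) * (1 + ζ ^ 2) ^ 2 ∂stdGauss :=
    norm_integral_le_of_norm_le (stdGauss_integrable_quartic.const_mul _)
      (Eventually.of_forall fun ζ => by
        rw [Real.norm_eq_abs, abs_mul]
        have h1 := growth_bound (x := x) (ζ := ζ) hC hσ (hf _)
        have h2 := hk.bound ζ
        calc _ ≤ (1 + ζ ^ 2) * (C * (1 + |x| + σ) * (1 + ζ ^ 2)) := by gcongr
          _ = _ := by ring)
  rw [integral_const_mul] at h1
  have hq : 0 ≤ gaussQuartic := integral_nonneg fun ζ => by positivity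
  refine h1.trans ?_
  change C * (1 + |x| + σ) * gaussQuartic ≤ _
  have : 1 + |x| + σ ≤ (1 + σ) * (1 + |x|) := by nlinarith [abs_nonneg x]
  calc C * (1 + |x| + σ) * gaussQuartic ≤ C * ((1 + σ) * (1 + |x|)) * gaussQuartic := by gcongr
    _ = _ := by ring

theorem GaussWeight.continuous_heatAvg {k : ℝ → ℝ} (hk : GaussWeight k) {f : ℝ → ℝ} {C : ℝ}
    (hf : Continuous f) (hC : ∀ x, |f x| ≤ C * (1 + |x|)) :
    Continuous fun q : ℝ × ℝ => heatAvg k (√(2 * q.2)) f q.1 := by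
  refine continuous_iff_continuousAt.2 fun ⟨x, t⟩ => ?_
  have h1 := hk.continuousAt_heatAvg (f := fun y _ => f y) (N := C) (x₀ := x) (s₀ := 0)
    (σ₀ := √(2 * t)) (fun _ => hf.measurable) (fun x _ => hC x) (Real.sqrt_nonneg _)
    (Eventually.of_forall fun ζ => by fun_prop)
  have h2 : ContinuousAt (fun q : ℝ × ℝ => (q.1, (0:ℝ), √(2 * q.2))) (x, t) := by fun_prop
  have h3 := ContinuousAt.comp (x := ((x, t) : ℝ × ℝ))
    (f := fun q : ℝ × ℝ => (q.1, (0:ℝ), √(2 * q.2))) h1 h2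
  simpa [Function.comp_def, abs_of_nonneg (Real.sqrt_nonneg _)] using h3

theorem GaussWeight.integrable_growth {k : ℝ → ℝ} (hk : GaussWeight k) {f : ℝ → ℝ} {C : ℝ}
    (hC : 0 ≤ C) (hm : Measurable f) (hf : ∀ x, |f x| ≤ C * (1 + |x|)) {σ : ℝ} (hσ : 0 ≤ σ)
    (x : ℝ) : Integrable (fun ζ => k ζ * f (x + σ * ζ)) stdGauss :=
  hk.integrable_mul (C := C * (1 + |x| + σ)) (hm.comp (by fun_prop)).aestronglyMeasurable
    fun _ => growth_bound hC hσ (hf _)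

/-- Duhamel's formula: the solution of `u_t = u_xx + f` on the line with data `φ`. -/
def heatSolution (φ : ℝ → ℝ) (f : ℝ → ℝ → ℝ) (x t : ℝ) : ℝ :=
  heatAvg (fun _ => 1) (√(2 * t)) φ x + duhamel (fun _ => 1) 0 f x t

/-- The space derivative of `heatSolution`. -/
def heatSolutionGrad (φ' : ℝ → ℝ) (f : ℝ → ℝ → ℝ) (x t : ℝ) : ℝ :=
  heatAvg (fun _ => 1) (√(2 * t)) φ' x + duhamel (fun ζ => ζ) 1 f x t

/-- The second space derivative of `heatSolution`. -/
def heatSolutionHess (φ' : ℝ → ℝ) (f : ℝ → ℝ → ℝ) (x t : ℝ) : ℝ :=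
  (√(2 * t))⁻¹ * heatAvg (fun ζ => ζ) (√(2 * t)) φ' x + duhamel (fun ζ => ζ ^ 2 - 1) 2 f x t

namespace HeatSource

variable {f : ℝ → ℝ → ℝ} {N : ℝ}

theorem abs_duhamel_le_of_bound (hf : HeatSource f N) {k : ℝ → ℝ} (hk : GaussWeight k) {m : ℕ}
    {T : ℝ} (hb : IntegrableOn (fun τ : ℝ => (√(2 * τ))⁻¹ ^ m * (2 * N)) (Ioc 0 T)) {t : ℝ}
    (ht : t ≤ T) (x : ℝ) :
    |duhamel k m f x t| ≤ ∫ τ in Ioi (0:ℝ), (Ioc 0 T).indicator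
      (fun τ => (√(2 * τ))⁻¹ ^ m * (2 * N)) τ := by
  rw [duhamel, ← Real.norm_eq_abs]
  exact norm_integral_le_of_norm_le (integrableOn_indicator hb)
    ((ae_restrict_iff' measurableSet_Ioi).2 (Eventually.of_forall fun τ hτ =>
      hf.abs_integrand_le_indicator ht (fun τ _ _ => hf.abs_integrand_le hk m x t τ) τ hτ))

theorem heatAvg_duhamel (hf : HeatSource f N) {t h : ℝ} (hh : 0 ≤ h) (x : ℝ) :
    heatAvg (fun _ => 1) (√(2 * h)) (fun y => duhamel (fun _ => 1) 0 f y t) x =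
      ∫ τ in Ioi h, duhamelIntegrand (fun _ => 1) 0 f x (t + h) τ := by
  have hm : Measurable fun q : ℝ × ℝ =>
      duhamelIntegrand (fun _ => 1) 0 f (x + √(2 * h) * q.1) t q.2 := by
    have h1 : Measurable fun q : (ℝ × ℝ) × ℝ =>
        f (x + √(2 * h) * q.1.1 + √(2 * q.1.2) * q.2) (t - q.1.2) := by
      have : Measurable fun q : (ℝ × ℝ) × ℝ =>
        (x + √(2 * h) * q.1.1 + √(2 * q.1.2) * q.2, t - q.1.2) := by fun_prop
      exact hf.meas.comp this
    have h2 := h1.stronglyMeasurable.integral_prod_right' (ν := stdGauss)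
    simpa [duhamelIntegrand, heatAvg] using h2.measurable
  have hInt : Integrable (Function.uncurry fun ζ τ =>
      duhamelIntegrand (fun _ => 1) 0 f (x + √(2 * h) * ζ) t τ)
      (stdGauss.prod (volume.restrict (Ioi 0))) := by
    have hb : Integrable (fun q : ℝ × ℝ => (1 : ℝ) * (Ioc 0 t).indicator
        (fun τ => (√(2 * τ))⁻¹ ^ 0 * (2 * N)) q.2) (stdGauss.prod (volume.restrict (Ioi 0))) :=
      (integrable_const (1:ℝ)).mul_prod (integrableOn_indicator (integrableOn_bound_zero N t))
    refine hb.mono' hm.aestronglyMeasurable ?_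
    have h3 : ∀ᵐ q : ℝ × ℝ ∂(stdGauss.prod (volume.restrict (Ioi 0))), q.2 ∈ Ioi (0:ℝ) :=
      Measure.quasiMeasurePreserving_snd.ae (ae_restrict_mem measurableSet_Ioi)
    filter_upwards [h3] with q hq
    rw [one_mul]
    exact hf.abs_integrand_le_indicator le_rfl
      (fun τ _ _ => hf.abs_integrand_le gaussWeight_one 0 _ t τ) q.2 hq
  simp only [heatAvg, one_mul, duhamel]
  rw [integral_integral_swap hInt]
  have hshift := (measurePreserving_add_right volume h).setIntegral_preimage_emb
    (measurableEmbedding_addRight h) (duhamelIntegrand (fun _ => 1) 0 f x (t + h)) (Ioi h)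
  rw [← hshift]
  have hpre : (fun x => x + h) ⁻¹' Ioi h = Ioi 0 := by ext; simp
  rw [hpre]
  refine setIntegral_congr_fun measurableSet_Ioi fun τ hτ => ?_
  have hτ : 0 < τ := hτ
  have h4 := heatAvg_heatAvg (hf.meas_slice (t - τ)) hf.nonneg (fun y => (hf.bound y _).trans
    (le_mul_of_one_le_right hf.nonneg (by linarith [abs_nonneg y]))) (√(2 * h)) (√(2 * τ)) x
  rw [Real.sq_sqrt (by linarith), Real.sq_sqrt (by linarith)] at h4
  simp only [duhamelIntegrand, pow_zero, one_mul]
  rw [show t + h - (τ + h) = t - τ by ring, show 2 * (τ + h) = 2 * h + 2 * τ by ring, ← h4]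
  simp [heatAvg]

/-- Restarting Duhamel's formula at time `t`. -/
theorem heatSolution_add (hf : HeatSource f N) {φ : ℝ → ℝ} (hφ : Continuous φ) {C : ℝ}
    (hC : 0 ≤ C) (hφC : ∀ x, |φ x| ≤ C * (1 + |x|)) {t h : ℝ} (ht : 0 ≤ t) (hh : 0 ≤ h)
    (x : ℝ) : heatSolution φ f x (t + h) =
      heatAvg (fun _ => 1) (√(2 * h)) (fun y => heatSolution φ f y t) x +
        ∫ τ in Ioc 0 h, duhamelIntegrand (fun _ => 1) 0 f x (t + h) τ := by
  have hc1 : Continuous fun y => heatAvg (fun _ => 1) (√(2 * t)) φ y :=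
    (gaussWeight_one.continuous_heatAvg hφ hφC).comp (by fun_prop : Continuous fun y => (y, t))
  have hc2 : Continuous fun y => duhamel (fun _ => 1) 0 f y t :=
    (hf.continuous_duhamel_zero gaussWeight_one).comp (by fun_prop : Continuous fun y => (y, t))
  have hq : 0 ≤ gaussQuartic := integral_nonneg fun ζ => by positivity
  have hi1 := gaussWeight_one.integrable_growth (by positivity) hc1.measurable
    (fun y => gaussWeight_one.abs_heatAvg_le_growth hC hφC (Real.sqrt_nonneg (2 * t)) y)
    (Real.sqrt_nonneg (2 * h)) x
  have hi2 := gaussWeight_one.integrable_bdd hc2.measurable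
    (fun y => hf.abs_duhamel_le_of_bound gaussWeight_one (integrableOn_bound_zero N t) le_rfl y)
    (√(2 * h)) x
  have h1 : heatAvg (fun _ => 1) (√(2 * h)) (fun y => heatSolution φ f y t) x =
      heatAvg (fun _ => 1) (√(2 * h)) (heatAvg (fun _ => 1) (√(2 * t)) φ) x +
      heatAvg (fun _ => 1) (√(2 * h)) (fun y => duhamel (fun _ => 1) 0 f y t) x := by
    simp only [heatSolution]
    rw [heatAvg, heatAvg, heatAvg, ← integral_add hi1 hi2]
    simp only [mul_add]
  rw [h1, heatAvg_heatAvg hφ.measurable hC hφC, hf.heatAvg_duhamel hh, heatSolution, duhamel,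
    Real.sq_sqrt (by linarith), Real.sq_sqrt (by linarith),
    show 2 * h + 2 * t = 2 * (t + h) by ring, add_assoc]
  congr 1
  have hInt := hf.integrable_zero gaussWeight_one x (t + h)
  rw [add_comm (∫ τ in Ioi h, _), ← Ioc_union_Ioi_eq_Ioi hh, setIntegral_union (by
      rw [Set.disjoint_left]; intro y hy hy'; exact absurd hy' (not_lt.2 hy.2)) measurableSet_Ioi
    (hInt.mono_set Ioc_subset_Ioi_self) (hInt.mono_set (Ioi_subset_Ioi hh))]

theorem hasDerivAt_heatSolution (hf : HeatSource f N) {φ φ' : ℝ → ℝ} {C K : ℝ}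
    (hC : 0 ≤ C) (hφC : ∀ x, |φ x| ≤ C * (1 + |x|)) (hφ' : ∀ x, HasDerivAt φ (φ' x) x)
    (hm : Measurable φ') (hK : ∀ x, |φ' x| ≤ K) (x t : ℝ) :
    HasDerivAt (fun y => heatSolution φ f y t) (heatSolutionGrad φ' f x t) x :=
  (hasDerivAt_heatAvg_of_hasDerivAt gaussWeight_one hφ' hm hK hC hφC (Real.sqrt_nonneg _) x).add
    (hf.hasDerivAt_duhamel x t)

theorem hasDerivWithinAt_heatSolution (hf : HeatSource f N) {φ φ' : ℝ → ℝ} {C K : ℝ}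
    (hC : 0 ≤ C) (hφC : ∀ x, |φ x| ≤ C * (1 + |x|)) (hφ' : ∀ x, HasDerivAt φ (φ' x) x)
    (hm : Measurable φ') (hK : ∀ x, |φ' x| ≤ K) {x t c : ℝ} (ht : 0 < t)
    (hc : ContinuousAt (fun q : ℝ × ℝ => f q.1 q.2) (x, t))
    (hg : HasDerivAt (fun y => heatSolutionGrad φ' f y t) c x) :
    HasDerivWithinAt (fun s => heatSolution φ f x s) (c + f x t) (Ioi t) t := by
  rw [hasDerivWithinAt_iff_tendsto_slope' (by simp)]
  have hcφ : Continuous φ := continuous_iff_continuousAt.2 fun y => (hφ' y).continuousAt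
  have hbd : ∀ y, |heatSolutionGrad φ' f y t| ≤ _ := fun y => (abs_add_le _ _).trans
    (add_le_add (gaussWeight_one.abs_heatAvg_le hK (√(2 * t)) y)
      (hf.abs_duhamel_le_of_bound gaussWeight_id (integrableOn_bound_one N t) le_rfl y))
  have h1 := (tendsto_heatAvg_quotient
    (hf.hasDerivAt_heatSolution hC hφC hφ' hm hK · t) hbd hg).add (hf.tendsto_short_time hc)
  have h2 : Tendsto (fun s : ℝ => s - t) (𝓝[>] t) (𝓝[>] 0) := by
    refine tendsto_nhdsWithin_iff.2 ⟨?_, ?_⟩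
    · have : Continuous fun s : ℝ => s - t := by fun_prop
      simpa using (this.tendsto t).mono_left nhdsWithin_le_nhds
    · filter_upwards [self_mem_nhdsWithin] with s hs
      exact sub_pos.2 (mem_Ioi.1 hs)
  refine (h1.comp h2).congr' ?_
  filter_upwards [self_mem_nhdsWithin] with s hs
  have hs : t < s := hs
  have h3 := hf.heatSolution_add hcφ hC hφC ht.le (sub_pos.2 hs).le x
  rw [add_sub_cancel] at h3
  simp only [Function.comp_apply, slope_def_field, h3, add_sub_cancel]
  ring

theorem hasDerivAt_heatSolutionGrad (hf : HeatSource f N) {φ' : ℝ → ℝ} {K : ℝ}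
    (hm : Measurable φ') (hK : ∀ x, |φ' x| ≤ K) {x t r : ℝ} (hr : 0 < r) (ht : 0 < t)
    (hH : ∀ δ T, 0 < δ → ∃ C, ∀ s, δ ≤ s → s ≤ T → ∀ y ∈ ball x r, ∀ z,
      |f z s - f y s| ≤ C * √|z - y|) :
    HasDerivAt (fun y => heatSolutionGrad φ' f y t) (heatSolutionHess φ' f x t) x :=
  (hasDerivAt_heatAvg_one hm hK (sqrt_two_mul_pos ht) x).add (hf.hasDerivAt_duhamel_one hr ht hH)

theorem continuousAt_heatSolutionHess (hf : HeatSource f N) {φ' : ℝ → ℝ} {K : ℝ}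
    (hc : Continuous φ') (hK : ∀ x, |φ' x| ≤ K) {x t r : ℝ} (hr : 0 < r) (ht : 0 < t)
    (hH : ∀ δ T, 0 < δ → ∃ C, ∀ s, δ ≤ s → s ≤ T → ∀ y ∈ ball x r, ∀ z,
      |f z s - f y s| ≤ C * √|z - y|) :
    ContinuousAt (fun q : ℝ × ℝ => heatSolutionHess φ' f q.1 q.2) (x, t) := by
  have hK0 : 0 ≤ K := (abs_nonneg _).trans (hK 0)
  have h1 := (gaussWeight_id.continuous_heatAvg hc fun x => (hK x).trans
    (le_mul_of_one_le_right hK0 (by linarith [abs_nonneg x]))).continuousAt (x := (x, t))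
  have h2 : ContinuousAt (fun q : ℝ × ℝ => (√(2 * q.2))⁻¹) (x, t) :=
    ContinuousAt.inv₀ (by fun_prop) (sqrt_two_mul_pos ht).ne'
  exact (h2.mul h1).add (hf.continuousAt_duhamel_two hr ht hH)

end HeatSource

/-- The triangle wave of period `4` extending the identity of `[-1,1]` evenly about `±1`. -/
def fold (x : ℝ) : ℝ := 2 / Real.pi * Real.arcsin (Real.sin (Real.pi / 2 * x))

/-- The square wave of period `4` extending `1` on `(-1,1)` oddly about `±1`. -/
def foldSign (x : ℝ) : ℝ := Real.sign (Real.cos (Real.pi / 2 * x))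

theorem continuous_fold : Continuous fold := by
  unfold fold
  have := Real.continuous_arcsin
  fun_prop

theorem fold_of_mem {x : ℝ} (hx : x ∈ Icc (-1:ℝ) 1) : fold x = x := by
  have := Real.pi_pos
  rw [fold, Real.arcsin_sin (by nlinarith [hx.1]) (by nlinarith [hx.2])]
  field_simp

theorem fold_mem (x : ℝ) : fold x ∈ Icc (-1:ℝ) 1 := by
  have h := Real.pi_pos
  have h1 := Real.neg_pi_div_two_le_arcsin (Real.sin (Real.pi / 2 * x))
  have h2 := Real.arcsin_le_pi_div_two (Real.sin (Real.pi / 2 * x))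
  rw [fold, div_mul_eq_mul_div]
  constructor
  · rw [le_div_iff₀ h]; linarith
  · rw [div_le_iff₀ h]; linarith

theorem fold_reflect_one (x : ℝ) : fold (1 + x) = fold (1 - x) := by
  rw [fold, fold, ← Real.sin_pi_sub]
  congr 3; ring

theorem fold_reflect_neg_one (x : ℝ) : fold (-1 + x) = fold (-1 - x) := by
  rw [fold, fold, ← Real.sin_pi_sub, ← Real.sin_sub_two_pi (Real.pi - _)]
  congr 3; ring

theorem foldSign_of_mem {x : ℝ} (hx : x ∈ Ioo (-1:ℝ) 1) : foldSign x = 1 := by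
  have := Real.pi_pos
  exact Real.sign_of_pos (Real.cos_pos_of_mem_Ioo ⟨by nlinarith [hx.1], by nlinarith [hx.2]⟩)

theorem foldSign_reflect_one (x : ℝ) : foldSign (1 + x) = - foldSign (1 - x) := by
  rw [foldSign, foldSign, ← Real.sign_neg, ← Real.cos_pi_sub]
  congr 2; ring

theorem foldSign_reflect_neg_one (x : ℝ) : foldSign (-1 + x) = - foldSign (-1 - x) := by
  rw [foldSign, foldSign, ← Real.sign_neg, ← Real.cos_pi_sub, ← Real.cos_sub_two_pi (Real.pi - _)]
  congr 2; ring

theorem abs_foldSign_le (x : ℝ) : |foldSign x| ≤ 1 := by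
  rcases Real.sign_apply_eq (Real.cos (Real.pi / 2 * x)) with h | h | h <;> simp [foldSign, h]

theorem measurable_foldSign : Measurable foldSign := by
  have hc : Measurable fun x : ℝ => Real.cos (Real.pi / 2 * x) := by fun_prop
  unfold foldSign Real.sign
  exact Measurable.ite (measurableSet_lt hc measurable_const) measurable_const
    (Measurable.ite (measurableSet_lt measurable_const hc) measurable_const measurable_const)

theorem countable_fold_nodes : {x : ℝ | Real.cos (Real.pi / 2 * x) = 0}.Countable := by
  refine (countable_range fun k : ℤ => (2 * k + 1 : ℝ)).mono fun x hx => ?_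
  obtain ⟨k, hk⟩ := Real.cos_eq_zero_iff.1 hx
  refine ⟨k, ?_⟩
  have := Real.pi_pos
  have h2 : Real.pi * (2 * k + 1 : ℝ) = Real.pi * x := by linarith
  exact mul_left_cancel₀ this.ne' h2

theorem continuousAt_foldSign {x : ℝ} (hx : Real.cos (Real.pi / 2 * x) ≠ 0) :
    ContinuousAt foldSign x := by
  have hc : Continuous fun x : ℝ => Real.cos (Real.pi / 2 * x) := by fun_prop
  rcases lt_or_gt_of_ne hx with h | h
  · refine (continuousAt_const (y := (-1:ℝ))).congr ?_
    filter_upwards [hc.continuousAt.eventually_lt_const h] with y hy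
    exact (Real.sign_of_neg hy).symm
  · refine (continuousAt_const (y := (1:ℝ))).congr ?_
    filter_upwards [hc.continuousAt.eventually_const_lt h] with y hy
    exact (Real.sign_of_pos hy).symm

/-- The odd periodic extension of `H(g)`, cut off at nonpositive times. -/
def foldSource (H : ℝ → ℝ) (g : ℝ → ℝ → ℝ) (x s : ℝ) : ℝ :=
  if 0 < s then foldSign x * H (g (fold x) s) else 0

theorem foldSource_of_mem {H : ℝ → ℝ} {g : ℝ → ℝ → ℝ} {x s : ℝ} (hx : x ∈ Ioo (-1:ℝ) 1)
    (hs : 0 < s) : foldSource H g x s = H (g x s) := by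
  rw [foldSource, if_pos hs, foldSign_of_mem hx, fold_of_mem (Ioo_subset_Icc_self hx), one_mul]

theorem heatSource_foldSource {H : ℝ → ℝ} (hH : Continuous H) {N : ℝ} (hN : ∀ ξ, |H ξ| ≤ N)
    {g : ℝ → ℝ → ℝ} (hg : Continuous fun q : ℝ × ℝ => g q.1 q.2) :
    HeatSource (foldSource H g) N where
  meas := by
    have h1 : Continuous fun q : ℝ × ℝ => H (g (fold q.1) q.2) :=
      hH.comp (hg.comp ((continuous_fold.comp continuous_fst).prodMk continuous_snd))
    exact Measurable.ite (measurableSet_lt measurable_const measurable_snd)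
      ((measurable_foldSign.comp measurable_fst).mul h1.measurable) measurable_const
  bound x s := by
    unfold foldSource
    split_ifs
    · rw [abs_mul]
      calc _ ≤ 1 * N := mul_le_mul (abs_foldSign_le x) (hN _) (abs_nonneg _) zero_le_one
        _ = N := one_mul N
    · rw [abs_zero]; exact (abs_nonneg _).trans (hN 0)
  zero x s hs := if_neg (not_lt.2 hs)
  cont := by
    refine ⟨_, countable_fold_nodes, fun x hx s hs => ?_⟩
    rcases lt_or_gt_of_ne hs with h | h
    · refine (continuousAt_const (y := (0:ℝ))).congr ?_
      filter_upwards [(continuousAt_snd (p := ((x, s) : ℝ × ℝ))).eventually_lt_const h] with q hq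
      exact (if_neg (not_lt.2 hq.le)).symm
    · have h1 : Continuous fun q : ℝ × ℝ => H (g (fold q.1) q.2) :=
        hH.comp (hg.comp ((continuous_fold.comp continuous_fst).prodMk continuous_snd))
      have h2 : ContinuousAt (fun q : ℝ × ℝ => foldSign q.1) (x, s) :=
        ContinuousAt.comp (f := Prod.fst) (x := ((x, s) : ℝ × ℝ)) (continuousAt_foldSign hx)
          continuousAt_fst
      refine (h2.mul h1.continuousAt).congr ?_
      filter_upwards [(continuousAt_snd (p := ((x, s) : ℝ × ℝ))).eventually_const_lt h] with q hq
      exact (if_pos hq).symm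

theorem heatAvg_one_eq_zero_of_odd {F : ℝ → ℝ} {a : ℝ} (h : ∀ x, F (a + x) = - F (a - x))
    (σ : ℝ) : heatAvg (fun _ => 1) σ F a = 0 := by
  have h1 : ∫ ζ, F (a + σ * ζ) ∂stdGauss = ∫ ζ, F (a + σ * (-ζ)) ∂stdGauss := by
    have h2 : stdGauss.map (fun ζ => -ζ) = stdGauss := by
      rw [stdGauss, ProbabilityTheory.gaussianReal_map_neg, neg_zero]
    conv_lhs => rw [← h2]
    exact (MeasurableEquiv.neg ℝ).measurableEmbedding.integral_map (fun ζ => F (a + σ * ζ))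
  have h3 : ∫ ζ, F (a + σ * (-ζ)) ∂stdGauss = - ∫ ζ, F (a + σ * ζ) ∂stdGauss := by
    rw [← integral_neg]
    congr 1 with ζ
    rw [h (σ * ζ), neg_neg]
    congr 1; ring
  simp only [heatAvg, one_mul]
  linarith

/-- The normalising constant in the contraction estimate. -/
theorem integral_inv_sqrt_mul_exp {β : ℝ} (hβ : 0 < β) :
    IntegrableOn (fun τ : ℝ => (√(2 * τ))⁻¹ * Real.exp (-(β * τ))) (Ioi 0) ∧
    ∫ τ in Ioi (0:ℝ), (√(2 * τ))⁻¹ * Real.exp (-(β * τ)) = √(Real.pi / (2 * β)) := by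
  have hcongr : ∀ τ ∈ Ioi (0:ℝ), (√2)⁻¹ * (τ ^ ((1 / 2 : ℝ) - 1) * Real.exp (-(β * τ))) =
      (√(2 * τ))⁻¹ * Real.exp (-(β * τ)) := fun τ hτ => by
    have hτ : 0 < τ := hτ
    rw [show (1 / 2 : ℝ) - 1 = -(1 / 2) by norm_num, Real.rpow_neg hτ.le, ← Real.sqrt_eq_rpow,
      Real.sqrt_mul zero_le_two, mul_inv, mul_assoc]
  have hval := Real.integral_rpow_mul_exp_neg_mul_Ioi (a := 1 / 2) (by norm_num) hβ
  have hpos : 0 < (1 / β) ^ (1 / 2 : ℝ) * Real.Gamma (1 / 2) :=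
    mul_pos (by positivity) (Real.Gamma_pos_of_pos (by norm_num))
  have hInt : IntegrableOn (fun τ : ℝ => τ ^ ((1 / 2 : ℝ) - 1) * Real.exp (-(β * τ))) (Ioi 0) := by
    by_contra hcon
    rw [integral_undef hcon] at hval
    exact hpos.ne hval
  refine ⟨IntegrableOn.congr_fun (hInt.const_mul (√2)⁻¹) hcongr measurableSet_Ioi, ?_⟩
  rw [← setIntegral_congr_fun measurableSet_Ioi hcongr, integral_const_mul, hval,
    Real.Gamma_one_half_eq, ← Real.sqrt_eq_rpow, ← Real.sqrt_inv, ← Real.sqrt_mul (by positivity),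
    ← Real.sqrt_mul (by positivity)]
  congr 1
  field_simp

theorem HeatSource.abs_duhamel_one_sub_le {f₁ f₂ : ℝ → ℝ → ℝ} {N A β : ℝ} (hf₁ : HeatSource f₁ N)
    (hf₂ : HeatSource f₂ N) (hβ : 0 < β)
    (h : ∀ x s, |f₁ x s - f₂ x s| ≤ A * Real.exp (β * s)) (x t : ℝ) :
    |duhamel (fun ζ => ζ) 1 f₁ x t - duhamel (fun ζ => ζ) 1 f₂ x t| ≤
      2 * A * √(Real.pi / (2 * β)) * Real.exp (β * t) := by
  obtain ⟨hi, hv⟩ := integral_inv_sqrt_mul_exp hβ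
  rw [duhamel, duhamel, ← integral_sub (hf₁.integrable_one gaussWeight_id x t)
    (hf₂.integrable_one gaussWeight_id x t), ← hv, mul_right_comm, ← integral_const_mul,
    ← Real.norm_eq_abs]
  refine norm_integral_le_of_norm_le (hi.const_mul _)
    ((ae_restrict_iff' measurableSet_Ioi).2 (Eventually.of_forall fun τ _ => ?_))
  have h1 : heatAvg (fun ζ => ζ) (√(2 * τ)) (fun y => f₁ y (t - τ)) x -
      heatAvg (fun ζ => ζ) (√(2 * τ)) (fun y => f₂ y (t - τ)) x =
      heatAvg (fun ζ => ζ) (√(2 * τ)) (fun y => f₁ y (t - τ) - f₂ y (t - τ)) x := by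
    rw [heatAvg, heatAvg, heatAvg, ← integral_sub
      (gaussWeight_id.integrable_bdd (hf₁.meas_slice _) (fun y => hf₁.bound y _) _ _)
      (gaussWeight_id.integrable_bdd (hf₂.meas_slice _) (fun y => hf₂.bound y _) _ _)]
    simp only [mul_sub]
  rw [duhamelIntegrand, duhamelIntegrand, ← mul_sub, h1, pow_one, Real.norm_eq_abs, abs_mul,
    abs_of_nonneg (by positivity)]
  have h2 := gaussWeight_id.abs_heatAvg_le (fun y => h y (t - τ)) (√(2 * τ)) x
  rw [show β * (t - τ) = β * t + -(β * τ) by ring, Real.exp_add] at h2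
  calc _ ≤ (√(2 * τ))⁻¹ * (2 * (A * (Real.exp (β * t) * Real.exp (-(β * τ))))) := by gcongr
    _ = _ := by ring

theorem heatSource_zero {N : ℝ} (hN : 0 ≤ N) : HeatSource (fun _ _ => 0) N :=
  ⟨measurable_const, fun _ _ => by simpa using hN, fun _ _ _ => rfl,
    ∅, countable_empty, fun _ _ _ _ => continuousAt_const⟩

/-- Solvability of the fixed point equation for the gradient. -/
theorem exists_gradient_fixedPoint {H : ℝ → ℝ} {L N : ℝ} (hL : 0 ≤ L)
    (hLip : ∀ a b, |H a - H b| ≤ L * |a - b|) (hN : ∀ ξ, |H ξ| ≤ N)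
    {φ' : ℝ → ℝ} (hφ' : Continuous φ') {K : ℝ} (hK : ∀ x, |φ' x| ≤ K) :
    ∃ f, HeatSource f N ∧ f = foldSource H (heatSolutionGrad φ' f) := by
  have hN0 : 0 ≤ N := (abs_nonneg _).trans (hN 0)
  have hK0 : 0 ≤ K := (abs_nonneg _).trans (hK 0)
  have hHc : Continuous H := by
    refine (LipschitzWith.of_dist_le_mul (K := L.toNNReal) fun a b => ?_).continuous
    rw [Real.coe_toNNReal L hL]
    exact hLip a b
  set β : ℝ := 8 * Real.pi * L ^ 2 + 1 with hβdef
  have hπ := Real.pi_pos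
  have hβ : 0 < β := by positivity
  set cβ : ℝ := √(Real.pi / (2 * β))
  have hcβ : 2 * L * cβ ≤ 1 / 2 := by
    refine abs_le_of_sq_le_sq' ?_ (by norm_num) |>.2
    rw [mul_pow, Real.sq_sqrt (by positivity), mul_div_assoc', div_le_iff₀ (by positivity), hβdef]
    nlinarith [mul_pos hπ hπ, mul_nonneg hπ.le (sq_nonneg L)]
  let E := BoundedContinuousFunction (ℝ × ℝ) ℝ
  let src : E → ℝ → ℝ → ℝ := fun h => foldSource H fun x s => Real.exp (β * s) * h (x, s)
  have hsrc : ∀ h, HeatSource (src h) N := fun h =>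
    heatSource_foldSource hHc hN (by fun_prop)
  have hexp : ∀ s : ℝ, 0 < s → 1 ≤ Real.exp (β * s) := fun s hs =>
    Real.one_le_exp (by positivity)
  have hcont : ∀ h : E, Continuous fun q : ℝ × ℝ =>
      Real.exp (-(β * max q.2 0)) * heatSolutionGrad φ' (src h) q.1 (max q.2 0) := fun h => by
    have h1 : Continuous fun q : ℝ × ℝ => (q.1, max q.2 0) := by fun_prop
    have h2 : Continuous fun q : ℝ × ℝ => heatSolutionGrad φ' (src h) q.1 q.2 :=
      (gaussWeight_one.continuous_heatAvg hφ' fun x => (hK x).trans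
        (le_mul_of_one_le_right hK0 (by linarith [abs_nonneg x]))).add
        ((hsrc h).continuous_duhamel_one gaussWeight_id)
    have h3 : Continuous fun q : ℝ × ℝ => Real.exp (-(β * max q.2 0)) := by fun_prop
    exact h3.mul (h2.comp h1)
  have hbound : ∀ (h : E) (q : ℝ × ℝ),
      ‖Real.exp (-(β * max q.2 0)) * heatSolutionGrad φ' (src h) q.1 (max q.2 0)‖ ≤
        2 * K + 2 * N * cβ := fun h q => by
    have h1 := (hsrc h).abs_duhamel_one_sub_le (heatSource_zero hN0) (A := N) hβ (fun x s => by
      rw [sub_zero]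
      by_cases hs : 0 < s
      · exact ((hsrc h).bound x s).trans (le_mul_of_one_le_right hN0 (hexp s hs))
      · rw [(hsrc h).zero x s (not_lt.1 hs), abs_zero]; positivity) q.1 (max q.2 0)
    have h0 : duhamel (fun ζ => ζ) 1 (fun _ _ => 0) q.1 (max q.2 0) = 0 := by
      simp [duhamel, duhamelIntegrand, heatAvg]
    rw [h0, sub_zero] at h1
    have h2 := gaussWeight_one.abs_heatAvg_le hK (√(2 * max q.2 0)) q.1
    rw [Real.norm_eq_abs, abs_mul, Real.abs_exp, heatSolutionGrad]
    have h3 : Real.exp (-(β * max q.2 0)) * Real.exp (β * max q.2 0) = 1 := by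
      rw [← Real.exp_add]; simp
    have h4 : Real.exp (-(β * max q.2 0)) ≤ 1 :=
      Real.exp_le_one_iff.2 (neg_nonpos.2 (by positivity))
    calc _ ≤ Real.exp (-(β * max q.2 0)) *
          (2 * K + 2 * N * cβ * Real.exp (β * max q.2 0)) := by
          gcongr; exact (abs_add_le _ _).trans (add_le_add h2 h1)
      _ = Real.exp (-(β * max q.2 0)) * (2 * K) + 2 * N * cβ *
          (Real.exp (-(β * max q.2 0)) * Real.exp (β * max q.2 0)) := by ring
      _ ≤ 1 * (2 * K) + 2 * N * cβ * 1 := by rw [h3]; gcongr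
      _ = _ := by ring
  let Φ : E → E := fun h => BoundedContinuousFunction.ofNormedAddCommGroup _ (hcont h) _ (hbound h)
  have hΦ : ContractingWith (1 / 2) Φ := by
    refine ⟨by norm_num, LipschitzWith.of_dist_le_mul fun h₁ h₂ => ?_⟩
    rw [BoundedContinuousFunction.dist_le (by positivity)]
    intro q
    have h1 := (hsrc h₁).abs_duhamel_one_sub_le (hsrc h₂) (A := L * dist h₁ h₂) hβ (fun x s => by
      by_cases hs : 0 < s
      · simp only [src, foldSource, if_pos hs]
        rw [← mul_sub, abs_mul]
        have h2 := hLip (Real.exp (β * s) * h₁ (fold x, s)) (Real.exp (β * s) * h₂ (fold x, s))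
        rw [← mul_sub, abs_mul, Real.abs_exp] at h2
        have h3 : |h₁ (fold x, s) - h₂ (fold x, s)| ≤ dist h₁ h₂ := by
          rw [← Real.dist_eq]; exact BoundedContinuousFunction.dist_coe_le_dist _
        calc _ ≤ 1 * (L * (Real.exp (β * s) * dist h₁ h₂)) := by
              gcongr
              · exact abs_foldSign_le x
              · exact h2.trans (by gcongr)
          _ = _ := by ring
      · rw [(hsrc h₁).zero x s (not_lt.1 hs), (hsrc h₂).zero x s (not_lt.1 hs)]
        simp; positivity) q.1 (max q.2 0)
    change |Real.exp (-(β * max q.2 0)) * heatSolutionGrad φ' (src h₁) q.1 (max q.2 0) -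
      Real.exp (-(β * max q.2 0)) * heatSolutionGrad φ' (src h₂) q.1 (max q.2 0)| ≤ _
    rw [← mul_sub, abs_mul, Real.abs_exp, heatSolutionGrad, heatSolutionGrad, add_sub_add_left_eq_sub]
    have h3 : Real.exp (-(β * max q.2 0)) * Real.exp (β * max q.2 0) = 1 := by
      rw [← Real.exp_add]; simp
    calc _ ≤ Real.exp (-(β * max q.2 0)) *
          (2 * (L * dist h₁ h₂) * cβ * Real.exp (β * max q.2 0)) := by gcongr
      _ = (2 * L * cβ) * dist h₁ h₂ *
          (Real.exp (-(β * max q.2 0)) * Real.exp (β * max q.2 0)) := by ring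
      _ ≤ (1 / 2) * dist h₁ h₂ * 1 := by rw [h3]; gcongr
      _ = _ := by simp
  let h := hΦ.fixedPoint
  have hfix : Φ h = h := hΦ.fixedPoint_isFixedPt
  refine ⟨src h, hsrc h, ?_⟩
  ext x s
  by_cases hs : 0 < s
  · simp only [src, foldSource, if_pos hs]
    congr 2
    conv_lhs => rw [← hfix]
    change Real.exp (β * s) * (Real.exp (-(β * max s 0)) *
      heatSolutionGrad φ' (src h) (fold x) (max s 0)) = _
    rw [max_eq_left hs.le, ← mul_assoc, ← Real.exp_add]
    simp [src]
  · simp only [src, foldSource, if_neg hs]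

/-- The odd extension about `±1` of a `C¹` function vanishing at `±1`. -/
theorem exists_odd_extension {u0 : ℝ → ℝ} (hu : ContDiffOn ℝ 1 u0 (Icc (-1) 1))
    (hl : u0 (-1) = 0) (hr : u0 1 = 0) : ∃ φ φ' : ℝ → ℝ, ∃ K, 0 ≤ K ∧ Continuous φ' ∧
      (∀ x, |φ' x| ≤ K) ∧ (∀ x, HasDerivAt φ (φ' x) x) ∧ (∀ x, |φ x| ≤ K * (1 + |x|)) ∧
      (∀ x ∈ Icc (-1:ℝ) 1, φ x = u0 x) ∧ (∀ x, φ (1 + x) = - φ (1 - x)) ∧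
      (∀ x, φ (-1 + x) = - φ (-1 - x)) := by
  have huniq : UniqueDiffOn ℝ (Icc (-1:ℝ) 1) := uniqueDiffOn_Icc (by norm_num)
  have hc : ContinuousOn (derivWithin u0 (Icc (-1) 1)) (Icc (-1) 1) :=
    hu.continuousOn_derivWithin huniq le_rfl
  obtain ⟨K, hK⟩ := isCompact_Icc.exists_bound_of_continuousOn hc
  set φ' : ℝ → ℝ := fun x => derivWithin u0 (Icc (-1) 1) (fold x)
  have hφ' : Continuous φ' := hc.comp_continuous continuous_fold fold_mem
  have hK' : ∀ x, |φ' x| ≤ K := fun x => hK _ (fold_mem x)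
  have hK0 : 0 ≤ K := (abs_nonneg _).trans (hK' 0)
  set φ : ℝ → ℝ := fun x => ∫ y in (-1:ℝ)..x, φ' y
  have hd : ∀ x, HasDerivAt φ (φ' x) x := fun x =>
    intervalIntegral.integral_hasDerivAt_right (hφ'.intervalIntegrable _ _)
      (hφ'.stronglyMeasurableAtFilter _ _) hφ'.continuousAt
  have heq : ∀ x ∈ Icc (-1:ℝ) 1, φ x = u0 x := fun x hx => by
    have h1 : ∫ y in (-1:ℝ)..x, φ' y = u0 x - u0 (-1) := by
      refine intervalIntegral.integral_eq_sub_of_hasDerivAt_of_le hx.1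
        (hu.continuousOn.mono (Icc_subset_Icc_right hx.2)) (fun y hy => ?_)
        (hφ'.intervalIntegrable _ _)
      have hy' : y ∈ Ioo (-1:ℝ) 1 := ⟨hy.1, hy.2.trans_le hx.2⟩
      have h2 := (hu.differentiableOn one_ne_zero y (Ioo_subset_Icc_self hy')).hasDerivWithinAt
      simp only [φ', fold_of_mem (Ioo_subset_Icc_self hy')]
      exact h2.hasDerivAt (Icc_mem_nhds hy'.1 hy'.2)
    rw [hl, sub_zero] at h1
    exact h1
  have hodd : ∀ a : ℝ, φ a = 0 → (∀ x, φ' (a + x) = φ' (a - x)) →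
      ∀ x, φ (a + x) = - φ (a - x) := fun a ha hs x => by
    have hD : ∀ y, HasDerivAt (fun y => φ (a + y) + φ (a - y)) 0 y := fun y => by
      have h1 := (hd (a + y)).comp y ((hasDerivAt_id' y).const_add a)
      have h2 := (hd (a - y)).comp y ((hasDerivAt_id' y).const_sub a)
      refine (h1.add h2).congr_deriv ?_
      rw [hs y]; ring
    have h3 := is_const_of_deriv_eq_zero (fun y => (hD y).differentiableAt)
      (fun y => (hD y).deriv) x 0
    simp only [add_zero, sub_zero, ha] at h3
    linarith
  refine ⟨φ, φ', K, hK0, hφ', hK', hd, fun x => ?_, heq, hodd 1 ?_ fun x => ?_,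
    hodd (-1) ?_ fun x => ?_⟩
  · have h1 := intervalIntegral.norm_integral_le_of_norm_le_const (a := (-1:ℝ)) (b := x)
      (f := φ') (C := K) fun y _ => hK' y
    refine h1.trans (mul_le_mul_of_nonneg_left ?_ hK0)
    rw [sub_neg_eq_add, add_comm 1 |x|]
    simpa using abs_add_le x 1
  · rw [heq 1 (by norm_num), hr]
  · simp only [φ', fold_reflect_one]
  · simp [φ]
  · simp only [φ', fold_reflect_neg_one]

/-- `u` is a classical solution of `u_t = u_xx + H(u_x)` on `[-1,1] × [0,∞)` vanishing on the
lateral boundary, with gradient `g` continuous up to the parabolic boundary. -/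
structure DirichletSol (H u0 : ℝ → ℝ) (u g c : ℝ → ℝ → ℝ) : Prop where
  cont : ContinuousOn (fun q : ℝ × ℝ => u q.1 q.2) (Icc (-1) 1 ×ˢ Ici 0)
  cont_grad : ContinuousOn (fun q : ℝ × ℝ => g q.1 q.2) (Icc (-1) 1 ×ˢ Ici 0)
  cont_hess : ContinuousOn (fun q : ℝ × ℝ => c q.1 q.2) (Ioo (-1) 1 ×ˢ Ioi 0)
  grad : ∀ x ∈ Ioo (-1:ℝ) 1, ∀ t, 0 ≤ t → HasDerivAt (fun y => u y t) (g x t) x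
  hess : ∀ x ∈ Ioo (-1:ℝ) 1, ∀ t, 0 < t → HasDerivAt (fun y => g y t) (c x t) x
  time : ∀ x ∈ Ioo (-1:ℝ) 1, ∀ t, 0 < t → HasDerivAt (fun s => u x s) (c x t + H (g x t)) t
  bc : ∀ t, 0 ≤ t → u (-1) t = 0 ∧ u 1 t = 0
  ic : ∀ x ∈ Icc (-1:ℝ) 1, u x 0 = u0 x

theorem HeatSource.duhamel_eq_zero_of_odd {f : ℝ → ℝ → ℝ} {a : ℝ}
    (h : ∀ s x, f (a + x) s = - f (a - x) s) (t : ℝ) : duhamel (fun _ => 1) 0 f a t = 0 := by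
  have h1 : ∀ τ, heatAvg (fun _ => 1) (√(2 * τ)) (fun y => f y (t - τ)) a = 0 := fun τ =>
    heatAvg_one_eq_zero_of_odd (F := fun y => f y (t - τ)) (h (t - τ)) _
  simp only [duhamel, duhamelIntegrand, h1, mul_zero, integral_zero]

theorem foldSource_odd {H : ℝ → ℝ} {g : ℝ → ℝ → ℝ} {a : ℝ} (h1 : ∀ x, fold (a + x) = fold (a - x))
    (h2 : ∀ x, foldSign (a + x) = - foldSign (a - x)) (s x : ℝ) :
    foldSource H g (a + x) s = - foldSource H g (a - x) s := by
  unfold foldSource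
  split_ifs
  · rw [h1, h2, neg_mul]
  · simp

theorem abs_sub_le_of_hasDerivAt {F F' : ℝ → ℝ} {K : ℝ} (hF : ∀ x, HasDerivAt F (F' x) x)
    (hK : ∀ x, |F' x| ≤ K) (x y : ℝ) : |F x - F y| ≤ K * |x - y| :=
  convex_univ.norm_image_sub_le_of_norm_hasDerivWithin_le (f := F) (f' := F')
    (fun x _ => (hF x).hasDerivWithinAt) (fun x _ => hK x) (mem_univ y) (mem_univ x)

/-- The gradient of a heat solution is Hölder continuous in space, away from `t = 0`. -/
theorem HeatSource.exists_abs_heatSolutionGrad_sub_le {f : ℝ → ℝ → ℝ} {N : ℝ}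
    (hf : HeatSource f N) {φ' : ℝ → ℝ} {K : ℝ} (hm : Measurable φ') (hK : ∀ x, |φ' x| ≤ K)
    {δ T : ℝ} (hδ : 0 < δ) : ∃ C, 0 ≤ C ∧ ∀ s, δ ≤ s → s ≤ T → ∀ y z,
      |heatSolutionGrad φ' f z s - heatSolutionGrad φ' f y s| ≤ C * √|z - y| := by
  have hK0 : 0 ≤ K := (abs_nonneg _).trans (hK 0)
  obtain ⟨C, hC⟩ := hf.exists_abs_duhamel_one_sub_le T
  have hδ' := sqrt_two_mul_pos hδ
  refine ⟨√(4 * K * ((√(2 * δ))⁻¹ * (2 * K))) + |C|, by positivity, fun s hs hsT y z => ?_⟩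
  have hs0 : 0 < s := hδ.trans_le hs
  have hs' := sqrt_two_mul_pos hs0
  have h1 : |heatAvg (fun _ => 1) (√(2 * s)) φ' z - heatAvg (fun _ => 1) (√(2 * s)) φ' y| ≤
      √(4 * K * ((√(2 * δ))⁻¹ * (2 * K))) * √|z - y| := by
    rw [← Real.sqrt_mul (by positivity), mul_assoc]
    refine le_sqrt_mul_of_le (abs_nonneg _) ?_ ?_
    · have ha := gaussWeight_one.abs_heatAvg_le hK (√(2 * s)) z
      have hb := gaussWeight_one.abs_heatAvg_le hK (√(2 * s)) y
      rw [abs_le] at ha hb ⊢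
      constructor <;> linarith
    · refine (abs_sub_le_of_hasDerivAt (fun x => hasDerivAt_heatAvg_one hm hK hs' x)
        (fun x => ?_) z y)
      rw [abs_mul, abs_of_pos (inv_pos.2 hs')]
      gcongr
      exact gaussWeight_id.abs_heatAvg_le hK _ _
  have h2 := (hC s hsT z y).trans (mul_le_mul_of_nonneg_right (le_abs_self C) (Real.sqrt_nonneg _))
  rw [heatSolutionGrad, heatSolutionGrad, add_sub_add_comm, add_mul]
  exact (abs_add_le _ _).trans (add_le_add h1 h2)

theorem exists_abs_foldSource_sub_le {H : ℝ → ℝ} {L N : ℝ} (hL : 0 ≤ L)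
    (hLip : ∀ a b, |H a - H b| ≤ L * |a - b|) (hN : ∀ ξ, |H ξ| ≤ N) {φ' : ℝ → ℝ} {K : ℝ}
    (hm : Measurable φ') (hK : ∀ x, |φ' x| ≤ K) {f : ℝ → ℝ → ℝ} (hf : HeatSource f N)
    (hfix : f = foldSource H (heatSolutionGrad φ' f)) {x r : ℝ} (hr : 0 < r)
    (hx : |x| + 2 * r ≤ 1) (δ T : ℝ) (hδ : 0 < δ) : ∃ C, ∀ s, δ ≤ s → s ≤ T → ∀ y ∈ ball x r, ∀ z,
      |f z s - f y s| ≤ C * √|z - y| := by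
  obtain ⟨C, hC0, hC⟩ := hf.exists_abs_heatSolutionGrad_sub_le (T := T) hm hK hδ
  have hN0 : 0 ≤ N := (abs_nonneg _).trans (hN 0)
  refine ⟨L * C + 2 * N / √r, fun s hs hsT y hy z => ?_⟩
  have hs0 : 0 < s := hδ.trans_le hs
  have hyx : |y - x| < r := hy
  have hx' := abs_le.1 (show |x| ≤ 1 - 2 * r by linarith)
  have hyx' := abs_lt.1 hyx
  have hy1 : y ∈ Ioo (-1:ℝ) 1 := ⟨by linarith, by linarith⟩
  have hsr : 0 < √r := Real.sqrt_pos.2 hr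
  by_cases hz : z ∈ Ioo (-1:ℝ) 1
  · rw [hfix, foldSource_of_mem hz hs0, foldSource_of_mem hy1 hs0]
    calc _ ≤ L * (C * √|z - y|) := (hLip _ _).trans (by gcongr; exact hC s hs hsT y z)
      _ ≤ _ := by
        rw [add_mul, mul_assoc]
        exact le_add_of_nonneg_right (by positivity)
  · have h1 : r ≤ |z - y| := by
      by_contra hcon
      have := abs_lt.1 (not_le.1 hcon)
      exact hz ⟨by linarith, by linarith⟩
    have ha := hf.bound z s
    have hb := hf.bound y s
    calc _ ≤ 2 * N := by
          rw [abs_le] at ha hb ⊢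
          constructor <;> linarith
      _ = 2 * N / √r * √r := by field_simp
      _ ≤ 2 * N / √r * √|z - y| := by gcongr
      _ ≤ _ := by
        rw [add_mul]
        exact le_add_of_nonneg_left (by positivity)

theorem exists_dirichletSol {H : ℝ → ℝ} {L N : ℝ} (hL : 0 ≤ L)
    (hLip : ∀ a b, |H a - H b| ≤ L * |a - b|) (hN : ∀ ξ, |H ξ| ≤ N) {u0 : ℝ → ℝ}
    (hu : ContDiffOn ℝ 1 u0 (Icc (-1) 1)) (hl : u0 (-1) = 0) (hr : u0 1 = 0) :
    ∃ u g c, DirichletSol H u0 u g c := by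
  obtain ⟨φ, φ', K, hK0, hφ'c, hK, hφ', hφC, hφu, hφ1, hφ2⟩ := exists_odd_extension hu hl hr
  obtain ⟨f, hf, hfix⟩ := exists_gradient_fixedPoint hL hLip hN hφ'c hK
  have hHc : Continuous H := by
    refine (LipschitzWith.of_dist_le_mul (K := L.toNNReal) fun a b => ?_).continuous
    rw [Real.coe_toNNReal L hL]
    exact hLip a b
  have hφc : Continuous φ := continuous_iff_continuousAt.2 fun y => (hφ' y).continuousAt
  have hm := hφ'c.measurable
  have hcu : Continuous fun q : ℝ × ℝ => heatSolution φ f q.1 q.2 :=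
    (gaussWeight_one.continuous_heatAvg hφc hφC).add (hf.continuous_duhamel_zero gaussWeight_one)
  have hcg : Continuous fun q : ℝ × ℝ => heatSolutionGrad φ' f q.1 q.2 :=
    (gaussWeight_one.continuous_heatAvg hφ'c fun x => (hK x).trans
      (le_mul_of_one_le_right hK0 (by linarith [abs_nonneg x]))).add
      (hf.continuous_duhamel_one gaussWeight_id)
  have hHol : ∀ x ∈ Ioo (-1:ℝ) 1, ∃ r, 0 < r ∧ ∀ δ T, 0 < δ → ∃ C, ∀ s, δ ≤ s → s ≤ T →
      ∀ y ∈ ball x r, ∀ z, |f z s - f y s| ≤ C * √|z - y| := fun x hx => by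
    have h1 : |x| < 1 := abs_lt.2 hx
    exact ⟨(1 - |x|) / 2, by linarith, exists_abs_foldSource_sub_le hL hLip hN hm hK hf hfix
      (by linarith) (by linarith)⟩
  have hcf : ∀ x ∈ Ioo (-1:ℝ) 1, ∀ t, 0 < t →
      ContinuousAt (fun q : ℝ × ℝ => f q.1 q.2) (x, t) := fun x hx t ht => by
    refine ((hHc.comp hcg).continuousAt (x := (x, t))).congr ?_
    filter_upwards [(isOpen_Ioo.prod isOpen_Ioi).mem_nhds (mk_mem_prod hx ht)] with q hq
    rw [hfix, foldSource_of_mem hq.1 hq.2, ← hfix]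
    rfl
  have hfH : ∀ x ∈ Ioo (-1:ℝ) 1, ∀ t, 0 < t → f x t = H (heatSolutionGrad φ' f x t) :=
    fun x hx t ht => by
      conv_lhs => rw [hfix]
      rw [foldSource_of_mem hx ht]
  have hhess : ∀ x ∈ Ioo (-1:ℝ) 1, ∀ t, 0 < t → HasDerivAt (fun y => heatSolutionGrad φ' f y t)
      (heatSolutionHess φ' f x t) x := fun x hx t ht => by
    obtain ⟨r, hr, hH⟩ := hHol x hx
    exact hf.hasDerivAt_heatSolutionGrad hm hK hr ht hH
  have hch : ∀ x ∈ Ioo (-1:ℝ) 1, ∀ t, 0 < t →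
      ContinuousAt (fun q : ℝ × ℝ => heatSolutionHess φ' f q.1 q.2) (x, t) := fun x hx t ht => by
    obtain ⟨r, hr, hH⟩ := hHol x hx
    exact hf.continuousAt_heatSolutionHess hφ'c hK hr ht hH
  refine ⟨heatSolution φ f, heatSolutionGrad φ' f, heatSolutionHess φ' f, hcu.continuousOn,
    hcg.continuousOn, fun q hq => (hch q.1 hq.1 q.2 hq.2).continuousWithinAt,
    fun x _ t _ => hf.hasDerivAt_heatSolution hK0 hφC hφ' hm hK x t, hhess,
    fun x hx t ht => ?_, fun t _ => ⟨?_, ?_⟩, fun x hx => ?_⟩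
  · refine hasDerivAt_of_right_deriv (F := fun s => heatSolution φ f x s)
      (w := fun t => heatSolutionHess φ' f x t + H (heatSolutionGrad φ' f x t))
      (hcu.comp (by fun_prop : Continuous fun s : ℝ => (x, s))).continuousOn
      (fun s hs => ?_) (fun s hs => ?_) ht
    · have h1 : ContinuousAt (fun s : ℝ => (x, s)) s := by fun_prop
      exact ((ContinuousAt.comp (f := fun s : ℝ => (x, s)) (hch x hx s hs) h1).add
        (ContinuousAt.comp (f := fun s : ℝ => (x, s)) (hHc.comp hcg).continuousAt
          h1)).continuousWithinAt
    · have h1 := hf.hasDerivWithinAt_heatSolution hK0 hφC hφ' hm hK hs (hcf x hx s hs)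
        (hhess x hx s hs)
      rwa [hfH x hx s hs] at h1
  · rw [heatSolution, heatAvg_one_eq_zero_of_odd hφ2, HeatSource.duhamel_eq_zero_of_odd, add_zero]
    rw [hfix]
    exact foldSource_odd fold_reflect_neg_one foldSign_reflect_neg_one
  · rw [heatSolution, heatAvg_one_eq_zero_of_odd hφ1, HeatSource.duhamel_eq_zero_of_odd, add_zero]
    rw [hfix]
    exact foldSource_odd fold_reflect_one foldSign_reflect_one
  · rw [heatSolution, hf.duhamel_of_nonpos 0 x le_rfl, add_zero, ← hφu x hx]
    simp [heatAvg, stdGauss]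

/-- `u` is a nonnegative classical solution of `u_t = u_xx + H(u_x)` on `[-1,1] × [0,∞)` vanishing
on the lateral boundary. -/
structure IsSol (H : ℝ → ℝ) (u : ℝ → ℝ → ℝ) : Prop where
  cont : ContinuousOn (fun q : ℝ × ℝ => u q.1 q.2) (Icc (-1) 1 ×ˢ Ici 0)
  nonneg : ∀ x ∈ Icc (-1:ℝ) 1, ∀ t, 0 ≤ t → 0 ≤ u x t
  bc : ∀ t, 0 ≤ t → u (-1) t = 0 ∧ u 1 t = 0
  jet : ∀ x ∈ Ioo (-1:ℝ) 1, ∀ t, 0 < t → ∃ ux uxx, HasJet u x t (uxx + H ux) ux uxx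

theorem HasJet.mono_jet {u : ℝ → ℝ → ℝ} {x t ut ux uxx ut' : ℝ} (hu : HasJet u x t ut ux uxx)
    (h : ut = ut') : HasJet u x t ut' ux uxx := h ▸ hu

theorem DirichletSol.hasJet {H u0 : ℝ → ℝ} {u g c : ℝ → ℝ → ℝ} (h : DirichletSol H u0 u g c)
    {x t : ℝ} (hx : x ∈ Ioo (-1:ℝ) 1) (ht : 0 < t) :
    HasJet u x t (c x t + H (g x t)) (g x t) (c x t) := by
  refine ⟨h.time x hx t ht, fun y => g y t, ?_, rfl, h.hess x hx t ht⟩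
  filter_upwards [isOpen_Ioo.mem_nhds hx] with y hy using h.grad y hy t ht.le

theorem hasJet_const (a x t : ℝ) : HasJet (fun _ _ => a) x t 0 0 0 :=
  HasJet.of_time (hasDerivAt_const t a)

theorem DirichletSol.isSol {H u0 : ℝ → ℝ} {u g c : ℝ → ℝ → ℝ} (h : DirichletSol H u0 u g c)
    (h0 : ∀ x ∈ Icc (-1:ℝ) 1, 0 ≤ u0 x) (hH : H 0 = 0) : IsSol H u where
  cont := h.cont
  bc := h.bc
  jet x hx t ht := ⟨_, _, h.hasJet hx ht⟩
  nonneg x hx t ht := by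
    refine parabolic_comparison (H := H) (T := t) (u := fun _ _ => 0) continuousOn_const
      (h.cont.mono (prod_mono_right Icc_subset_Ici_self)) (fun y hy => ?_)
      (fun s hs => (h.bc s hs.1).1.ge) (fun s hs => (h.bc s hs.1).2.ge)
      (fun y _ s _ => ⟨0, 0, 0, hasJet_const 0 y s, by rw [hH, add_zero]⟩)
      (fun y hy s hs => ⟨_, _, _, h.hasJet hy hs.1, le_rfl⟩) x hx t ⟨ht, le_rfl⟩
    rw [h.ic y hy]
    exact h0 y hy

namespace IsSol

variable {H H₁ H₂ : ℝ → ℝ} {u v : ℝ → ℝ → ℝ}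

theorem continuousOn (hu : IsSol H u) {T : ℝ} :
    ContinuousOn (fun q : ℝ × ℝ => u q.1 q.2) (Icc (-1) 1 ×ˢ Icc 0 T) :=
  hu.cont.mono (prod_mono_right Icc_subset_Ici_self)

theorem le (hu : IsSol H₁ u) (hv : IsSol H₂ v) (hH : ∀ ξ, H₁ ξ ≤ H₂ ξ)
    (h0 : ∀ x ∈ Icc (-1:ℝ) 1, u x 0 ≤ v x 0) {x : ℝ} (hx : x ∈ Icc (-1:ℝ) 1) {t : ℝ}
    (ht : 0 ≤ t) : u x t ≤ v x t := by
  refine parabolic_comparison (H := H₁) (T := t) hu.continuousOn hv.continuousOn h0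
    (fun s hs => by rw [(hu.bc s hs.1).1, (hv.bc s hs.1).1])
    (fun s hs => by rw [(hu.bc s hs.1).2, (hv.bc s hs.1).2])
    (fun y hy s hs => ?_) (fun y hy s hs => ?_) x hx t ⟨ht, le_rfl⟩
  · obtain ⟨a, b, h⟩ := hu.jet y hy s hs.1
    exact ⟨_, _, _, h, le_rfl⟩
  · obtain ⟨a, b, h⟩ := hv.jet y hy s hs.1
    exact ⟨_, _, _, h, by linarith [hH a]⟩

theorem shift (hu : IsSol H u) {t₀ : ℝ} (ht₀ : 0 ≤ t₀) : IsSol H fun x t => u x (t + t₀) where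
  cont := hu.cont.comp (f := fun q : ℝ × ℝ => (q.1, q.2 + t₀)) (by fun_prop)
    fun q hq => ⟨hq.1, add_nonneg hq.2 ht₀⟩
  nonneg x hx t ht := hu.nonneg x hx _ (add_nonneg ht ht₀)
  bc t ht := hu.bc _ (add_nonneg ht ht₀)
  jet x hx t ht := by
    obtain ⟨a, b, h⟩ := hu.jet x hx (t + t₀) (by linarith)
    refine ⟨a, b, ?_⟩
    have h' : HasJet u (x + 0) (t + t₀) (b + H a) a b := by rwa [add_zero]
    simpa using h'.shift 0 t₀

/-- Comparison with a stationary or moving supersolution. -/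
theorem le_super (hu : IsSol H u) {B : ℝ → ℝ → ℝ} {T : ℝ}
    (hc : ContinuousOn (fun q : ℝ × ℝ => B q.1 q.2) (Icc (-1) 1 ×ˢ Icc 0 T))
    (h0 : ∀ x ∈ Icc (-1:ℝ) 1, u x 0 ≤ B x 0) (hl : ∀ t ∈ Icc 0 T, 0 ≤ B (-1) t)
    (hr : ∀ t ∈ Icc 0 T, 0 ≤ B 1 t)
    (hB : ∀ x ∈ Ioo (-1:ℝ) 1, ∀ t ∈ Ioc 0 T, ∃ vt vx vxx, HasJet B x t vt vx vxx ∧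
      vxx + H vx ≤ vt) : ∀ x ∈ Icc (-1:ℝ) 1, ∀ t ∈ Icc 0 T, u x t ≤ B x t :=
  parabolic_comparison hu.continuousOn hc h0
    (fun s hs => by rw [(hu.bc s hs.1).1]; exact hl s hs)
    (fun s hs => by rw [(hu.bc s hs.1).2]; exact hr s hs)
    (fun y hy s hs => by
      obtain ⟨a, b, h⟩ := hu.jet y hy s hs.1
      exact ⟨_, _, _, h, le_rfl⟩) hB

theorem lipschitz_aux (hu : IsSol H u) {M : ℝ}
    (h0 : ∀ x ∈ Icc (-1:ℝ) 1, ∀ y ∈ Icc (-1:ℝ) 1, |u x 0 - u y 0| ≤ M * |x - y|)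
    (hl : ∀ x ∈ Icc (-1:ℝ) 1, ∀ t, 0 ≤ t → u x t ≤ M * (1 + x))
    (hr : ∀ x ∈ Icc (-1:ℝ) 1, ∀ t, 0 ≤ t → u x t ≤ M * (1 - x)) {x h t : ℝ}
    (hx : -1 ≤ x) (hh : 0 ≤ h) (hxh : x + h ≤ 1) (ht : 0 ≤ t) :
    |u (x + h) t - u x t| ≤ M * h := by
  have hc1 : ContinuousOn (fun q : ℝ × ℝ => u (q.1 + h) (q.2 + 0)) (Icc (-1) (1 - h) ×ˢ Icc 0 t) :=
    hu.cont.comp (f := fun q : ℝ × ℝ => (q.1 + h, q.2 + 0)) (by fun_prop) fun q hq =>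
      ⟨⟨by linarith [hq.1.1], by linarith [hq.1.2]⟩, by simpa using hq.2.1⟩
  have hc2 : ContinuousOn (fun q : ℝ × ℝ => u q.1 q.2) (Icc (-1) (1 - h) ×ˢ Icc 0 t) :=
    hu.cont.mono (prod_mono (Icc_subset_Icc_right (by linarith)) Icc_subset_Ici_self)
  have hj1 : ∀ y ∈ Ioo (-1:ℝ) (1 - h), ∀ s ∈ Ioc 0 t, ∃ ux uxx,
      HasJet (fun y s => u (y + h) (s + 0)) y s (uxx + H ux) ux uxx := fun y hy s hs => by
    obtain ⟨a, b, hj⟩ := hu.jet (y + h) ⟨by linarith [hy.1], by linarith [hy.2]⟩ s hs.1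
    exact ⟨a, b, HasJet.shift h 0 (by rwa [add_zero])⟩
  have hj2 : ∀ y ∈ Ioo (-1:ℝ) (1 - h), ∀ s ∈ Ioc 0 t, ∃ ux uxx,
      HasJet u y s (uxx + H ux) ux uxx := fun y hy s hs =>
    hu.jet y ⟨hy.1, by linarith [hy.2]⟩ s hs.1
  have hinit : ∀ y ∈ Icc (-1:ℝ) (1 - h), |u (y + h) 0 - u y 0| ≤ M * h := fun y hy => by
    have := h0 (y + h) ⟨by linarith [hy.1], by linarith [hy.2]⟩ y ⟨hy.1, by linarith [hy.2]⟩
    rwa [add_sub_cancel_left, abs_of_nonneg hh] at this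
  have hm1 : (-1:ℝ) + h ∈ Icc (-1:ℝ) 1 := ⟨by linarith, by linarith⟩
  have hm2 : 1 - h ∈ Icc (-1:ℝ) 1 := ⟨by linarith, by linarith⟩
  have hxm : x ∈ Icc (-1:ℝ) (1 - h) := ⟨hx, by linarith⟩
  have hMh : 0 ≤ M * h := by
    simpa using (hu.nonneg _ hm1 0 le_rfl).trans (hl _ hm1 0 le_rfl)
  have e1 := parabolic_comparison (H := H) (u := fun y s => u (y + h) (s + 0))
    (v := fun y s => u y s + M * h) hc1 (hc2.add_const (M * h))
    (fun y hy => by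
      have := (abs_le.1 (hinit y hy)).2
      simp only [add_zero]; linarith)
    (fun s hs => by
      have := hl _ hm1 s hs.1
      simp only [add_zero, (hu.bc s hs.1).1]; linarith)
    (fun s hs => by
      have := hu.nonneg _ hm2 s hs.1
      simp only [sub_add_cancel, add_zero, (hu.bc s hs.1).2]; linarith)
    (fun y hy s hs => by
      obtain ⟨a, b, hj⟩ := hj1 y hy s hs
      exact ⟨_, _, _, hj, le_rfl⟩)
    (fun y hy s hs => by
      obtain ⟨a, b, hj⟩ := hj2 y hy s hs
      exact ⟨_, _, _, hj.add (hasJet_const (M * h) y s), by simp⟩) x hxm t ⟨ht, le_rfl⟩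
  have e2 := parabolic_comparison (H := H) (u := u)
    (v := fun y s => u (y + h) (s + 0) + M * h) hc2 (hc1.add_const (M * h))
    (fun y hy => by
      have := (abs_le.1 (hinit y hy)).1
      simp only [add_zero]; linarith)
    (fun s hs => by
      have := hu.nonneg _ hm1 s hs.1
      simp only [add_zero, (hu.bc s hs.1).1]; linarith)
    (fun s hs => by
      have := hr _ hm2 s hs.1
      simp only [sub_add_cancel, add_zero, (hu.bc s hs.1).2]; linarith)
    (fun y hy s hs => by
      obtain ⟨a, b, hj⟩ := hj2 y hy s hs
      exact ⟨_, _, _, hj, le_rfl⟩)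
    (fun y hy s hs => by
      obtain ⟨a, b, hj⟩ := hj1 y hy s hs
      exact ⟨_, _, _, hj.add (hasJet_const (M * h) y s), by simp⟩) x hxm t ⟨ht, le_rfl⟩
  simp only [add_zero] at e1 e2
  exact abs_le.2 ⟨by linarith, by linarith⟩

/-- A Lipschitz bound for the data and linear barriers at the boundary give a Lipschitz bound. -/
theorem lipschitz (hu : IsSol H u) {M : ℝ}
    (h0 : ∀ x ∈ Icc (-1:ℝ) 1, ∀ y ∈ Icc (-1:ℝ) 1, |u x 0 - u y 0| ≤ M * |x - y|)
    (hl : ∀ x ∈ Icc (-1:ℝ) 1, ∀ t, 0 ≤ t → u x t ≤ M * (1 + x))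
    (hr : ∀ x ∈ Icc (-1:ℝ) 1, ∀ t, 0 ≤ t → u x t ≤ M * (1 - x)) {x y t : ℝ}
    (hx : x ∈ Icc (-1:ℝ) 1) (hy : y ∈ Icc (-1:ℝ) 1) (ht : 0 ≤ t) :
    |u x t - u y t| ≤ M * |x - y| := by
  rcases le_total x y with h | h
  · have := hu.lipschitz_aux h0 hl hr (x := x) (h := y - x) hx.1 (by linarith)
      (by linarith [hy.2]) ht
    rw [add_sub_cancel] at this
    rwa [abs_sub_comm, abs_sub_comm x, abs_of_nonneg (sub_nonneg.2 h)]
  · have := hu.lipschitz_aux h0 hl hr (x := y) (h := x - y) hy.1 (by linarith)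
      (by linarith [hx.2]) ht
    rw [add_sub_cancel] at this
    rwa [abs_of_nonneg (sub_nonneg.2 h)]

end IsSol

theorem abs_deriv_le_of_lipschitzOn {f : ℝ → ℝ} {f' x M a b : ℝ} (hx : x ∈ Ioo a b)
    (hf : HasDerivAt f f' x)
    (h : ∀ y ∈ Icc a b, |f y - f x| ≤ M * |y - x|) : |f'| ≤ M := by
  refine le_of_tendsto (hasDerivAt_iff_tendsto_slope.1 hf).abs ?_
  filter_upwards [self_mem_nhdsWithin, nhdsWithin_le_nhds (Icc_mem_nhds hx.1 hx.2)] with y hy1 hy2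
  have h3 : 0 < |y - x| := abs_pos.2 (sub_ne_zero.2 hy1)
  rw [slope_def_field, abs_div, div_le_iff₀ h3]
  exact h y hy2

section Hamiltonian

variable {p : ℝ} {i j : ℕ}

theorem Fj1_nonneg (ξ : ℝ) : 0 ≤ Fj1 p j ξ :=
  le_min (by positivity) (by positivity)

theorem Fj1_zero (hp : 2 < p) : Fj1 p j 0 = 0 := by
  simp [Fj1, Real.zero_rpow (by linarith : p ≠ 0)]

theorem Fj1_neg (ξ : ℝ) : Fj1 p j (-ξ) = Fj1 p j ξ := by simp [Fj1]

theorem Fj1_le_rpow (ξ : ℝ) : Fj1 p j ξ ≤ |ξ| ^ p := min_le_left _ _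

theorem Fj1_le_sq (ξ : ℝ) : Fj1 p j ξ ≤ (j : ℝ) ^ (p - 2) * ξ ^ 2 := min_le_right _ _

theorem Fj1_mono (hp : 2 < p) (hij : i ≤ j) (ξ : ℝ) : Fj1 p i ξ ≤ Fj1 p j ξ := by
  refine min_le_min le_rfl (mul_le_mul_of_nonneg_right ?_ (sq_nonneg ξ))
  exact Real.rpow_le_rpow (Nat.cast_nonneg i) (Nat.cast_le.2 hij) (by linarith)

theorem Fj1_of_abs_le (hp : 2 < p) {ξ : ℝ} (h : |ξ| ≤ j) : Fj1 p j ξ = |ξ| ^ p := by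
  refine min_eq_left ?_
  rcases eq_or_ne ξ 0 with rfl | hξ
  · simp [Real.zero_rpow (by linarith : p ≠ 0)]
  · have h0 : 0 < |ξ| := abs_pos.2 hξ
    rw [show p = (p - 2) + 2 by ring, Real.rpow_add h0, add_sub_cancel_right, Real.rpow_two, sq_abs]
    gcongr

theorem mul_Fj1_le (hp : 2 < p) {l : ℝ} (hl : 1 ≤ l) (ξ : ℝ) : l * Fj1 p j ξ ≤ Fj1 p j (l * ξ) := by
  have hl0 : 0 ≤ l := by linarith
  refine le_min ?_ ?_
  · rw [abs_mul, abs_of_nonneg hl0, Real.mul_rpow hl0 (abs_nonneg _)]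
    have h1 : l ≤ l ^ p := Real.self_le_rpow_of_one_le hl (by linarith)
    exact mul_le_mul h1 (Fj1_le_rpow ξ) (Fj1_nonneg ξ) (by positivity)
  · calc l * Fj1 p j ξ ≤ l * ((j : ℝ) ^ (p - 2) * ξ ^ 2) := by gcongr; exact Fj1_le_sq ξ
      _ ≤ l * (l * ((j : ℝ) ^ (p - 2) * ξ ^ 2)) :=
        mul_le_mul_of_nonneg_left (le_mul_of_one_le_left (by positivity) hl) hl0
      _ = _ := by ring

theorem continuous_Fj1 (hp : 2 < p) : Continuous (Fj1 p j) :=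
  (continuous_abs.rpow_const fun _ => Or.inr (by linarith)).min (by fun_prop)

theorem abs_rpow_sub_rpow_le (hp : 1 ≤ p) {M a b : ℝ} (ha : |a| ≤ M) (hb : |b| ≤ M) :
    |(|a| ^ p - |b| ^ p)| ≤ p * M ^ (p - 1) * |a - b| := by
  have h1 := (convex_Icc (0:ℝ) M).norm_image_sub_le_of_norm_hasDerivWithin_le
    (f := fun x : ℝ => x ^ p) (f' := fun x => p * x ^ (p - 1)) (C := p * M ^ (p - 1))
    (fun x _ => (Real.hasDerivAt_rpow_const (Or.inr hp)).hasDerivWithinAt) (fun x hx => by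
      rw [Real.norm_eq_abs, abs_of_nonneg (mul_nonneg (by linarith) (Real.rpow_nonneg hx.1 _))]
      have := Real.rpow_le_rpow hx.1 hx.2 (by linarith : 0 ≤ p - 1)
      gcongr) (mem_Icc.2 ⟨abs_nonneg b, hb⟩) (mem_Icc.2 ⟨abs_nonneg a, ha⟩)
  refine h1.trans (mul_le_mul_of_nonneg_left (abs_abs_sub_abs_le_abs_sub a b) ?_)
  exact mul_nonneg (by linarith) (Real.rpow_nonneg ((abs_nonneg a).trans ha) _)

theorem exists_Fj1_lipschitz (hp : 2 < p) (j : ℕ) {M : ℝ} (hM : 0 ≤ M) : ∃ L, 0 ≤ L ∧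
    ∀ a b, |a| ≤ M → |b| ≤ M → |Fj1 p j a - Fj1 p j b| ≤ L * |a - b| := by
  refine ⟨max (p * M ^ (p - 1)) ((j : ℝ) ^ (p - 2) * (2 * M)), le_max_of_le_right (by positivity),
    fun a b ha hb => (abs_min_sub_min_le_max _ _ _ _).trans (max_le ?_ ?_)⟩
  · exact (abs_rpow_sub_rpow_le (by linarith) ha hb).trans
      (mul_le_mul_of_nonneg_right (le_max_left _ _) (abs_nonneg _))
  · refine le_trans ?_ (mul_le_mul_of_nonneg_right (le_max_right _ _) (abs_nonneg _))
    rw [← mul_sub, abs_mul, abs_of_nonneg (by positivity : (0:ℝ) ≤ (j : ℝ) ^ (p - 2)), mul_assoc,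
      sq_sub_sq, abs_mul]
    gcongr
    exact (abs_add_le a b).trans (by linarith)

theorem exists_Fj1_clamp_lipschitz (hp : 2 < p) (j : ℕ) {M : ℝ} (hM : 0 ≤ M) : ∃ L N, 0 ≤ L ∧
    (∀ a b, |Fj1 p j (max (-M) (min M a)) - Fj1 p j (max (-M) (min M b))| ≤ L * |a - b|) ∧
    ∀ a, |Fj1 p j (max (-M) (min M a))| ≤ N := by
  obtain ⟨L, hL, h⟩ := exists_Fj1_lipschitz hp j hM
  have hcl : ∀ a : ℝ, |max (-M) (min M a)| ≤ M := fun a =>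
    abs_le.2 ⟨le_max_left _ _, max_le (by linarith) (min_le_left _ _)⟩
  refine ⟨L, L * M, hL, fun a b => (h _ _ (hcl a) (hcl b)).trans
    (mul_le_mul_of_nonneg_left ?_ hL), fun a => ?_⟩
  · have h1 := abs_max_sub_max_le_max (-M) (min M a) (-M) (min M b)
    have h2 := abs_min_sub_min_le_max M a M b
    simp only [sub_self, abs_zero, abs_nonneg, max_eq_right] at h1 h2
    exact h1.trans h2
  · have h1 := h _ 0 (hcl a) (by rwa [abs_zero])
    rw [Fj1_zero hp, sub_zero, sub_zero] at h1
    exact h1.trans (mul_le_mul_of_nonneg_left (hcl a) hL)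

end Hamiltonian

/-- The logarithmic barrier for Hamiltonians of quadratic growth. -/
theorem IsSol.le_log_barrier {H : ℝ → ℝ} {u : ℝ → ℝ → ℝ} (hu : IsSol H u) {A κ : ℝ} (hA : 0 < A)
    (hκ : 0 ≤ κ) (hH : ∀ ξ, H ξ ≤ A * ξ ^ 2)
    (h0 : ∀ x ∈ Icc (-1:ℝ) 1, A * u x 0 ≤ Real.log (1 + κ * (1 + x))) {x t : ℝ}
    (hx : x ∈ Icc (-1:ℝ) 1) (ht : 0 ≤ t) : u x t ≤ κ / A * (1 + x) := by
  have hpos : ∀ y ∈ Icc (-1:ℝ) 1, 0 < 1 + κ * (1 + y) := fun y hy => by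
    have := mul_nonneg hκ (by linarith [hy.1] : 0 ≤ 1 + y)
    linarith
  have hd : ∀ y, HasDerivAt (fun y : ℝ => 1 + κ * (1 + y)) κ y := fun y =>
    ((((hasDerivAt_id' y).const_add 1).const_mul κ).const_add 1).congr_deriv (mul_one κ)
  have h1 := hu.le_super (B := fun y _ => 1 / A * Real.log (1 + κ * (1 + y))) (T := t)
    (by
      refine continuousOn_const.mul (ContinuousOn.log (by fun_prop) fun q hq => (hpos _ hq.1).ne'))
    (fun y hy => by
      rw [one_div, ← div_eq_inv_mul, le_div_iff₀ hA, mul_comm]; exact h0 y hy)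
    (fun s _ => by simp)
    (fun s _ => mul_nonneg (by positivity) (Real.log_nonneg (by linarith [hpos 0 (by simp)])))
    (fun y hy s _ => by
      have hy0 := hpos y (Ioo_subset_Icc_self hy)
      have e1 : ∀ᶠ z in 𝓝 y, HasDerivAt (fun z => 1 / A * Real.log (1 + κ * (1 + z)))
          (1 / A * (κ / (1 + κ * (1 + z)))) z := by
        filter_upwards [isOpen_Ioo.mem_nhds hy] with z hz
        exact ((hd z).log (hpos z (Ioo_subset_Icc_self hz)).ne').const_mul _
      have e2 : HasDerivAt (fun z => 1 / A * (κ / (1 + κ * (1 + z))))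
          (1 / A * ((0 * (1 + κ * (1 + y)) - κ * κ) / (1 + κ * (1 + y)) ^ 2)) y :=
        ((hasDerivAt_const y κ).fun_div (hd y) hy0.ne').const_mul _
      refine ⟨_, _, _, HasJet.of_space e1 e2, ?_⟩
      have := hH (1 / A * (κ / (1 + κ * (1 + y))))
      refine (add_le_add_right this _).trans_eq ?_
      field_simp
      ring) x hx t ⟨ht, le_rfl⟩
  refine h1.trans ?_
  have h2 := Real.log_le_sub_one_of_pos (hpos x hx)
  rw [div_mul_eq_mul_div, div_mul_eq_mul_div, one_mul]
  gcongr
  linarith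

theorem IsSol.reflect {H : ℝ → ℝ} {u : ℝ → ℝ → ℝ} (hu : IsSol H u) (hH : ∀ ξ, H (-ξ) = H ξ) :
    IsSol H fun x t => u (-x) t where
  cont := hu.cont.comp (f := fun q : ℝ × ℝ => (-q.1, q.2)) (by fun_prop) fun q hq =>
    ⟨⟨by linarith [hq.1.2], by linarith [hq.1.1]⟩, hq.2⟩
  nonneg x hx t ht := hu.nonneg (-x) ⟨by linarith [hx.2], by linarith [hx.1]⟩ t ht
  bc t ht := ⟨by simpa using (hu.bc t ht).2, (hu.bc t ht).1⟩
  jet x hx t ht := by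
    obtain ⟨a, b, h⟩ := hu.jet (-x) ⟨by linarith [hx.2], by linarith [hx.1]⟩ t ht
    exact ⟨-a, b, h.reflect.mono_jet (by rw [hH])⟩

theorem exists_lipschitz_of_contDiffOn {u0 : ℝ → ℝ} (hu : ContDiffOn ℝ 1 u0 (Icc (-1) 1)) :
    ∃ L, 0 ≤ L ∧ ∀ x ∈ Icc (-1:ℝ) 1, ∀ y ∈ Icc (-1:ℝ) 1, |u0 x - u0 y| ≤ L * |x - y| := by
  have huniq : UniqueDiffOn ℝ (Icc (-1:ℝ) 1) := uniqueDiffOn_Icc (by norm_num)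
  obtain ⟨K, hK⟩ := isCompact_Icc.exists_bound_of_continuousOn
    (hu.continuousOn_derivWithin huniq le_rfl)
  exact ⟨K, (norm_nonneg _).trans (hK 0 (by simp)), fun x hx y hy =>
    (convex_Icc (-1:ℝ) 1).norm_image_sub_le_of_norm_hasDerivWithin_le
      (fun z hz => (hu.differentiableOn one_ne_zero z hz).hasDerivWithinAt) hK hy hx⟩

/-- Global solvability of the regularized problems. -/
theorem exists_regularized_sol {p : ℝ} (hp : 2 < p) {j : ℕ} (hj : 1 ≤ j) {u0 : ℝ → ℝ}
    (hu : MemX1 u0) : ∃ u g c, DirichletSol (Fj1 p j) u0 u g c ∧ IsSol (Fj1 p j) u := by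
  obtain ⟨hC1, hnn, hl, hr⟩ := hu
  obtain ⟨L, hL, hLip⟩ := exists_lipschitz_of_contDiffOn hC1
  set A : ℝ := (j : ℝ) ^ (p - 2)
  have hA : 0 < A := Real.rpow_pos_of_pos (by exact_mod_cast hj) _
  set κ : ℝ := (Real.exp (2 * (L * A)) - 1) / 2 with hκdef
  have hκL : L * A ≤ κ := by
    have := Real.add_one_le_exp (2 * (L * A))
    rw [hκdef]; linarith
  have hκ : 0 ≤ κ := (mul_nonneg hL hA.le).trans hκL
  set M := κ / A
  have hM : 0 ≤ M := div_nonneg hκ hA.le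
  have hLM : L ≤ M := (le_div_iff₀ hA).2 hκL
  have hlog : ∀ y ∈ Icc (0:ℝ) 2, A * (L * y) ≤ Real.log (1 + κ * y) := fun y hy => by
    have hpos : 0 < 1 + κ * y := by nlinarith [mul_nonneg hκ hy.1]
    rw [Real.le_log_iff_exp_le hpos]
    have h1 := convexOn_exp.2 (mem_univ 0) (mem_univ (2 * (L * A)))
      (by linarith [hy.2] : 0 ≤ 1 - y / 2) (by linarith [hy.1] : 0 ≤ y / 2) (by ring)
    simp only [smul_eq_mul, mul_zero, zero_add, Real.exp_zero] at h1
    calc Real.exp (A * (L * y)) = Real.exp (y / 2 * (2 * (L * A))) := by congr 1; ring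
      _ ≤ _ := h1
      _ = 1 + κ * y := by rw [hκdef]; ring
  obtain ⟨L', N', hL', hLip', hN'⟩ := exists_Fj1_clamp_lipschitz hp j hM
  set F : ℝ → ℝ := fun ξ => Fj1 p j (max (-M) (min M ξ))
  have hcl0 : ∀ ξ, |ξ| ≤ M → max (-M) (min M ξ) = ξ := fun ξ hξ => by
    rw [min_eq_right (abs_le.1 hξ).2, max_eq_right (abs_le.1 hξ).1]
  have hF : ∀ ξ, |ξ| ≤ M → F ξ = Fj1 p j ξ := fun ξ hξ => by simp only [F, hcl0 ξ hξ]
  have hclneg : ∀ ξ, max (-M) (min M (-ξ)) = - max (-M) (min M ξ) := fun ξ => by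
    rcases le_total ξ (-M) with h | h
    · rw [min_eq_left (by linarith), min_eq_right (by linarith), max_eq_left h,
        max_eq_right (by linarith), neg_neg]
    · rcases le_total ξ M with h' | h'
      · rw [hcl0 ξ (abs_le.2 ⟨h, h'⟩), hcl0 (-ξ) (by rw [abs_neg]; exact abs_le.2 ⟨h, h'⟩)]
      · rw [min_eq_left h', min_eq_right (by linarith), max_eq_left (by linarith),
          max_eq_right (by linarith)]
  have hFneg : ∀ ξ, F (-ξ) = F ξ := fun ξ => by simp only [F, hclneg, Fj1_neg]
  have hFsq : ∀ ξ, F ξ ≤ A * ξ ^ 2 := fun ξ => by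
    refine (Fj1_le_sq _).trans (mul_le_mul_of_nonneg_left (sq_le_sq.2 ?_) hA.le)
    rcases le_total ξ (-M) with h | h
    · rw [min_eq_right (show ξ ≤ M by linarith), max_eq_left h, abs_neg, abs_of_nonneg hM]
      exact le_abs.2 (Or.inr (by linarith))
    · rcases le_total ξ M with h' | h'
      · rw [hcl0 ξ (abs_le.2 ⟨h, h'⟩)]
      · rw [min_eq_left h', max_eq_right (by linarith), abs_of_nonneg hM]
        exact le_abs.2 (Or.inl h')
  obtain ⟨u, g, c, hD⟩ := exists_dirichletSol hL' hLip' hN' hC1 hl hr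
  have hS : IsSol F u := hD.isSol hnn ((hF 0 (by rwa [abs_zero])).trans (Fj1_zero hp))
  have hb : ∀ x ∈ Icc (-1:ℝ) 1, ∀ t, 0 ≤ t → u x t ≤ M * (1 + x) := fun x hx t ht =>
    hS.le_log_barrier hA hκ hFsq (fun y hy => by
      rw [hD.ic y hy]
      have h1 := hLip y hy (-1) (by simp)
      rw [hl, sub_zero, sub_neg_eq_add, abs_of_nonneg (hnn y hy),
        abs_of_nonneg (by linarith [hy.1]), add_comm] at h1
      exact (mul_le_mul_of_nonneg_left h1 hA.le).trans
        (hlog (1 + y) ⟨by linarith [hy.1], by linarith [hy.2]⟩)) hx ht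
  have hb' : ∀ x ∈ Icc (-1:ℝ) 1, ∀ t, 0 ≤ t → u x t ≤ M * (1 - x) := fun x hx t ht => by
    have h2 := (hS.reflect hFneg).le_log_barrier hA hκ hFsq (fun y hy => by
      have hy' : -y ∈ Icc (-1:ℝ) 1 := ⟨by linarith [hy.2], by linarith [hy.1]⟩
      rw [hD.ic _ hy']
      have h1 := hLip (-y) hy' 1 (by simp)
      rw [hr, sub_zero, abs_of_nonneg (hnn _ hy'), abs_sub_comm, sub_neg_eq_add,
        abs_of_nonneg (by linarith [hy.1])] at h1
      exact (mul_le_mul_of_nonneg_left h1 hA.le).trans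
        (hlog (1 + y) ⟨by linarith [hy.1], by linarith [hy.2]⟩)) (x := -x)
        ⟨by linarith [hx.2], by linarith [hx.1]⟩ ht
    simpa [← sub_eq_add_neg] using h2
  have hg : ∀ x ∈ Ioo (-1:ℝ) 1, ∀ t, 0 ≤ t → |g x t| ≤ M := fun x hx t ht =>
    abs_deriv_le_of_lipschitzOn hx (hD.grad x hx t ht) fun y hy =>
      hS.lipschitz (fun a ha b hb => by
        rw [hD.ic a ha, hD.ic b hb]
        exact (hLip a ha b hb).trans (mul_le_mul_of_nonneg_right hLM (abs_nonneg _)))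
        hb hb' hy (Ioo_subset_Icc_self hx) ht
  have hD' : DirichletSol (Fj1 p j) u0 u g c :=
    { hD with
      time := fun x hx t ht => by
        rw [← hF _ (hg x hx t ht.le)]
        exact hD.time x hx t ht }
  exact ⟨u, g, c, hD', hD'.isSol hnn (Fj1_zero hp)⟩

theorem HasJet.deriv_eq {u : ℝ → ℝ → ℝ} {x t ut ux uxx : ℝ} (hu : HasJet u x t ut ux uxx) :
    deriv (fun y => u y t) x = ux := by
  obtain ⟨k, hk, hkx, -⟩ := hu.space
  rw [hk.self_of_nhds.deriv, hkx]

theorem HasJet.hasDerivAt {u : ℝ → ℝ → ℝ} {x t ut ux uxx : ℝ} (hu : HasJet u x t ut ux uxx) :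
    HasDerivAt (fun y => u y t) ux x := by
  obtain ⟨k, hk, hkx, -⟩ := hu.space
  exact hkx ▸ hk.self_of_nhds

theorem HasJet.hasDerivAt_deriv {u : ℝ → ℝ → ℝ} {x t ut ux uxx : ℝ}
    (hu : HasJet u x t ut ux uxx) : HasDerivAt (deriv fun y => u y t) uxx x := by
  obtain ⟨k, hk, -, hkd⟩ := hu.space
  refine hkd.congr_of_eventuallyEq ?_
  filter_upwards [hk] with y hy using hy.deriv

theorem hasJet_of_contDiffOn {u : ℝ → ℝ → ℝ} {x t : ℝ} (hx : x ∈ Ioo (-1:ℝ) 1) (ht : 0 < t)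
    (h1 : ContDiffOn ℝ 1 (fun s => u x s) (Ioi 0))
    (h2 : ContDiffOn ℝ 2 (fun y => u y t) (Ioo (-1) 1)) :
    HasJet u x t (deriv (fun s => u x s) t) (deriv (fun y => u y t) x)
      (deriv (deriv fun y => u y t) x) := by
  have hd : ∀ y ∈ Ioo (-1:ℝ) 1, HasDerivAt (fun y => u y t) (deriv (fun y => u y t) y) y :=
    fun y hy => ((h2.differentiableOn two_ne_zero y hy).differentiableAt
      (isOpen_Ioo.mem_nhds hy)).hasDerivAt
  refine ⟨((h1.differentiableOn one_ne_zero t ht).differentiableAt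
    (Ioi_mem_nhds ht)).hasDerivAt, _, ?_, rfl, ?_⟩
  · filter_upwards [isOpen_Ioo.mem_nhds hx] with y hy using hd y hy
  · have h3 : ContDiffOn ℝ 1 (deriv fun y => u y t) (Ioo (-1) 1) :=
      ((contDiffOn_succ_iff_deriv_of_isOpen (n := 1) isOpen_Ioo).1
        (by simpa [one_add_one_eq_two] using h2)).2.2
    exact ((h3.differentiableOn one_ne_zero x hx).differentiableAt
      (isOpen_Ioo.mem_nhds hx)).hasDerivAt

theorem IsRegSol1.isSol {p : ℝ} {j : ℕ} {u0 : ℝ → ℝ} {u : ℝ → ℝ → ℝ} (hu : IsRegSol1 p j u0 u)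
    (hu0 : MemX1 u0) : IsSol (Fj1 p j) u where
  cont := hu.cont
  nonneg := hu.nonneg
  bc t ht := by
    rcases ht.eq_or_lt with rfl | h
    · rw [hu.ic _ (by simp), hu.ic _ (by simp)]
      exact hu0.2.2
    · exact hu.bc t h
  jet x hx t ht := ⟨_, _, (hasJet_of_contDiffOn hx ht (hu.time_reg x hx)
    (hu.space_reg t ht)).mono_jet (hu.eqn x hx t ht)⟩

namespace DirichletSol

variable {H u0 : ℝ → ℝ} {u g c : ℝ → ℝ → ℝ}

theorem deriv_space (h : DirichletSol H u0 u g c) {x t : ℝ} (hx : x ∈ Ioo (-1:ℝ) 1) (ht : 0 ≤ t) :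
    deriv (fun y => u y t) x = g x t := (h.grad x hx t ht).deriv

theorem contDiffOn_space (h : DirichletSol H u0 u g c) {t : ℝ} (ht : 0 < t) :
    ContDiffOn ℝ 2 (fun y => u y t) (Ioo (-1) 1) := by
  have h1 : ContDiffOn ℝ 1 (fun y => g y t) (Ioo (-1) 1) := by
    rw [show (1 : WithTop ℕ∞) = 0 + 1 by simp, contDiffOn_succ_iff_deriv_of_isOpen isOpen_Ioo]
    refine ⟨fun x hx => (h.hess x hx t ht).differentiableAt.differentiableWithinAt, by simp, ?_⟩
    rw [contDiffOn_zero]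
    exact (h.cont_hess.comp (f := fun x : ℝ => (x, t)) (by fun_prop)
      fun x hx => mk_mem_prod hx ht).congr fun x hx => (h.hess x hx t ht).deriv
  rw [show (2 : WithTop ℕ∞) = 1 + 1 by norm_num, contDiffOn_succ_iff_deriv_of_isOpen isOpen_Ioo]
  exact ⟨fun x hx => (h.grad x hx t ht.le).differentiableAt.differentiableWithinAt, by simp,
    h1.congr fun x hx => h.deriv_space hx ht.le⟩

theorem contDiffOn_time (h : DirichletSol H u0 u g c) (hH : Continuous H) {x : ℝ}
    (hx : x ∈ Ioo (-1:ℝ) 1) : ContDiffOn ℝ 1 (fun s => u x s) (Ioi 0) := by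
  rw [show (1 : WithTop ℕ∞) = 0 + 1 by simp, contDiffOn_succ_iff_deriv_of_isOpen isOpen_Ioi]
  refine ⟨fun t ht => (h.time x hx t ht).differentiableAt.differentiableWithinAt, by simp, ?_⟩
  rw [contDiffOn_zero]
  have h1 : ContinuousOn (fun t => c x t) (Ioi 0) :=
    h.cont_hess.comp (f := fun t : ℝ => (x, t)) (by fun_prop) fun t ht => mk_mem_prod hx ht
  have h2 : ContinuousOn (fun t => g x t) (Ioi 0) :=
    h.cont_grad.comp (f := fun t : ℝ => (x, t)) (by fun_prop)
      fun t ht => mk_mem_prod (Ioo_subset_Icc_self hx) (mem_Ici.2 (le_of_lt ht))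
  exact (h1.add (hH.comp_continuousOn h2)).congr fun t ht => (h.time x hx t ht).deriv

theorem isClassicalSol {p : ℝ} (hp : 2 < p) {j : ℕ} (h : DirichletSol (Fj1 p j) u0 u g c)
    (hg : ∀ x ∈ Ioo (-1:ℝ) 1, ∀ t, 0 < t → |g x t| ≤ j) : IsClassicalSol1Global p u0 u where
  cont := h.cont
  deriv_cont := ⟨_, h.cont_grad, fun _ hx _ ht => (h.deriv_space hx (le_of_lt ht)).symm⟩
  time_reg x hx := h.contDiffOn_time (continuous_Fj1 hp) hx
  space_reg t ht := h.contDiffOn_space ht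
  eqn x hx t ht := by
    have hj := h.hasJet hx ht
    rw [(h.time x hx t ht).deriv, hj.hasDerivAt_deriv.deriv, h.deriv_space hx (le_of_lt ht),
      Fj1_of_abs_le hp (hg x hx t ht)]
  bc := h.bc
  ic := h.ic

/-- The gradient of the solution stays bounded by `L + 1` for a short time. -/
theorem exists_short_time (h : DirichletSol H u0 u g c) {L : ℝ}
    (hL : ∀ x ∈ Icc (-1:ℝ) 1, ∀ y ∈ Icc (-1:ℝ) 1, |u0 x - u0 y| ≤ L * |x - y|) :
    ∃ τ, 0 < τ ∧ ∀ x ∈ Ioo (-1:ℝ) 1, ∀ t ∈ Icc 0 τ, |g x t| ≤ L + 1 := by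
  have h1 : UniformContinuousOn (fun q : ℝ × ℝ => g q.1 q.2) (Icc (-1) 1 ×ˢ Icc 0 1) :=
    (isCompact_Icc.prod isCompact_Icc).uniformContinuousOn_of_continuous
      (h.cont_grad.mono (prod_mono_right Icc_subset_Ici_self))
  obtain ⟨δ, hδ, hd⟩ := Metric.uniformContinuousOn_iff.1 h1 1 one_pos
  refine ⟨min 1 (δ / 2), by positivity, fun x hx t ht => ?_⟩
  have hx' := Ioo_subset_Icc_self hx
  have h2 := hd (x, t) ⟨hx', ht.1, ht.2.trans (min_le_left _ _)⟩ (x, 0) ⟨hx', by simp⟩ (by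
    rw [Prod.dist_eq, dist_self, max_eq_right dist_nonneg, Real.dist_eq, sub_zero,
      abs_of_nonneg ht.1]
    exact (ht.2.trans (min_le_right _ _)).trans_lt (by linarith))
  have h3 : |g x 0| ≤ L := abs_deriv_le_of_lipschitzOn hx (h.grad x hx 0 le_rfl) fun y hy => by
    rw [h.ic y hy, h.ic x hx']
    exact hL y hy x hx'
  rw [Real.dist_eq] at h2
  have := abs_sub_abs_le_abs_sub (g x t) (g x 0)
  linarith

end DirichletSol

/-- Quantitative Hopf lemma at the left endpoint. -/
theorem IsSol.hopf_left {H : ℝ → ℝ} {u v : ℝ → ℝ → ℝ} (hu : IsSol H u) (hv : IsSol H v)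
    {m δ G L t₀ : ℝ} (hm : m ∈ Ioo (-1:ℝ) 1) (ht₀ : 0 < t₀) (hδ : 0 < δ)
    (hG : ∀ x ∈ Ioo (-1:ℝ) 1, ∀ t ∈ Ioc 0 t₀, |deriv (fun y => u y t) x| ≤ G)
    (hL : 0 ≤ L) (hLip : ∀ a b, |a| ≤ G + 1 → |b| ≤ G + 1 → |H a - H b| ≤ L * |a - b|)
    (h0 : ∀ x ∈ Icc (-1:ℝ) 1, u x 0 ≤ v x 0)
    (hmid : ∀ t ∈ Icc 0 t₀, u m t + δ ≤ v m t) :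
    ∃ κ, 0 < κ ∧ ∀ x ∈ Icc (-1) m, u x t₀ + κ * (1 + x) ≤ v x t₀ := by
  set σ := 2 / t₀ with hσ
  have hσ0 : 0 < σ := by positivity
  have hσt : σ * t₀ = 2 := by rw [hσ]; field_simp
  set K := L + σ with hK
  have hK0 : 0 < K := by positivity
  set A := Real.exp (2 * K) with hA
  have hA0 : 0 < A := Real.exp_pos _
  obtain ⟨ε, hε, hε1, hε2⟩ : ∃ ε, 0 < ε ∧ ε * K * A ≤ 1 ∧ ε * A ≤ δ := by
    refine ⟨min (1 / (K * A)) (δ / A), by positivity, ?_, ?_⟩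
    · rw [mul_assoc, ← le_div_iff₀ (by positivity)]; exact min_le_left _ _
    · rw [← le_div_iff₀ hA0]; exact min_le_right _ _
  set E : ℝ → ℝ → ℝ := fun x t => Real.exp (K * (x + 1 + σ * (t - t₀))) with hE
  have hEle : ∀ x ≤ (1:ℝ), ∀ t ≤ t₀, E x t ≤ A := fun x hx t ht => by
    apply Real.exp_le_exp.2
    have : σ * (t - t₀) ≤ 0 := mul_nonpos_of_nonneg_of_nonpos hσ0.le (by linarith)
    nlinarith
  have hEpos : ∀ x t, 0 < E x t := fun x t => Real.exp_pos _
  have hE1 : ∀ x t, x + 1 + σ * (t - t₀) ≤ 0 → E x t ≤ 1 := fun x t h =>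
    Real.exp_le_one_iff.2 (mul_nonpos_of_nonneg_of_nonpos hK0.le h)
  have hdx : ∀ x t, HasDerivAt (fun y => E y t) (K * E x t) x := fun x t => by
    have h1 : HasDerivAt (fun y : ℝ => K * (y + 1 + σ * (t - t₀))) K x := by
      simpa using (((hasDerivAt_id' x).add_const 1).add_const (σ * (t - t₀))).const_mul K
    exact h1.exp.congr_deriv (by rw [hE]; ring)
  have hdt : ∀ x t, HasDerivAt (fun s => E x s) (K * σ * E x t) t := fun x t => by
    have h1 : HasDerivAt (fun s : ℝ => K * (x + 1 + σ * (s - t₀))) (K * σ) t := by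
      simpa using ((((hasDerivAt_id' t).sub_const t₀).const_mul σ).const_add (x + 1)).const_mul K
    exact h1.exp.congr_deriv (by rw [hE]; ring)
  have hjet : ∀ x t, HasJet (fun x t => ε * (E x t - 1)) x t (ε * (K * σ * E x t))
      (ε * (K * E x t)) (ε * (K * (K * E x t))) := fun x t =>
    ⟨((hdt x t).sub_const 1).const_mul ε, fun y => ε * (K * E y t),
      Eventually.of_forall fun y => ((hdx y t).sub_const 1).const_mul ε, rfl,
      ((hdx x t).const_mul K).const_mul ε⟩
  have hsub : Icc (-1) m ⊆ Icc (-1:ℝ) 1 := Icc_subset_Icc_right hm.2.le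
  have key := parabolic_comparison (H := H) (u := fun x t => u x t + ε * (E x t - 1)) (v := v)
    (a := -1) (b := m) (T := t₀)
    ((hu.continuousOn.mono (prod_mono_left hsub)).add
      (g := fun q : ℝ × ℝ => ε * (E q.1 q.2 - 1)) (by rw [hE]; fun_prop))
    (hv.continuousOn.mono (prod_mono_left hsub))
    (fun x hx => by
      have := hE1 x 0 (by linarith [hx.2, hm.2])
      have : ε * (E x 0 - 1) ≤ 0 := mul_nonpos_of_nonneg_of_nonpos hε.le (by linarith)
      linarith [h0 x (hsub hx)])
    (fun t ht => by
      have := hE1 (-1) t (by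
        have : σ * (t - t₀) ≤ 0 := mul_nonpos_of_nonneg_of_nonpos hσ0.le (by linarith [ht.2])
        linarith)
      have : ε * (E (-1) t - 1) ≤ 0 := mul_nonpos_of_nonneg_of_nonpos hε.le (by linarith)
      rw [(hu.bc t ht.1).1, (hv.bc t ht.1).1]; linarith)
    (fun t ht => by
      have := mul_le_mul_of_nonneg_left (hEle m hm.2.le t ht.2) hε.le
      have := hmid t ht
      linarith)
    (fun x hx t ht => by
      have hx' : x ∈ Ioo (-1:ℝ) 1 := ⟨hx.1, hx.2.trans hm.2⟩
      obtain ⟨a, b, hj⟩ := hu.jet x hx' t ht.1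
      refine ⟨_, _, _, hj.add (hjet x t), ?_⟩
      have ha : |a| ≤ G := by rw [← hj.deriv_eq]; exact hG x hx' t ht
      have hz0 : 0 ≤ ε * (K * E x t) := by have := hEpos x t; positivity
      have hz1 : ε * (K * E x t) ≤ 1 := by
        refine le_trans ?_ hε1
        rw [← mul_assoc]
        exact mul_le_mul_of_nonneg_left (hEle x hx'.2.le t ht.2) (by positivity)
      have hb : |a + ε * (K * E x t)| ≤ G + 1 :=
        (abs_add_le _ _).trans (add_le_add ha (by rwa [abs_of_nonneg hz0]))
      have h1 := (abs_le.1 (hLip _ a hb (by linarith))).1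
      rw [add_sub_cancel_left, abs_of_nonneg hz0] at h1
      rw [hK] at h1 ⊢
      nlinarith)
    (fun x hx t ht => by
      obtain ⟨a, b, hj⟩ := hv.jet x ⟨hx.1, hx.2.trans hm.2⟩ t ht.1
      exact ⟨_, _, _, hj, le_rfl⟩)
  refine ⟨ε * K, by positivity, fun x hx => ?_⟩
  have h1 := key x hx t₀ ⟨ht₀.le, le_rfl⟩
  have h2 : K * (x + 1) + 1 ≤ E x t₀ := by simpa [hE] using Real.add_one_le_exp (K * (x + 1))
  have := mul_le_mul_of_nonneg_left h2 hε.le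
  linarith

theorem IsSol.hopf {H : ℝ → ℝ} {u v : ℝ → ℝ → ℝ} (hu : IsSol H u) (hv : IsSol H v)
    (hH : ∀ ξ, H (-ξ) = H ξ) {m δ G L t₀ : ℝ} (hm : m ∈ Ioo (-1:ℝ) 1) (ht₀ : 0 < t₀) (hδ : 0 < δ)
    (hG : ∀ x ∈ Ioo (-1:ℝ) 1, ∀ t ∈ Ioc 0 t₀, |deriv (fun y => u y t) x| ≤ G)
    (hL : 0 ≤ L) (hLip : ∀ a b, |a| ≤ G + 1 → |b| ≤ G + 1 → |H a - H b| ≤ L * |a - b|)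
    (h0 : ∀ x ∈ Icc (-1:ℝ) 1, u x 0 ≤ v x 0)
    (hmid : ∀ t ∈ Icc 0 t₀, u m t + δ ≤ v m t) :
    ∃ κ, 0 < κ ∧ ∀ x ∈ Icc (-1) 1, u x t₀ + κ * (1 - x ^ 2) ≤ v x t₀ := by
  obtain ⟨κ₁, hκ₁, h1⟩ := hu.hopf_left hv hm ht₀ hδ hG hL hLip h0 hmid
  obtain ⟨κ₂, hκ₂, h2⟩ := (hu.reflect hH).hopf_left (hv.reflect hH) (m := -m)
    ⟨by linarith [hm.2], by linarith [hm.1]⟩ ht₀ hδ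
    (fun x hx t ht => by
      have := hG (-x) ⟨by linarith [hx.2], by linarith [hx.1]⟩ t ht
      rwa [deriv_comp_neg (f := fun y => u y t), abs_neg])
    hL hLip (fun x hx => h0 (-x) ⟨by linarith [hx.2], by linarith [hx.1]⟩)
    (fun t ht => by simpa using hmid t ht)
  refine ⟨min κ₁ κ₂ / 2, by positivity, fun x hx => ?_⟩
  have m1 := min_le_left κ₁ κ₂
  have m2 := min_le_right κ₁ κ₂
  have m0 : 0 < min κ₁ κ₂ := lt_min hκ₁ hκ₂
  rcases le_total x m with h | h
  · have := h1 x ⟨hx.1, h⟩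
    have a1 : (1 - x) * (1 + x) ≤ 2 * (1 + x) :=
      mul_le_mul_of_nonneg_right (by linarith [hx.1]) (by linarith [hx.1])
    have a2 := mul_le_mul_of_nonneg_left a1 m0.le
    have a3 := mul_le_mul_of_nonneg_right m1 (by linarith [hx.1] : 0 ≤ 1 + x)
    nlinarith
  · have := h2 (-x) ⟨by linarith [hx.2], by linarith⟩
    rw [neg_neg] at this
    have a1 : (1 + x) * (1 - x) ≤ 2 * (1 - x) :=
      mul_le_mul_of_nonneg_right (by linarith [hx.2]) (by linarith [hx.2])
    have a2 := mul_le_mul_of_nonneg_left a1 m0.le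
    have a3 := mul_le_mul_of_nonneg_right m2 (by linarith [hx.2] : 0 ≤ 1 - x)
    nlinarith

/-- Two ordered, distinct data give solutions strictly separated, up to the boundary, at some
small time. -/
theorem IsSol.exists_separated {H : ℝ → ℝ} {u v : ℝ → ℝ → ℝ} (hu : IsSol H u) (hv : IsSol H v)
    (hH : ∀ ξ, H (-ξ) = H ξ) {G L t₁ : ℝ} (ht₁ : 0 < t₁)
    (hG : ∀ x ∈ Ioo (-1:ℝ) 1, ∀ t ∈ Ioc 0 t₁, |deriv (fun y => u y t) x| ≤ G)
    (hL : 0 ≤ L) (hLip : ∀ a b, |a| ≤ G + 1 → |b| ≤ G + 1 → |H a - H b| ≤ L * |a - b|)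
    (h0 : ∀ x ∈ Icc (-1:ℝ) 1, u x 0 ≤ v x 0)
    (hne : ¬ ∀ x ∈ Icc (-1:ℝ) 1, v x 0 = u x 0) :
    ∃ t₀ ∈ Ioc 0 t₁, ∃ κ, 0 < κ ∧ ∀ x ∈ Icc (-1:ℝ) 1, u x t₀ + κ * (1 - x ^ 2) ≤ v x t₀ := by
  push Not at hne
  obtain ⟨m, hm, hne⟩ := hne
  have hlt : u m 0 < v m 0 := lt_of_le_of_ne (h0 m hm) (Ne.symm hne)
  have hm1 : m ≠ -1 := by rintro rfl; simp [(hu.bc 0 le_rfl).1, (hv.bc 0 le_rfl).1] at hlt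
  have hm2 : m ≠ 1 := by rintro rfl; simp [(hu.bc 0 le_rfl).2, (hv.bc 0 le_rfl).2] at hlt
  have hm' : m ∈ Ioo (-1:ℝ) 1 := ⟨lt_of_le_of_ne hm.1 (Ne.symm hm1), lt_of_le_of_ne hm.2 hm2⟩
  set δ := (v m 0 - u m 0) / 2 with hδ
  have hc : ContinuousOn (fun t => v m t - u m t) (Ici 0) :=
    (hv.cont.comp (f := fun t : ℝ => (m, t)) (by fun_prop) fun t ht => mk_mem_prod hm ht).sub
    (hu.cont.comp (f := fun t : ℝ => (m, t)) (by fun_prop) fun t ht => mk_mem_prod hm ht)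
  obtain ⟨τ, hτ, hd⟩ := Metric.continuousOn_iff.1 hc 0 self_mem_Ici δ (by rw [hδ]; linarith)
  refine ⟨min t₁ (τ / 2), ⟨by positivity, min_le_left _ _⟩, ?_⟩
  refine hu.hopf hv hH (δ := δ) hm' (by positivity) (by rw [hδ]; linarith)
    (fun x hx t ht => hG x hx t ⟨ht.1, ht.2.trans (min_le_left _ _)⟩) hL hLip h0 fun t ht => ?_
  have h1 := hd t ht.1 (by
    rw [Real.dist_eq, sub_zero, abs_of_nonneg ht.1]
    exact (ht.2.trans (min_le_right _ _)).trans_lt (by linarith))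
  rw [Real.dist_eq] at h1
  have := (abs_lt.1 h1).1
  rw [hδ] at this ⊢
  linarith

/-- As long as the gradient does not exceed the truncation level, truncating later changes
nothing. -/
theorem IsSol.eq_of_abs_deriv_le {p : ℝ} (hp : 2 < p) {i j : ℕ} (hij : i ≤ j) {u w : ℝ → ℝ → ℝ}
    (hu : IsSol (Fj1 p i) u) (hw : IsSol (Fj1 p j) w) {T : ℝ}
    (h0 : ∀ x ∈ Icc (-1:ℝ) 1, w x 0 = u x 0)
    (hG : ∀ x ∈ Ioo (-1:ℝ) 1, ∀ t ∈ Ioc 0 T, |deriv (fun y => u y t) x| ≤ i)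
    {x : ℝ} (hx : x ∈ Icc (-1:ℝ) 1) {t : ℝ} (ht : t ∈ Icc 0 T) : w x t = u x t := by
  refine le_antisymm (hw.le_super hu.continuousOn (fun y hy => (h0 y hy).le)
    (fun s hs => (hu.bc s hs.1).1.ge) (fun s hs => (hu.bc s hs.1).2.ge) (fun y hy s hs => ?_)
    x hx t ht) (hu.le hw (fun ξ => Fj1_mono hp hij ξ) (fun y hy => (h0 y hy).ge) hx ht.1)
  obtain ⟨a, b, hj⟩ := hu.jet y hy s hs.1
  refine ⟨_, _, _, hj, ?_⟩
  have ha : |a| ≤ i := by rw [← hj.deriv_eq]; exact hG y hy s hs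
  rw [Fj1_of_abs_le hp ha, Fj1_of_abs_le hp (ha.trans (Nat.cast_le.2 hij))]

/-- A function whose derivative is bounded on an open interval is Lipschitz on its closure. -/
theorem abs_sub_le_of_abs_deriv_le {f f' : ℝ → ℝ} {M : ℝ} (hf : ContinuousOn f (Icc (-1) 1))
    (hd : ∀ x ∈ Ioo (-1:ℝ) 1, HasDerivAt f (f' x) x) (hM : ∀ x ∈ Ioo (-1:ℝ) 1, |f' x| ≤ M)
    {a b : ℝ} (ha : a ∈ Icc (-1:ℝ) 1) (hb : b ∈ Icc (-1:ℝ) 1) : |f b - f a| ≤ M * |b - a| := by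
  have hlt : ∀ a ∈ Icc (-1:ℝ) 1, ∀ b ∈ Icc (-1:ℝ) 1, a < b → |f b - f a| ≤ M * |b - a| := by
    intro a ha b hb hab
    obtain ⟨c, hc, he⟩ := exists_hasDerivAt_eq_slope f f' hab
      (hf.mono (Icc_subset_Icc ha.1 hb.2))
      (fun y hy => hd y ⟨ha.1.trans_lt hy.1, hy.2.trans_le hb.2⟩)
    have hc' := hM c ⟨ha.1.trans_lt hc.1, hc.2.trans_le hb.2⟩
    rwa [he, abs_div, div_le_iff₀ (abs_pos.2 (by linarith))] at hc'
  rcases lt_trichotomy a b with h | rfl | h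
  · exact hlt a ha b hb h
  · simp
  · rw [abs_sub_comm, abs_sub_comm b a]; exact hlt b hb a ha h

/-- A function vanishing at both endpoints with slope at most `M` lies below `M (1 - x²)`. -/
theorem abs_le_of_abs_deriv_le {f f' : ℝ → ℝ} {M : ℝ} (hf : ContinuousOn f (Icc (-1) 1))
    (hd : ∀ x ∈ Ioo (-1:ℝ) 1, HasDerivAt f (f' x) x) (hM : ∀ x ∈ Ioo (-1:ℝ) 1, |f' x| ≤ M)
    (h1 : f (-1) = 0) (h2 : f 1 = 0) {x : ℝ} (hx : x ∈ Icc (-1:ℝ) 1) :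
    |f x| ≤ M * (1 - x ^ 2) := by
  have hM0 : 0 ≤ M := (abs_nonneg _).trans (hM 0 (by simp))
  have key : ∀ a ∈ Icc (-1:ℝ) 1, ∀ b ∈ Icc (-1:ℝ) 1, |f b - f a| ≤ M * |b - a| :=
    fun a ha b hb => abs_sub_le_of_abs_deriv_le hf hd hM ha hb
  rcases le_total x 0 with h | h
  · have := key (-1) (by simp) x hx
    rw [h1, sub_zero, abs_of_nonneg (a := x - -1) (by linarith [hx.1])] at this
    exact this.trans (mul_le_mul_of_nonneg_left (by nlinarith [hx.1]) hM0)
  · have := key 1 (by simp) x hx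
    rw [h2, sub_zero, abs_of_nonpos (a := x - 1) (by linarith [hx.2])] at this
    exact this.trans (mul_le_mul_of_nonneg_left (by nlinarith [hx.2]) hM0)

/-- A smooth profile, together with a multiple of it by a factor larger than one, fits into a gap
that opens linearly at the endpoints. -/
theorem exists_smooth_between {f g : ℝ → ℝ} {G κ : ℝ} (hκ : 0 < κ)
    (hf : ContinuousOn f (Icc (-1) 1)) (hg : ContinuousOn g (Icc (-1) 1))
    (hd : ∀ x ∈ Ioo (-1:ℝ) 1, HasDerivAt f (g x) x) (hG : ∀ x ∈ Ioo (-1:ℝ) 1, |g x| ≤ G)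
    (h1 : f (-1) = 0) (h2 : f 1 = 0) :
    ∃ w : ℝ → ℝ, ∃ l : ℝ, 1 < l ∧ ContDiff ℝ 2 w ∧ w (-1) = 0 ∧ w 1 = 0 ∧
      (∀ x ∈ Icc (-1:ℝ) 1, f x ≤ w x) ∧
      ∀ x ∈ Icc (-1:ℝ) 1, l * w x ≤ f x + κ * (1 - x ^ 2) := by
  set ε := κ / 8 with hε
  have hε0 : 0 < ε := by positivity
  obtain ⟨q, hq⟩ := exists_polynomial_near_of_continuousOn (-1) 1 g hg ε hε0
  set Q : ℝ → ℝ := fun x => ∫ y in (-1:ℝ)..x, q.eval y with hQ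
  have hQd : ∀ x, HasDerivAt Q (q.eval x) x := fun x =>
    intervalIntegral.integral_hasDerivAt_right (q.continuous.intervalIntegrable _ _)
      (q.continuous.stronglyMeasurableAtFilter _ _) q.continuous.continuousAt
  have hQc : ContDiff ℝ 2 Q := by
    rw [show (2 : WithTop ℕ∞) = 1 + 1 by norm_num, contDiff_succ_iff_deriv]
    refine ⟨fun x => (hQd x).differentiableAt, by simp, ?_⟩
    rw [show deriv Q = fun x => q.eval x from funext fun x => (hQd x).deriv]
    simpa using q.contDiff_aeval (𝕜 := ℝ) 1
  have hQ1 : Q (-1) = 0 := by simp [hQ]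
  set e := Q 1 with he
  have hle : |e| ≤ 2 * ε := by
    obtain ⟨c, hc, hs⟩ := exists_hasDerivAt_eq_slope (fun x => Q x - f x)
      (fun x => q.eval x - g x) (by norm_num : (-1:ℝ) < 1)
      (hQc.continuous.continuousOn.sub hf) fun x hx => (hQd x).sub (hd x hx)
    have h3 := (hq c (Ioo_subset_Icc_self hc)).le
    rw [hs, hQ1, h1, h2, ← he, abs_div, div_le_iff₀ (by norm_num)] at h3
    norm_num at h3
    linarith
  set D : ℝ → ℝ := fun x => Q x - f x - e / 2 * (1 + x) with hD
  have hDb : ∀ x ∈ Icc (-1:ℝ) 1, |D x| ≤ 2 * ε * (1 - x ^ 2) := fun x hx => by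
    refine abs_le_of_abs_deriv_le (f' := fun x => q.eval x - g x - e / 2)
      ((hQc.continuous.continuousOn.sub hf).sub (g := fun x => e / 2 * (1 + x)) (by fun_prop)) (fun y hy => ?_) (fun y hy => ?_)
      ?_ ?_ hx
    · have := (((hQd y).sub (hd y hy)).sub (((hasDerivAt_id' y).const_add 1).const_mul (e / 2)))
      exact this.congr_deriv (by ring)
    · have a1 := (hq y (Ioo_subset_Icc_self hy)).le
      have a2 := abs_sub (q.eval y - g y) (e / 2)
      rw [abs_div, abs_two] at a2
      linarith
    · simp [hQ1, h1]
    · simp only [Pi.sub_apply, h2, ← he]; ring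
  have hG0 : 0 ≤ G := (abs_nonneg _).trans (hG 0 (by simp))
  refine ⟨fun x => Q x - e / 2 * (1 + x) + 2 * ε * (1 - x ^ 2), 1 + κ / 2 / (G + κ / 2),
    by have : 0 < κ / 2 / (G + κ / 2) := by positivity
       linarith,
    by fun_prop, by simp [hQ1], by simp only [← he]; ring, fun x hx => ?_, fun x hx => ?_⟩
  · have := (abs_le.1 (hDb x hx)).1
    simp only [hD] at this; linarith
  · have a1 := (abs_le.1 (hDb x hx)).2
    have a2 := (le_abs_self _).trans (abs_le_of_abs_deriv_le hf hd hG h1 h2 hx)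
    simp only [hD] at a1
    have a3 : Q x - e / 2 * (1 + x) + 2 * ε * (1 - x ^ 2) ≤ f x + κ / 2 * (1 - x ^ 2) := by
      rw [hε] at a1 ⊢; linarith
    have a4 : κ / 2 / (G + κ / 2) * (Q x - e / 2 * (1 + x) + 2 * ε * (1 - x ^ 2))
        ≤ κ / 2 * (1 - x ^ 2) := by
      refine (mul_le_mul_of_nonneg_left (a3.trans (?_ : _ ≤ (G + κ / 2) * (1 - x ^ 2)))
        (by positivity)).trans_eq ?_
      · linarith
      · field_simp
    rw [add_mul, one_mul]
    linarith

/-- The time derivative is bounded by its bound at time zero. -/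
theorem IsSol.abs_time_deriv_le {H : ℝ → ℝ} {z : ℝ → ℝ → ℝ} (hz : IsSol H z) {w : ℝ → ℝ} {C : ℝ}
    (hw : ContDiff ℝ 2 w) (hC : ∀ x ∈ Ioo (-1:ℝ) 1, |deriv (deriv w) x + H (deriv w x)| ≤ C)
    (h0 : ∀ x ∈ Icc (-1:ℝ) 1, z x 0 = w x) {x t ut ux uxx : ℝ} (hx : x ∈ Ioo (-1:ℝ) 1)
    (ht : 0 < t) (hj : HasJet z x t ut ux uxx) : |ut| ≤ C := by
  have hC0 : 0 ≤ C := (abs_nonneg _).trans (hC 0 (by simp))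
  have hw1 : w (-1) = 0 := by rw [← h0 _ (by simp), (hz.bc 0 le_rfl).1]
  have hw2 : w 1 = 0 := by rw [← h0 _ (by simp), (hz.bc 0 le_rfl).2]
  have hwd : ContDiff ℝ 1 (deriv w) :=
    ((contDiff_succ_iff_deriv (n := 1)).1 (by simpa [one_add_one_eq_two] using hw)).2.2
  have hjet : ∀ (c y s : ℝ), HasJet (fun y s => w y + c * s) y s c (deriv w y)
      (deriv (deriv w) y) := fun c y s => by
    have h1 : HasJet (fun y _ => w y) y s 0 (deriv w y) (deriv (deriv w) y) :=
      HasJet.of_space (Eventually.of_forall fun y =>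
        (hw.differentiable two_ne_zero y).hasDerivAt) (hwd.differentiable one_ne_zero y).hasDerivAt
    have h2 : HasJet (fun _ s => c * s) y s c 0 0 :=
      HasJet.of_time (by simpa using (hasDerivAt_id' s).const_mul c)
    simpa using h1.add h2
  have hcw := hw.continuous
  have hup : ∀ y ∈ Icc (-1:ℝ) 1, ∀ s, 0 ≤ s → z y s ≤ w y + C * s := fun y hy s hs =>
    hz.le_super (B := fun y s => w y + C * s) (T := s) (by fun_prop)
      (fun y hy => by simp [h0 y hy])
      (fun r hr => by simp only [hw1, zero_add]; exact mul_nonneg hC0 hr.1)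
      (fun r hr => by simp only [hw2, zero_add]; exact mul_nonneg hC0 hr.1)
      (fun y hy r hr => ⟨_, _, _, hjet C y r, (abs_le.1 (hC y hy)).2⟩) y hy s ⟨hs, le_rfl⟩
  have hlow : ∀ y ∈ Icc (-1:ℝ) 1, ∀ s, 0 ≤ s → w y + -C * s ≤ z y s := fun y hy s hs =>
    parabolic_comparison (H := H) (u := fun y s => w y + -C * s) (T := s) (by fun_prop)
      hz.continuousOn (fun y hy => by simp [h0 y hy])
      (fun r hr => by
        simp only [hw1, (hz.bc r hr.1).1]; nlinarith [hr.1])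
      (fun r hr => by
        simp only [hw2, (hz.bc r hr.1).2]; nlinarith [hr.1])
      (fun y hy r hr => ⟨_, _, _, hjet (-C) y r, (abs_le.1 (hC y hy)).1⟩)
      (fun y hy r hr => by
        obtain ⟨a, b, hj⟩ := hz.jet y hy r hr.1
        exact ⟨_, _, _, hj, le_rfl⟩) y hy s ⟨hs, le_rfl⟩
  have hcmp : ∀ h, 0 ≤ h → ∀ y ∈ Icc (-1:ℝ) 1, ∀ s, 0 ≤ s → |z y (s + h) - z y s| ≤ C * h := by
    intro h hh y hy s hs
    have hCh : 0 ≤ C * h := mul_nonneg hC0 hh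
    have e1 := (hz.shift hh).le_super (B := fun y s => z y s + C * h) (T := s)
      (hz.continuousOn.add_const (C * h))
      (fun y hy => by simp only [zero_add, h0 y hy]; exact hup y hy h hh)
      (fun r hr => by simp only [(hz.bc r hr.1).1, zero_add]; exact hCh)
      (fun r hr => by simp only [(hz.bc r hr.1).2, zero_add]; exact hCh)
      (fun y hy r hr => by
        obtain ⟨a, b, hj⟩ := hz.jet y hy r hr.1
        exact ⟨_, _, _, hj.add (hasJet_const (C * h) y r), by simp⟩) y hy s ⟨hs, le_rfl⟩
    have e2 := hz.le_super (B := fun y s => z y (s + h) + C * h) (T := s)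
      ((hz.shift hh).continuousOn.add_const (C * h))
      (fun y hy => by
        have := hlow y hy h hh
        simp only [zero_add, h0 y hy]; linarith)
      (fun r hr => by simp only [((hz.shift hh).bc r hr.1).1, zero_add]; exact hCh)
      (fun r hr => by simp only [((hz.shift hh).bc r hr.1).2, zero_add]; exact hCh)
      (fun y hy r hr => by
        obtain ⟨a, b, hj⟩ := (hz.shift hh).jet y hy r hr.1
        exact ⟨_, _, _, hj.add (hasJet_const (C * h) y r), by simp⟩) y hy s ⟨hs, le_rfl⟩
    exact abs_le.2 ⟨by linarith, by linarith⟩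
  have hxI := Ioo_subset_Icc_self hx
  refine abs_deriv_le_of_lipschitzOn (a := 0) (b := 2 * t) ⟨ht, by linarith⟩ hj.time
    fun s hs => ?_
  rcases le_total s t with h | h
  · have := hcmp (t - s) (by linarith) x hxI s hs.1
    rw [add_sub_cancel] at this
    rwa [abs_sub_comm, abs_sub_comm s t, abs_of_nonneg (a := t - s) (by linarith)]
  · have := hcmp (s - t) (by linarith) x hxI t ht.le
    rw [add_sub_cancel] at this
    rwa [abs_of_nonneg (a := s - t) (by linarith)]

/-- The singular steady slope `ψ`, which solves `ψ' = -ψ ^ p`. -/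
def singSlope (p y : ℝ) : ℝ := ((p - 1) * y) ^ (-(1 / (p - 1)))

/-- The singular steady state, the primitive of `singSlope p` vanishing at `0`. -/
def singProfile (p y : ℝ) : ℝ := ((p - 1) * y) ^ (1 - 1 / (p - 1)) / (p - 2)

section

variable {p : ℝ}

theorem hasDerivAt_singSlope (hp : 2 < p) {y : ℝ} (hy : 0 < y) :
    HasDerivAt (singSlope p) (-(singSlope p y) ^ p) y := by
  have hp1 : 0 < p - 1 := by linarith
  have h := ((hasDerivAt_id' y).const_mul (p - 1)).rpow_const (p := -(1 / (p - 1)))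
    (Or.inl (by positivity))
  refine h.congr_deriv ?_
  rw [singSlope, ← Real.rpow_mul (by positivity),
    show -(1 / (p - 1)) - 1 = -(1 / (p - 1)) * p by field_simp; ring]
  field_simp

theorem hasDerivAt_singProfile (hp : 2 < p) {y : ℝ} (hy : 0 < y) :
    HasDerivAt (singProfile p) (singSlope p y) y := by
  have hp1 : 0 < p - 1 := by linarith
  have hp2 : 0 < p - 2 := by linarith
  have h := (((hasDerivAt_id' y).const_mul (p - 1)).rpow_const (p := 1 - 1 / (p - 1))
    (Or.inl (by positivity))).div_const (p - 2)
  refine h.congr_deriv ?_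
  rw [singSlope, show 1 - 1 / (p - 1) - 1 = -(1 / (p - 1)) by ring]
  field_simp
  ring

theorem singSlope_pos (hp : 2 < p) {y : ℝ} (hy : 0 < y) : 0 < singSlope p y :=
  Real.rpow_pos_of_pos (mul_pos (by linarith) hy) _

theorem singSlope_anti (hp : 2 < p) {x y : ℝ} (hx : 0 < x) (hxy : x ≤ y) :
    singSlope p y ≤ singSlope p x := by
  have hp1 : 0 < p - 1 := by linarith
  exact Real.rpow_le_rpow_of_nonpos (by positivity) (by gcongr)
    (by rw [neg_nonpos]; positivity)

theorem exists_le_singSlope (hp : 2 < p) (K : ℝ) {r : ℝ} (hr : 0 < r) :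
    ∃ ε ∈ Ioc 0 r, K ≤ singSlope p ε := by
  have hp1 : 0 < p - 1 := by linarith
  have h1 : Tendsto (fun y : ℝ => (p - 1) * y) (𝓝[>] 0) (𝓝[>] 0) := by
    refine tendsto_nhdsWithin_iff.2 ⟨?_, ?_⟩
    · have : Tendsto (fun y : ℝ => (p - 1) * y) (𝓝 0) (𝓝 ((p - 1) * 0)) :=
        (continuous_const.mul continuous_id).tendsto 0
      rw [mul_zero] at this
      exact this.mono_left nhdsWithin_le_nhds
    · filter_upwards [self_mem_nhdsWithin] with y hy using mul_pos hp1 hy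
  have h2 : Tendsto (singSlope p) (𝓝[>] 0) atTop :=
    (tendsto_rpow_neg_nhdsGT_zero (by rw [neg_lt_zero]; positivity)).comp h1
  obtain ⟨ε, h3, h4⟩ := ((h2.eventually_ge_atTop K).and (Ioc_mem_nhdsGT hr)).exists
  exact ⟨ε, h4, h3⟩

theorem one_sub_inv_pos (hp : 2 < p) : 0 < 1 - 1 / (p - 1) := by
  rw [sub_pos, div_lt_one (by linarith)]; linarith

theorem singProfile_zero (hp : 2 < p) : singProfile p 0 = 0 := by
  rw [singProfile, mul_zero, Real.zero_rpow (one_sub_inv_pos hp).ne', zero_div]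

theorem singProfile_mono (hp : 2 < p) {x y : ℝ} (hx : 0 ≤ x) (hxy : x ≤ y) :
    singProfile p x ≤ singProfile p y := by
  have hp1 : 0 < p - 1 := by linarith
  have hp2 : 0 < p - 2 := by linarith
  have := one_sub_inv_pos hp
  unfold singProfile
  gcongr

theorem continuous_singProfile (hp : 2 < p) : Continuous (singProfile p) :=
  ((continuous_const.mul continuous_id).rpow_const
    fun _ => Or.inr (one_sub_inv_pos hp).le).div_const _

/-- The singular profile dominates quadratic terms near the boundary. -/
theorem exists_mul_sq_lt_singProfile (hp : 2 < p) (K : ℝ) {r : ℝ} (hr : 0 < r) :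
    ∃ y ∈ Ioc 0 r, K * y ^ 2 < singProfile p y := by
  have hp1 : 0 < p - 1 := by linarith
  have hp2 : 0 < p - 2 := by linarith
  obtain ⟨ε, hε, hK⟩ := exists_le_singSlope hp (|K| + 1) (lt_min hr one_pos)
  refine ⟨ε, ⟨hε.1, hε.2.trans (min_le_left _ _)⟩, ?_⟩
  have h1 : singProfile p ε = singSlope p ε * ((p - 1) / (p - 2) * ε) := by
    rw [singProfile, singSlope, show 1 - 1 / (p - 1) = -(1 / (p - 1)) + 1 by ring,
      Real.rpow_add_one (mul_pos hp1 hε.1).ne']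
    ring
  have h2 : ε ≤ (p - 1) / (p - 2) * ε := by
    have : 1 ≤ (p - 1) / (p - 2) := by rw [le_div_iff₀ hp2]; linarith
    nlinarith [hε.1]
  have h3 : ε ≤ 1 := hε.2.trans (min_le_right _ _)
  rw [h1]
  calc K * ε ^ 2 ≤ |K| * ε ^ 2 := by gcongr; exact le_abs_self K
    _ ≤ |K| * ε := by
      have := hε.1
      gcongr
      nlinarith
    _ < (|K| + 1) * ε := by linarith [hε.1]
    _ ≤ singSlope p ε * ((p - 1) / (p - 2) * ε) := by
      have := hε.1
      have := (singSlope_pos hp hε.1).le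
      gcongr

end

theorem le_of_touching {h k B B' : ℝ → ℝ} {a b : ℝ} (hh : ∀ x ∈ Icc a b, HasDerivAt h (k x) x)
    (hB : ∀ x ∈ Icc a b, HasDerivAt B (B' x) x) (ha : h a ≤ B a)
    (ht : ∀ x ∈ Icc a b, h x = B x → k x < B' x) : ∀ x ∈ Icc a b, h x ≤ B x := fun _ hx =>
  image_le_of_deriv_right_lt_deriv_boundary'
    (fun x hx => (hh x hx).continuousAt.continuousWithinAt)
    (fun x hx => (hh x (Ico_subset_Icc_self hx)).hasDerivWithinAt) ha
    (fun x hx => (hB x hx).continuousAt.continuousWithinAt)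
    (fun x hx => (hB x (Ico_subset_Icc_self hx)).hasDerivWithinAt)
    (fun x hx => ht x (Ico_subset_Icc_self hx)) hx

theorem sub_le_sub_of_deriv_le {f g f' g' : ℝ → ℝ} {a b : ℝ} (hab : a ≤ b)
    (hf : ∀ x ∈ Icc a b, HasDerivAt f (f' x) x) (hg : ∀ x ∈ Icc a b, HasDerivAt g (g' x) x)
    (h : ∀ x ∈ Icc a b, f' x ≤ g' x) : f b - f a ≤ g b - g a := by
  have hd : ∀ x ∈ Icc a b, HasDerivAt (fun x => g x - f x) (g' x - f' x) x :=
    fun x hx => (hg x hx).sub (hf x hx)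
  have : MonotoneOn (fun x => g x - f x) (Icc a b) := by
    refine monotoneOn_of_hasDerivWithinAt_nonneg (f' := fun x => g' x - f' x) (convex_Icc a b)
      (fun x hx => (hd x hx).continuousAt.continuousWithinAt) (fun x hx => ?_) fun x hx => ?_
    · exact (hd x (interior_subset hx)).hasDerivWithinAt
    · exact sub_nonneg.2 (h x (interior_subset hx))
  have := this (left_mem_Icc.2 hab) (right_mem_Icc.2 hab) hab
  simp only at this
  linarith

section

variable {p C : ℝ}

theorem hasDerivAt_singSlope_shift (hp : 2 < p) {a ε y : ℝ} (hy : 0 < y - a + ε) :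
    HasDerivAt (fun y => singSlope p (y - a + ε)) (-(singSlope p (y - a + ε)) ^ p) y := by
  have := (hasDerivAt_singSlope hp hy).comp y (((hasDerivAt_id' y).sub_const a).add_const ε)
  simpa [Function.comp_def] using this

theorem hasDerivAt_singProfile_shift (hp : 2 < p) {a ε y : ℝ} (hy : 0 < y - a + ε) :
    HasDerivAt (fun y => singProfile p (y - a + ε)) (singSlope p (y - a + ε)) y := by
  have := (hasDerivAt_singProfile hp hy).comp y (((hasDerivAt_id' y).sub_const a).add_const ε)
  simpa [Function.comp_def] using this

theorem hasDerivAt_mul_sub_sq (c a y : ℝ) :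
    HasDerivAt (fun y => c / 2 * (y - a) ^ 2) (c * (y - a)) y := by
  refine ((((hasDerivAt_id' y).sub_const a).pow 2).const_mul (c / 2)).congr_deriv ?_
  ring

/-- If `f'' + F_J(f') ≤ C` with a large truncation level, then `f` grows away from `a` no faster
than the singular steady state. -/
theorem exists_level_le_singProfile (hp : 2 < p) (hC : 0 ≤ C) (N : ℝ) {a : ℝ} (ha : a ∈ Ioo (0:ℝ) 1) :
    ∃ J₀ : ℕ, ∀ J ≥ J₀, ∀ f h k : ℝ → ℝ, (∀ y ∈ Ioo (0:ℝ) 2, HasDerivAt f (h y) y) →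
      (∀ y ∈ Ioo (0:ℝ) 2, HasDerivAt h (k y) y) → (∀ y ∈ Ioo (0:ℝ) 2, k y + Fj1 p J (h y) ≤ C) →
      (∀ y ∈ Ioo (0:ℝ) 2, 0 ≤ f y ∧ f y ≤ N) →
      ∀ y ∈ Icc a 1, f y ≤ f a + singProfile p y + (C + 1) * y ^ 2 := by
  obtain ⟨ε, hε, hεN⟩ := exists_le_singSlope hp (2 * N / a + C) ha.1
  refine ⟨⌈singSlope p ε⌉₊, fun J hJ f h k hf hh hk hN y hy => ?_⟩
  have hJ' : singSlope p ε ≤ J := Nat.ceil_le.1 hJ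
  have hsub : Icc a 1 ⊆ Ioo (0:ℝ) 2 := fun x hx => ⟨ha.1.trans_le hx.1, by linarith [hx.2]⟩
  have hsub2 : Icc (a / 2) a ⊆ Ioo (0:ℝ) 2 := fun x hx =>
    ⟨by linarith [hx.1, ha.1], by linarith [hx.2, ha.2]⟩
  have hpos : ∀ x ∈ Icc a 1, 0 < x - a + ε := fun x hx => by linarith [hx.1, hε.1]
  have hstart : h a ≤ singSlope p ε := by
    obtain ⟨s, hs, he⟩ := exists_hasDerivAt_eq_slope f h (by linarith [ha.1] : a / 2 < a)
      (fun x hx => (hf x (hsub2 hx)).continuousAt.continuousWithinAt)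
      (fun x hx => hf x (hsub2 (Ioo_subset_Icc_self hx)))
    have h1 := (hN a (hsub (left_mem_Icc.2 ha.2.le))).2
    have h2 := (hN (a / 2) (hsub2 (left_mem_Icc.2 (by linarith [ha.1])))).1
    have h3 : h s ≤ 2 * N / a := by
      rw [he, div_le_div_iff₀ (by linarith [ha.1]) ha.1]
      nlinarith [ha.1]
    have h4 := sub_le_sub_of_deriv_le (f := h) (g := fun x => C * x) (f' := k) (g' := fun _ => C)
      hs.2.le (fun x hx => hh x (hsub2 ⟨hs.1.le.trans hx.1, hx.2⟩))
      (fun x _ => by simpa using (hasDerivAt_id' x).const_mul C)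
      (fun x hx => by
        linarith [hk x (hsub2 ⟨hs.1.le.trans hx.1, hx.2⟩), Fj1_nonneg (p := p) (j := J) (h x)])
    have h5 : a - s ≤ 1 := by linarith [hs.1, ha.1, ha.2]
    nlinarith
  have hslope := le_of_touching (h := h) (k := k) (a := a) (b := 1)
    (B := fun y => singSlope p (y - a + ε) + (C + 1) * (y - a))
    (B' := fun y => -(singSlope p (y - a + ε)) ^ p + (C + 1))
    (fun x hx => hh x (hsub hx))
    (fun x hx => by
      refine ((hasDerivAt_singSlope_shift hp (hpos x hx)).fun_add
        (((hasDerivAt_id' x).sub_const a).const_mul (C + 1))).congr_deriv ?_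
      ring)
    (by simpa using hstart)
    (fun x hx he => by
      have h1 := hk x (hsub hx)
      have h0 := singSlope_pos hp (hpos x hx)
      have h2 : singSlope p (x - a + ε) ^ p ≤ Fj1 p J (h x) := by
        have h3 : Fj1 p J (singSlope p (x - a + ε)) = singSlope p (x - a + ε) ^ p := by
          rw [Fj1_of_abs_le hp, abs_of_pos h0]
          rw [abs_of_pos h0]
          exact (singSlope_anti hp hε.1 (by linarith [hx.1])).trans hJ'
        have h4 : singSlope p (x - a + ε) ≤ h x := by
          rw [he]; nlinarith [hx.1]
        rw [← h3]
        have h5 : |singSlope p (x - a + ε)| ≤ |h x| := by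
          rwa [abs_of_pos h0, abs_of_pos (h0.trans_le h4)]
        exact min_le_min (Real.rpow_le_rpow (abs_nonneg _) h5 (by linarith))
          (mul_le_mul_of_nonneg_left (sq_le_sq.2 h5) (by positivity))
      linarith)
  have hInt := sub_le_sub_of_deriv_le (f := f) (f' := h)
    (g := fun y => singProfile p (y - a + ε) + (C + 1) / 2 * (y - a) ^ 2)
    (g' := fun y => singSlope p (y - a + ε) + (C + 1) * (y - a)) hy.1
    (fun x hx => hf x (hsub ⟨hx.1, hx.2.trans hy.2⟩))
    (fun x hx => (hasDerivAt_singProfile_shift hp (hpos x ⟨hx.1, hx.2.trans hy.2⟩)).fun_add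
      (hasDerivAt_mul_sub_sq (C + 1) a x))
    (fun x hx => hslope x ⟨hx.1, hx.2.trans hy.2⟩)
  simp only [sub_self, zero_add] at hInt
  have h1 : singProfile p (y - a + ε) ≤ singProfile p y :=
    singProfile_mono hp (hpos y hy).le (by linarith [hε.2])
  have h2 : 0 ≤ singProfile p ε := by
    rw [← singProfile_zero hp]; exact singProfile_mono hp le_rfl hε.1.le
  have h3 : (C + 1) / 2 * (y - a) ^ 2 ≤ (C + 1) * y ^ 2 := by
    have : (y - a) ^ 2 ≤ y ^ 2 := by nlinarith [hy.1, ha.1]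
    nlinarith [sq_nonneg y]
  nlinarith

/-- If `f'' + |f'|^p ≥ -C` and `f` has a large slope at `a`, then beyond `a` it stays above the
singular steady state, up to a quadratic term. -/
theorem singProfile_sub_le (hp : 2 < p) (hC : 0 ≤ C) {a ε b : ℝ} (ha : 0 < a) (hε : 0 < ε)
    (hε1 : ε ≤ 1) (hb : b ≤ 1) (hbC : (C + 1) * b ≤ singSlope p 2) {f h k : ℝ → ℝ}
    (hf : ∀ y ∈ Icc a b, HasDerivAt f (h y) y) (hh : ∀ y ∈ Icc a b, HasDerivAt h (k y) y)
    (hk : ∀ y ∈ Icc a b, -C ≤ k y + |h y| ^ p) (hab : a ≤ b) (hfa : 0 ≤ f a)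
    (hha : singSlope p ε ≤ h a) :
    singProfile p (b - a + ε) - singProfile p ε - (C + 1) * b ^ 2 ≤ f b := by
  have hpos : ∀ x ∈ Icc a b, 0 < x - a + ε := fun x hx => by linarith [hx.1]
  have hBd : ∀ x ∈ Icc a b, HasDerivAt (fun y => singSlope p (y - a + ε) - (C + 1) * (y - a))
      (-(singSlope p (x - a + ε)) ^ p - (C + 1)) x := fun x hx => by
    refine ((hasDerivAt_singSlope_shift hp (hpos x hx)).fun_sub
      (((hasDerivAt_id' x).sub_const a).const_mul (C + 1))).congr_deriv ?_
    ring
  have hslope := le_of_touching (a := a) (b := b)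
    (h := fun y => -h y) (k := fun y => -k y)
    (B := fun y => -(singSlope p (y - a + ε) - (C + 1) * (y - a)))
    (B' := fun y => -(-(singSlope p (y - a + ε)) ^ p - (C + 1)))
    (fun x hx => (hh x hx).fun_neg) (fun x hx => (hBd x hx).fun_neg)
    (by simpa using hha)
    (fun x hx he => by
      have h1 := hk x hx
      have h0 := singSlope_pos hp (hpos x hx)
      have he' : h x = singSlope p (x - a + ε) - (C + 1) * (x - a) := neg_injective he
      have h2 : |h x| ^ p ≤ singSlope p (x - a + ε) ^ p := by
        have h3 := singSlope_anti hp (hpos x hx) (by linarith [hx.2] : x - a + ε ≤ 2)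
        have h4 : (C + 1) * (x - a) ≤ (C + 1) * b := by
          gcongr; linarith [hx.2]
        have h5 : 0 ≤ (C + 1) * (x - a) := mul_nonneg (by linarith) (by linarith [hx.1])
        refine Real.rpow_le_rpow (abs_nonneg _) ?_ (by linarith)
        rw [he', abs_of_nonneg (by linarith)]
        linarith
      linarith)
  have hInt := sub_le_sub_of_deriv_le (g := f) (g' := h)
    (f := fun y => singProfile p (y - a + ε) - (C + 1) / 2 * (y - a) ^ 2)
    (f' := fun y => singSlope p (y - a + ε) - (C + 1) * (y - a)) hab
    (fun x hx => (hasDerivAt_singProfile_shift hp (hpos x hx)).fun_sub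
      (hasDerivAt_mul_sub_sq (C + 1) a x)) hf
    (fun x hx => neg_le_neg_iff.1 (hslope x hx))
  simp only [sub_self, zero_add] at hInt
  have h3 : (C + 1) / 2 * (b - a) ^ 2 ≤ (C + 1) * b ^ 2 := by
    have : (b - a) ^ 2 ≤ b ^ 2 := by nlinarith
    nlinarith [sq_nonneg b]
  nlinarith

/-- A subsolution lying, by a factor `l > 1`, below the singular steady state has a slope at the
boundary which is controlled a priori. -/
theorem exists_slope_bound (hp : 2 < p) (hC : 0 ≤ C) {l : ℝ} (hl : 1 < l) {N : ℝ} (hN : 0 ≤ N) :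
    ∃ M, 0 ≤ M ∧ ∀ f h k : ℝ → ℝ, ContinuousOn f (Icc 0 2) → f 0 = 0 →
      (∀ y ∈ Ioo (0:ℝ) 2, HasDerivAt f (h y) y) →
      (∀ y ∈ Ioo (0:ℝ) 2, HasDerivAt h (k y) y) → (∀ y ∈ Ioo (0:ℝ) 2, -C ≤ k y + |h y| ^ p) →
      (∀ y ∈ Icc (0:ℝ) 2, 0 ≤ f y ∧ f y ≤ N) →
      (∀ y ∈ Ioc (0:ℝ) 1, l * f y ≤ singProfile p y + (C + 1) * y ^ 2) →
      ∀ y ∈ Icc (0:ℝ) 2, f y ≤ M * y := by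
  have hψ2 := singSlope_pos hp two_pos
  have hl1 : 0 < l - 1 := by linarith
  have hC1 : 0 < C + 1 := by linarith
  obtain ⟨b, hb, hbK⟩ := exists_mul_sq_lt_singProfile hp ((l + 1) * (C + 1) / (l - 1))
    (lt_min one_pos (div_pos hψ2 hC1))
  have hb1 : b ≤ 1 := hb.2.trans (min_le_left _ _)
  have hbC : (C + 1) * b ≤ singSlope p 2 := by
    rw [mul_comm, ← le_div_iff₀ hC1]; exact hb.2.trans (min_le_right _ _)
  have hbK' : (l + 1) * (C + 1) * b ^ 2 < (l - 1) * singProfile p b := by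
    rw [div_mul_eq_mul_div, div_lt_iff₀ hl1] at hbK
    linarith
  obtain ⟨ρ, hρ, hρb, hρK⟩ : ∃ ρ, 0 < ρ ∧ ρ < b ∧ (l + 1) * (C + 1) * b ^ 2 <
      l * (singProfile p (b - ρ) - singProfile p ρ) - singProfile p b := by
    have hc : Continuous fun ρ => l * (singProfile p (b - ρ) - singProfile p ρ)
        - singProfile p b := by
      have := continuous_singProfile hp
      fun_prop
    have h1 : ∀ᶠ ρ in 𝓝[>] (0:ℝ), (l + 1) * (C + 1) * b ^ 2 <
        l * (singProfile p (b - ρ) - singProfile p ρ) - singProfile p b :=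
      nhdsWithin_le_nhds (hc.continuousAt.eventually (lt_mem_nhds (by
        beta_reduce; rw [sub_zero, singProfile_zero hp]; linarith)))
    obtain ⟨ρ, h2, h3⟩ := (h1.and (Ioo_mem_nhdsGT hb.1)).exists
    exact ⟨ρ, h3.1, h3.2, h2⟩
  have hψρ := singSlope_pos hp hρ
  refine ⟨max (singSlope p ρ) (N / ρ), hψρ.le.trans (le_max_left _ _),
    fun f h k hfc hf0 hf hh hk hfN hle y hy => ?_⟩
  have hslope : ∀ a ∈ Ioc 0 ρ, h a ≤ singSlope p ρ := by
    intro a ha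
    by_contra! hlt
    have hab : a ≤ b := ha.2.trans hρb.le
    have hsub : Icc a b ⊆ Ioo (0:ℝ) 2 := fun x hx => ⟨ha.1.trans_le hx.1, by linarith [hx.2]⟩
    have h1 := singProfile_sub_le hp hC ha.1 hρ (hρb.le.trans hb1) hb1 hbC
      (fun x hx => hf x (hsub hx)) (fun x hx => hh x (hsub hx)) (fun x hx => hk x (hsub hx)) hab
      (hfN a (Ioo_subset_Icc_self (hsub (left_mem_Icc.2 hab)))).1 hlt.le
    have h2 := hle b ⟨hb.1, hb1⟩
    have h3 : singProfile p (b - ρ) ≤ singProfile p (b - a + ρ) :=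
      singProfile_mono hp (by linarith) (by linarith [ha.2])
    have h4 : l * (singProfile p (b - ρ) - singProfile p ρ - (C + 1) * b ^ 2) ≤ l * f b :=
      mul_le_mul_of_nonneg_left (by linarith) (by linarith)
    nlinarith
  rcases hy.1.eq_or_lt with rfl | hy0
  · simp [hf0]
  rcases le_total y ρ with hyρ | hyρ
  · obtain ⟨s, hs, he⟩ := exists_hasDerivAt_eq_slope f h hy0
      (hfc.mono (Icc_subset_Icc_right hy.2)) (fun x hx => hf x ⟨hx.1, hx.2.trans_le hy.2⟩)
    have h1 := hslope s ⟨hs.1, hs.2.le.trans hyρ⟩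
    rw [he, hf0, sub_zero, sub_zero, div_le_iff₀ hy0] at h1
    exact h1.trans (mul_le_mul_of_nonneg_right (le_max_left _ _) hy0.le)
  · refine (hfN y hy).2.trans (le_trans ?_
      (mul_le_mul_of_nonneg_right (le_max_right _ _) hy0.le))
    rw [div_mul_eq_mul_div, le_div_iff₀ hρ]
    exact mul_le_mul_of_nonneg_left hyρ hN

end

theorem IsSol.exists_spatial_profile {H : ℝ → ℝ} {u : ℝ → ℝ → ℝ} (hu : IsSol H u) {C t : ℝ}
    (hC : ∀ x ∈ Ioo (-1:ℝ) 1, ∀ t, 0 < t → ∀ ut ux uxx, HasJet u x t ut ux uxx → |ut| ≤ C)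
    (ht : 0 < t) : ∃ h k : ℝ → ℝ, (∀ y ∈ Ioo (0:ℝ) 2, HasDerivAt (fun y => u (y - 1) t) (h y) y) ∧
      (∀ y ∈ Ioo (0:ℝ) 2, HasDerivAt h (k y) y) ∧
      ∀ y ∈ Ioo (0:ℝ) 2, |k y + H (h y)| ≤ C := by
  have hI : ∀ y ∈ Ioo (0:ℝ) 2, y - 1 ∈ Ioo (-1:ℝ) 1 := fun y hy =>
    ⟨by linarith [hy.1], by linarith [hy.2]⟩
  refine ⟨fun y => deriv (fun x => u x t) (y - 1),
    fun y => deriv (deriv fun x => u x t) (y - 1), fun y hy => ?_, fun y hy => ?_, fun y hy => ?_⟩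
  all_goals obtain ⟨a, b, hj⟩ := hu.jet (y - 1) (hI y hy) t ht
  · beta_reduce; rw [hj.deriv_eq]
    exact hj.hasDerivAt.comp_sub_const y 1
  · beta_reduce; rw [hj.hasDerivAt_deriv.deriv]
    exact hj.hasDerivAt_deriv.comp_sub_const y 1
  · beta_reduce; rw [hj.hasDerivAt_deriv.deriv, hj.deriv_eq]
    exact hC _ (hI y hy) t ht _ _ _ hj

/-- A priori bound, uniform in the truncation level, for the boundary slope of a family lying
strictly below a family which does not lose the boundary condition at `-1`. -/
theorem exists_uniform_boundary_slope {p : ℝ} (hp : 2 < p) {W Z : ℕ → ℝ → ℝ → ℝ} {j₀ : ℕ}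
    {C N l : ℝ} (hC : 0 ≤ C) (hN : 0 ≤ N) (hl : 1 < l)
    (hW : ∀ j ≥ j₀, IsSol (Fj1 p j) (W j)) (hZ : ∀ j ≥ j₀, IsSol (Fj1 p j) (Z j))
    (hWC : ∀ j ≥ j₀, ∀ x ∈ Ioo (-1:ℝ) 1, ∀ t, 0 < t → ∀ ut ux uxx,
      HasJet (W j) x t ut ux uxx → |ut| ≤ C)
    (hZC : ∀ j ≥ j₀, ∀ x ∈ Ioo (-1:ℝ) 1, ∀ t, 0 < t → ∀ ut ux uxx,
      HasJet (Z j) x t ut ux uxx → |ut| ≤ C)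
    (hmono : ∀ i ≥ j₀, ∀ j ≥ i, ∀ x ∈ Icc (-1:ℝ) 1, ∀ t, 0 < t → Z i x t ≤ Z j x t)
    (hWZ : ∀ j ≥ j₀, ∀ x ∈ Icc (-1:ℝ) 1, ∀ t, 0 < t → l * W j x t ≤ Z j x t)
    (hZN : ∀ j ≥ j₀, ∀ x ∈ Icc (-1:ℝ) 1, ∀ t, 0 < t → Z j x t ≤ N)
    (hno : ∀ t, 0 < t → ∀ η, 0 < η → ∀ r, 0 < r →
      ∃ a ∈ Ioo 0 r, ∀ j ≥ j₀, Z j (-1 + a) t ≤ η) :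
    ∃ M, 0 ≤ M ∧ ∀ j ≥ j₀, ∀ x ∈ Icc (-1:ℝ) 1, ∀ t, 0 < t → W j x t ≤ M * (1 + x) := by
  have hI : ∀ y ∈ Icc (0:ℝ) 2, y - 1 ∈ Icc (-1:ℝ) 1 := fun y hy =>
    ⟨by linarith [hy.1], by linarith [hy.2]⟩
  have hup : ∀ j ≥ j₀, ∀ t, 0 < t → ∀ y ∈ Ioc (0:ℝ) 1,
      Z j (y - 1) t ≤ singProfile p y + (C + 1) * y ^ 2 := by
    intro j hj t ht y hy
    refine le_of_forall_pos_le_add fun η hη => ?_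
    obtain ⟨a, ha, hZa⟩ := hno t ht η hη y hy.1
    obtain ⟨J₀, hJ₀⟩ := exists_level_le_singProfile hp hC N ⟨ha.1, ha.2.trans_le hy.2⟩
    have hJ : max j J₀ ≥ j₀ := hj.trans (le_max_left _ _)
    obtain ⟨h, k, hf, hh, hk⟩ := (hZ _ hJ).exists_spatial_profile (hZC _ hJ) ht
    have h1 := hJ₀ (max j J₀) (le_max_right _ _) _ h k hf hh (fun y hy => (abs_le.1 (hk y hy)).2)
      (fun y hy => ⟨(hZ _ hJ).nonneg _ (hI y (Ioo_subset_Icc_self hy)) t ht.le,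
        hZN _ hJ _ (hI y (Ioo_subset_Icc_self hy)) t ht⟩) y ⟨ha.2.le, hy.2⟩
    have h2 := hmono j hj (max j J₀) (le_max_left _ _) (y - 1)
      (hI y ⟨hy.1.le, by linarith [hy.2]⟩) t ht
    have h3 := hZa _ hJ
    rw [neg_add_eq_sub] at h3
    linarith
  obtain ⟨M, hM, hb⟩ := exists_slope_bound hp hC hl hN
  refine ⟨M, hM, fun j hj x hx t ht => ?_⟩
  obtain ⟨h, k, hf, hh, hk⟩ := (hW j hj).exists_spatial_profile (hWC j hj) ht
  have hle : ∀ y ∈ Icc (0:ℝ) 2, l * W j (y - 1) t ≤ N := fun y hy =>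
    (hWZ j hj _ (hI y hy) t ht).trans (hZN j hj _ (hI y hy) t ht)
  have h1 := hb (fun y => W j (y - 1) t) h k
    ((hW j hj).cont.comp (f := fun y : ℝ => (y - 1, t)) (by fun_prop)
      fun y hy => mk_mem_prod (hI y hy) ht.le)
    (by simpa using ((hW j hj).bc t ht.le).1) hf hh
    (fun y hy => (abs_le.1 (hk y hy)).1.trans (by linarith [Fj1_le_rpow (p := p) (j := j) (h y)]))
    (fun y hy => by
      have h2 := (hW j hj).nonneg _ (hI y hy) t ht.le
      exact ⟨h2, by nlinarith [hle y hy]⟩)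
    (fun y hy => (hWZ j hj _ (hI y ⟨hy.1.le, by linarith [hy.2]⟩) t ht).trans (hup j hj t ht y hy))
    (1 + x) ⟨by linarith [hx.1], by linarith [hx.2]⟩
  simpa using h1

/-- Multiplying a solution by a factor larger than one gives a subsolution. -/
theorem IsSol.const_mul_le {p : ℝ} (hp : 2 < p) {j : ℕ} {w z : ℝ → ℝ → ℝ}
    (hw : IsSol (Fj1 p j) w) (hz : IsSol (Fj1 p j) z) {l : ℝ} (hl : 1 ≤ l)
    (h0 : ∀ x ∈ Icc (-1:ℝ) 1, l * w x 0 ≤ z x 0) {x : ℝ} (hx : x ∈ Icc (-1:ℝ) 1) {t : ℝ}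
    (ht : 0 ≤ t) : l * w x t ≤ z x t :=
  parabolic_comparison (H := Fj1 p j) (u := fun x t => l * w x t) (T := t)
    (continuousOn_const.mul hw.continuousOn) hz.continuousOn h0
    (fun s hs => by simp [(hw.bc s hs.1).1, (hz.bc s hs.1).1])
    (fun s hs => by simp [(hw.bc s hs.1).2, (hz.bc s hs.1).2])
    (fun y hy s hs => by
      obtain ⟨a, b, hj⟩ := hw.jet y hy s hs.1
      refine ⟨_, _, _, hj.const_mul l, ?_⟩
      rw [mul_add]
      linarith [mul_Fj1_le hp (j := j) hl a])
    (fun y hy s hs => by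
      obtain ⟨a, b, hj⟩ := hz.jet y hy s hs.1
      exact ⟨_, _, _, hj, le_rfl⟩) x hx t ⟨ht, le_rfl⟩

theorem exists_residual_bound {p : ℝ} (hp : 2 < p) {w : ℝ → ℝ} (hw : ContDiff ℝ 2 w) :
    ∃ C, 0 ≤ C ∧ ∀ (j : ℕ), ∀ x ∈ Ioo (-1:ℝ) 1, |deriv (deriv w) x + Fj1 p j (deriv w x)| ≤ C := by
  have h1 : ContDiff ℝ 1 (deriv w) :=
    ((contDiff_succ_iff_deriv (n := 1)).1 (by simpa [one_add_one_eq_two] using hw)).2.2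
  have h2 : Continuous (deriv (deriv w)) := h1.continuous_deriv le_rfl
  have h3 : Continuous fun x => |deriv (deriv w) x| + |deriv w x| ^ p :=
    h2.abs.add (h1.continuous.abs.rpow_const fun _ => Or.inr (by linarith))
  obtain ⟨C, hC⟩ := (isCompact_Icc (a := (-1:ℝ)) (b := 1)).exists_bound_of_continuousOn
    h3.continuousOn
  refine ⟨C, (norm_nonneg _).trans (hC 0 (by simp)), fun j x hx => ?_⟩
  refine le_trans ?_ ((le_abs_self _).trans (hC x (Ioo_subset_Icc_self hx)))
  refine (abs_add_le _ _).trans (add_le_add_right ?_ _)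
  rw [abs_of_nonneg (Fj1_nonneg _)]
  exact Fj1_le_rpow _

/-- A bound on the data bounds the solution. -/
theorem IsSol.le_const {H : ℝ → ℝ} {u : ℝ → ℝ → ℝ} (hu : IsSol H u) (hH : H 0 = 0) {N : ℝ}
    (h0 : ∀ x ∈ Icc (-1:ℝ) 1, u x 0 ≤ N) {x : ℝ} (hx : x ∈ Icc (-1:ℝ) 1) {t : ℝ} (ht : 0 ≤ t) :
    u x t ≤ N := by
  have hN : 0 ≤ N := (hu.nonneg 0 (by simp) 0 le_rfl).trans (h0 0 (by simp))
  exact hu.le_super (B := fun _ _ => N) (T := t) continuousOn_const h0 (fun _ _ => hN)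
    (fun _ _ => hN) (fun y _ s _ => ⟨_, _, _, hasJet_const N y s, by simp [hH]⟩) x hx t ⟨ht, le_rfl⟩

theorem le_Usup1 {v : ℕ → ℝ → ℝ → ℝ} {N x t : ℝ} (hN : ∀ j, 1 ≤ j → v j x t ≤ N) {j : ℕ}
    (hj : 1 ≤ j) : v j x t ≤ Usup1 v x t :=
  le_ciSup (f := fun j : {j : ℕ // 1 ≤ j} => v j.1 x t)
    ⟨N, by rintro _ ⟨i, rfl⟩; exact hN i.1 i.2⟩ ⟨j, hj⟩

/-- If the lower limit at an endpoint is not positive, the supremum takes small values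
arbitrarily close to this endpoint. -/
theorem exists_Usup1_le {v : ℕ → ℝ → ℝ → ℝ} {N x₀ t : ℝ} (hx₀ : x₀ ∈ Icc (-1:ℝ) 1)
    (hN : ∀ j, 1 ≤ j → ∀ x ∈ Icc (-1:ℝ) 1, v j x t ≤ N)
    (hl : ¬ 0 < liminf (fun x => Usup1 v x t) (nhdsWithin x₀ (Ioo (-1:ℝ) 1)))
    {η r : ℝ} (hη : 0 < η) (hr : 0 < r) :
    ∃ x ∈ Ioo (-1:ℝ) 1, |x - x₀| < r ∧ ∀ j, 1 ≤ j → v j x t ≤ η := by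
  have hne : (𝓝[Ioo (-1:ℝ) 1] x₀).NeBot := by
    rw [← mem_closure_iff_nhdsWithin_neBot, closure_Ioo (by norm_num)]
    exact hx₀
  have hb : IsBoundedUnder (· ≤ ·) (𝓝[Ioo (-1:ℝ) 1] x₀) fun x => Usup1 v x t := by
    refine isBoundedUnder_of_eventually_le (a := N) ?_
    filter_upwards [self_mem_nhdsWithin] with x hx
    have : Nonempty {j : ℕ // 1 ≤ j} := ⟨⟨1, le_rfl⟩⟩
    exact ciSup_le fun j => hN j.1 j.2 x (Ioo_subset_Icc_self hx)
  have hf := frequently_lt_of_liminf_lt hb.isCoboundedUnder_ge ((not_lt.1 hl).trans_lt hη)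
  obtain ⟨x, h1, h2, h3⟩ := (hf.and_eventually ((eventually_mem_nhdsWithin).and
    (nhdsWithin_le_nhds (Metric.ball_mem_nhds x₀ hr)))).exists
  exact ⟨x, h2, h3, fun j hj =>
    (le_Usup1 (fun i hi => hN i hi x (Ioo_subset_Icc_self h2)) hj).trans h1.le⟩

theorem ContDiff.memX1 {w : ℝ → ℝ} (hw : ContDiff ℝ 2 w) (h0 : ∀ x ∈ Icc (-1:ℝ) 1, 0 ≤ w x)
    (h1 : w (-1) = 0) (h2 : w 1 = 0) : MemX1 w :=
  ⟨(hw.of_le one_le_two).contDiffOn, h0, h1, h2⟩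

/-- If the solutions `u j` lie, after a time, strictly below solutions which do not lose the
boundary conditions, then a level of truncation is never reached. -/
theorem exists_uniform_slope {p : ℝ} (hp : 2 < p) {w₀ : ℝ → ℝ} {l N t₀ : ℝ} {j₀ : ℕ}
    (hj₀ : 1 ≤ j₀) (hl : 1 < l) (ht₀ : 0 < t₀) (hw₀ : ContDiff ℝ 2 w₀)
    (hpos : ∀ x ∈ Icc (-1:ℝ) 1, 0 ≤ w₀ x) (hw1 : w₀ (-1) = 0) (hw2 : w₀ 1 = 0)
    {v : ℕ → ℝ → ℝ → ℝ} (hv : ∀ j, 1 ≤ j → IsSol (Fj1 p j) (v j))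
    (hN : ∀ j, 1 ≤ j → ∀ x ∈ Icc (-1:ℝ) 1, ∀ t, 0 ≤ t → v j x t ≤ N)
    (hwv : ∀ j ≥ j₀, ∀ x ∈ Icc (-1:ℝ) 1, l * w₀ x ≤ v j x t₀)
    (hno : ∀ x₀ ∈ ({-1, 1} : Set ℝ), ∀ t > (0:ℝ),
      ¬ 0 < liminf (fun x => Usup1 v x t) (nhdsWithin x₀ (Ioo (-1:ℝ) 1))) :
    ∃ M, 0 ≤ M ∧ ∀ j ≥ j₀, ∀ u : ℝ → ℝ → ℝ, IsSol (Fj1 p j) u →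
      (∀ x ∈ Icc (-1:ℝ) 1, u x 0 ≤ w₀ x) → ∀ x ∈ Icc (-1:ℝ) 1, ∀ t, 0 < t →
        u x t ≤ M * (1 + x) ∧ u x t ≤ M * (1 - x) := by
  have hl0 : 0 < l := by linarith
  have hlw : ContDiff ℝ 2 fun x => l * w₀ x := contDiff_const.mul hw₀
  have hw₀X : MemX1 w₀ := hw₀.memX1 hpos hw1 hw2
  have hlwX : MemX1 fun x => l * w₀ x := hlw.memX1
    (fun x hx => mul_nonneg hl0.le (hpos x hx)) (by simp [hw1]) (by simp [hw2])
  have hexW : ∀ j, 1 ≤ j → ∃ u, IsSol (Fj1 p j) u ∧ ∀ x ∈ Icc (-1:ℝ) 1, u x 0 = w₀ x := by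
    intro j hj
    obtain ⟨u, g, c, h1, h2⟩ := exists_regularized_sol hp hj hw₀X
    exact ⟨u, h2, h1.ic⟩
  have hexZ : ∀ j, 1 ≤ j → ∃ u, IsSol (Fj1 p j) u ∧ ∀ x ∈ Icc (-1:ℝ) 1, u x 0 = l * w₀ x := by
    intro j hj
    obtain ⟨u, g, c, h1, h2⟩ := exists_regularized_sol hp hj hlwX
    exact ⟨u, h2, h1.ic⟩
  choose! W hW hW0 using hexW
  choose! Z hZ hZ0 using hexZ
  obtain ⟨C₁, hC₁, hb₁⟩ := exists_residual_bound hp hw₀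
  obtain ⟨C₂, hC₂, hb₂⟩ := exists_residual_bound hp hlw
  have h1j : ∀ j ≥ j₀, 1 ≤ j := fun j hj => hj₀.trans hj
  have hWC : ∀ j ≥ j₀, ∀ x ∈ Ioo (-1:ℝ) 1, ∀ t, 0 < t → ∀ ut ux uxx,
      HasJet (W j) x t ut ux uxx → |ut| ≤ max C₁ C₂ := fun j hj x hx t ht ut ux uxx hjet =>
    ((hW j (h1j j hj)).abs_time_deriv_le hw₀ (hb₁ j) (hW0 j (h1j j hj)) hx ht hjet).trans
      (le_max_left _ _)
  have hZC : ∀ j ≥ j₀, ∀ x ∈ Ioo (-1:ℝ) 1, ∀ t, 0 < t → ∀ ut ux uxx,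
      HasJet (Z j) x t ut ux uxx → |ut| ≤ max C₁ C₂ := fun j hj x hx t ht ut ux uxx hjet =>
    ((hZ j (h1j j hj)).abs_time_deriv_le hlw (hb₂ j) (hZ0 j (h1j j hj)) hx ht hjet).trans
      (le_max_right _ _)
  have hmono : ∀ i ≥ j₀, ∀ j ≥ i, ∀ x ∈ Icc (-1:ℝ) 1, ∀ t, 0 < t → Z i x t ≤ Z j x t :=
    fun i hi j hij x hx t ht => (hZ i (h1j i hi)).le (hZ j (h1j j (hi.trans hij)))
      (fun ξ => Fj1_mono hp hij ξ) (fun y hy => by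
        rw [hZ0 i (h1j i hi) y hy, hZ0 j (h1j j (hi.trans hij)) y hy]) hx ht.le
  have hWZ : ∀ j ≥ j₀, ∀ x ∈ Icc (-1:ℝ) 1, ∀ t, 0 < t → l * W j x t ≤ Z j x t :=
    fun j hj x hx t ht => (hW j (h1j j hj)).const_mul_le hp (hZ j (h1j j hj)) hl.le
      (fun y hy => by rw [hW0 j (h1j j hj) y hy, hZ0 j (h1j j hj) y hy]) hx ht.le
  have hZv : ∀ j ≥ j₀, ∀ x ∈ Icc (-1:ℝ) 1, ∀ t, 0 < t → Z j x t ≤ v j x (t + t₀) :=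
    fun j hj x hx t ht => (hZ j (h1j j hj)).le ((hv j (h1j j hj)).shift ht₀.le)
      (fun ξ => le_rfl) (fun y hy => by
        rw [hZ0 j (h1j j hj) y hy, zero_add]; exact hwv j hj y hy) hx ht.le
  have hZN : ∀ j ≥ j₀, ∀ x ∈ Icc (-1:ℝ) 1, ∀ t, 0 < t → Z j x t ≤ N := fun j hj x hx t ht =>
    (hZv j hj x hx t ht).trans (hN j (h1j j hj) x hx _ (by linarith))
  have hN0 : 0 ≤ N := ((hv 1 le_rfl).nonneg 0 (by simp) 0 le_rfl).trans
    (hN 1 le_rfl 0 (by simp) 0 le_rfl)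
  have hC : 0 ≤ max C₁ C₂ := hC₁.trans (le_max_left _ _)
  obtain ⟨M₁, hM₁, h₁⟩ := exists_uniform_boundary_slope hp hC hN0 hl
    (fun j hj => hW j (h1j j hj)) (fun j hj => hZ j (h1j j hj)) hWC hZC hmono hWZ hZN
    (fun t ht η hη r hr => by
      obtain ⟨x, hx, hxr, hxη⟩ := exists_Usup1_le (by simp) (fun j hj x hx => hN j hj x hx (t + t₀)
        (by linarith)) (hno (-1) (by simp) (t + t₀) (by linarith)) hη hr
      refine ⟨x + 1, ⟨by linarith [hx.1], by linarith [(abs_lt.1 hxr).2]⟩, fun j hj => ?_⟩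
      rw [show -1 + (x + 1) = x by ring]
      exact (hZv j hj x (Ioo_subset_Icc_self hx) t ht).trans (hxη j (h1j j hj)))
  have hneg : ∀ x ∈ Icc (-1:ℝ) 1, -x ∈ Icc (-1:ℝ) 1 := fun x hx =>
    ⟨by linarith [hx.2], by linarith [hx.1]⟩
  have hneg' : ∀ x ∈ Ioo (-1:ℝ) 1, -x ∈ Ioo (-1:ℝ) 1 := fun x hx =>
    ⟨by linarith [hx.2], by linarith [hx.1]⟩
  have hrefl : ∀ {u : ℝ → ℝ → ℝ} {x t ut ux uxx : ℝ},
      HasJet (fun x t => u (-x) t) x t ut ux uxx → HasJet u (-x) t ut (-ux) uxx :=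
    fun {u x t ut ux uxx} h => by
      have h' : HasJet (fun x t => u (-x) t) (- -x) t ut ux uxx := by rwa [neg_neg]
      simpa using h'.reflect
  obtain ⟨M₂, hM₂, h₂⟩ := exists_uniform_boundary_slope (W := fun j x t => W j (-x) t)
    (Z := fun j x t => Z j (-x) t) hp hC hN0 hl
    (fun j hj => (hW j (h1j j hj)).reflect Fj1_neg) (fun j hj => (hZ j (h1j j hj)).reflect Fj1_neg)
    (fun j hj x hx t ht ut ux uxx h => hWC j hj (-x) (hneg' x hx) t ht ut (-ux) uxx (hrefl h))
    (fun j hj x hx t ht ut ux uxx h => hZC j hj (-x) (hneg' x hx) t ht ut (-ux) uxx (hrefl h))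
    (fun i hi j hj x hx => hmono i hi j hj (-x) (hneg x hx))
    (fun j hj x hx => hWZ j hj (-x) (hneg x hx)) (fun j hj x hx => hZN j hj (-x) (hneg x hx))
    (fun t ht η hη r hr => by
      obtain ⟨x, hx, hxr, hxη⟩ := exists_Usup1_le (by simp) (fun j hj x hx => hN j hj x hx (t + t₀)
        (by linarith)) (hno 1 (by simp) (t + t₀) (by linarith)) hη hr
      refine ⟨1 - x, ⟨by linarith [hx.2], by linarith [(abs_lt.1 hxr).1]⟩, fun j hj => ?_⟩
      rw [show -(-1 + (1 - x)) = x by ring]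
      exact (hZv j hj x (Ioo_subset_Icc_self hx) t ht).trans (hxη j (h1j j hj)))
  refine ⟨max M₁ M₂, hM₁.trans (le_max_left _ _), fun j hj u hu hu0 x hx t ht => ?_⟩
  have hle : u x t ≤ W j x t := hu.le (hW j (h1j j hj)) (fun ξ => le_rfl)
    (fun y hy => (hu0 y hy).trans (hW0 j (h1j j hj) y hy).ge) hx ht.le
  constructor
  · exact (hle.trans (h₁ j hj x hx t ht)).trans
      (mul_le_mul_of_nonneg_right (le_max_left _ _) (by linarith [hx.1]))
  · have := h₂ j hj (-x) (hneg x hx) t ht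
    rw [neg_neg] at this
    exact (hle.trans this).trans
      (mul_le_mul_of_nonneg_right (le_max_right _ _) (by linarith [hx.2]))

/-- A regularized solution whose gradient is controlled up to time `t₀`, and which satisfies linear
barriers at both endpoints afterwards, has a bounded gradient. -/
theorem DirichletSol.abs_grad_le {H u0 : ℝ → ℝ} {u g c : ℝ → ℝ → ℝ} (h : DirichletSol H u0 u g c)
    (hu : IsSol H u) {t₀ M : ℝ} (ht₀ : 0 ≤ t₀)
    (hg : ∀ x ∈ Ioo (-1:ℝ) 1, ∀ t ∈ Icc 0 t₀, |g x t| ≤ M)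
    (hM : ∀ x ∈ Icc (-1:ℝ) 1, ∀ t, t₀ < t → u x t ≤ M * (1 + x) ∧ u x t ≤ M * (1 - x))
    {x : ℝ} (hx : x ∈ Ioo (-1:ℝ) 1) {t : ℝ} (ht : 0 ≤ t) : |g x t| ≤ M := by
  rcases le_or_gt t t₀ with h1 | h1
  · exact hg x hx t ⟨ht, h1⟩
  have hcont : ContinuousOn (fun y => u y t₀) (Icc (-1) 1) :=
    h.cont.comp (f := fun y : ℝ => (y, t₀)) (by fun_prop) fun y hy => mk_mem_prod hy ht₀
  have hLip : ∀ a ∈ Icc (-1:ℝ) 1, ∀ b ∈ Icc (-1:ℝ) 1, |u a t₀ - u b t₀| ≤ M * |a - b| :=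
    fun a ha b hb => abs_sub_le_of_abs_deriv_le hcont (fun y hy => h.grad y hy t₀ ht₀)
      (fun y hy => hg y hy t₀ ⟨ht₀, le_rfl⟩) hb ha
  have hbar : ∀ y ∈ Icc (-1:ℝ) 1, ∀ s, 0 ≤ s →
      u y (s + t₀) ≤ M * (1 + y) ∧ u y (s + t₀) ≤ M * (1 - y) := by
    intro y hy s hs
    rcases hs.eq_or_lt with rfl | hs
    · have e1 := (le_abs_self _).trans (hLip y hy (-1) (by simp))
      have e2 := (le_abs_self _).trans (hLip y hy 1 (by simp))
      rw [(h.bc t₀ ht₀).1, abs_of_nonneg (a := y - -1) (by linarith [hy.1])] at e1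
      rw [(h.bc t₀ ht₀).2, abs_of_nonpos (a := y - 1) (by linarith [hy.2])] at e2
      rw [zero_add]
      constructor <;> linarith
    · exact hM y hy _ (by linarith)
  refine abs_deriv_le_of_lipschitzOn hx (h.grad x hx t ht) fun y hy => ?_
  have := (hu.shift ht₀).lipschitz (M := M) (fun a ha b hb => by simpa using hLip a ha b hb)
    (fun a ha s hs => (hbar a ha s hs).1) (fun a ha s hs => (hbar a ha s hs).2) hy
    (Ioo_subset_Icc_self hx) (sub_nonneg.2 h1.le)
  simpa using this

/-- **Theorem 3(i) of Porretta–Souplet.** In dimension one with `Ω = (-1,1)`: if `u₀ ∈ X` is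
such that gradient blowup occurs (`T*(u₀) < ∞`, i.e. no global classical solution exists) but
the global viscosity solution with data `u₀` never loses the boundary conditions, then for any
`v₀ ∈ X` with `v₀ ≥ u₀`, `v₀ ≢ u₀`, the global viscosity solution with data `v₀` loses the
boundary conditions at some boundary point. -/
theorem threshold_above_loses_bc (p : ℝ) (hp : 2 < p) (u0 : ℝ → ℝ) (hu0 : MemX1 u0)
    (hblow : ¬ ∃ u : ℝ → ℝ → ℝ, IsClassicalSol1Global p u0 u)
    (hnoloss : ∀ u : ℕ → ℝ → ℝ → ℝ, (∀ j, 1 ≤ j → IsRegSol1 p j u0 (u j)) →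
      ∀ t > (0:ℝ),
        Tendsto (fun x => Usup1 u x t) (nhdsWithin (-1) (Ioo (-1:ℝ) 1)) (nhds 0) ∧
        Tendsto (fun x => Usup1 u x t) (nhdsWithin 1 (Ioo (-1:ℝ) 1)) (nhds 0))
    (v0 : ℝ → ℝ) (hv0 : MemX1 v0)
    (hge : ∀ x ∈ Icc (-1:ℝ) 1, u0 x ≤ v0 x)
    (hne : ¬ ∀ x ∈ Icc (-1:ℝ) 1, v0 x = u0 x)
    (v : ℕ → ℝ → ℝ → ℝ) (hv : ∀ j, 1 ≤ j → IsRegSol1 p j v0 (v j)) :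
    ∃ x₀ ∈ ({-1, 1} : Set ℝ), ∃ t > (0:ℝ),
      0 < liminf (fun x => Usup1 v x t) (nhdsWithin x₀ (Ioo (-1:ℝ) 1)) := by
  by_contra hcon
  have hno : ∀ x₀ ∈ ({-1, 1} : Set ℝ), ∀ t > (0:ℝ),
      ¬ 0 < liminf (fun x => Usup1 v x t) (nhdsWithin x₀ (Ioo (-1:ℝ) 1)) :=
    fun x₀ hx₀ t ht h => hcon ⟨x₀, hx₀, t, ht, h⟩
  obtain ⟨L, hL, hLip⟩ := exists_lipschitz_of_contDiffOn hu0.1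
  obtain ⟨j₀, hj₀, hLj⟩ : ∃ j₀ : ℕ, 1 ≤ j₀ ∧ L + 1 ≤ j₀ :=
    ⟨⌈L⌉₊ + 1, by simp, by push_cast; linarith [Nat.le_ceil L]⟩
  have hex : ∀ j : ℕ, 1 ≤ j → ∃ u g c, DirichletSol (Fj1 p j) u0 u g c ∧ IsSol (Fj1 p j) u :=
    fun j hj => exists_regularized_sol hp hj hu0
  obtain ⟨U, G, c, hU, hUS⟩ := hex j₀ hj₀
  obtain ⟨t₁, ht₁, hG⟩ := hU.exists_short_time hLip
  replace hG : ∀ x ∈ Ioo (-1:ℝ) 1, ∀ t ∈ Icc 0 t₁, |G x t| ≤ j₀ :=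
    fun x hx t ht => (hG x hx t ht).trans hLj
  have hGd : ∀ x ∈ Ioo (-1:ℝ) 1, ∀ t ∈ Ioc 0 t₁, |deriv (fun y => U y t) x| ≤ j₀ :=
    fun x hx t ht => by
      rw [hU.deriv_space hx ht.1.le]; exact hG x hx t (Ioc_subset_Icc_self ht)
  have hvS : ∀ j, 1 ≤ j → IsSol (Fj1 p j) (v j) := fun j hj => (hv j hj).isSol hv0
  obtain ⟨N, hN⟩ := isCompact_Icc.exists_bound_of_continuousOn hv0.1.continuousOn
  have hvN : ∀ j, 1 ≤ j → ∀ x ∈ Icc (-1:ℝ) 1, ∀ t, 0 ≤ t → v j x t ≤ N :=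
    fun j hj x hx t ht => (hvS j hj).le_const (Fj1_zero hp)
      (fun y hy => by rw [(hv j hj).ic y hy]; exact (le_abs_self _).trans (hN y hy)) hx ht
  obtain ⟨K, hK, hKL⟩ := exists_Fj1_lipschitz hp j₀ (M := (j₀:ℝ) + 1) (by positivity)
  obtain ⟨t₀, ht₀, κ, hκ, hsep⟩ := hUS.exists_separated (hvS j₀ hj₀) Fj1_neg ht₁ hGd hK hKL
    (fun x hx => by rw [hU.ic x hx, (hv j₀ hj₀).ic x hx]; exact hge x hx)
    (fun h => hne fun x hx => by rw [← hU.ic x hx, ← (hv j₀ hj₀).ic x hx]; exact h x hx)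
  have hslice : ∀ {f : ℝ → ℝ → ℝ}, ContinuousOn (fun q : ℝ × ℝ => f q.1 q.2) (Icc (-1) 1 ×ˢ Ici 0) →
      ContinuousOn (fun x => f x t₀) (Icc (-1) 1) := fun hf =>
    hf.comp (f := fun x : ℝ => (x, t₀)) (by fun_prop) fun x hx => mk_mem_prod hx ht₀.1.le
  obtain ⟨w₀, l, hl, hw₀, hw1, hw2, hUw, hwU⟩ := exists_smooth_between hκ (hslice hU.cont)
    (hslice hU.cont_grad) (fun x hx => hU.grad x hx t₀ ht₀.1.le)
    (fun x hx => hG x hx t₀ (Ioc_subset_Icc_self ht₀)) (hU.bc t₀ ht₀.1.le).1 (hU.bc t₀ ht₀.1.le).2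
  obtain ⟨M, hM, hslope⟩ := exists_uniform_slope hp hj₀ hl ht₀.1 hw₀
    (fun x hx => (hUS.nonneg x hx t₀ ht₀.1.le).trans (hUw x hx)) hw1 hw2 hvS hvN
    (fun j hj x hx => ((hwU x hx).trans (hsep x hx)).trans
      ((hvS j₀ hj₀).le (hvS j (hj₀.trans hj)) (fun ξ => Fj1_mono hp hj ξ)
        (fun y hy => by rw [(hv j₀ hj₀).ic y hy, (hv j (hj₀.trans hj)).ic y hy]) hx ht₀.1.le)) hno
  obtain ⟨j, hj, hMj⟩ : ∃ j : ℕ, j₀ ≤ j ∧ M ≤ j :=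
    ⟨max j₀ ⌈M⌉₊, le_max_left _ _, (Nat.le_ceil M).trans (by exact_mod_cast le_max_right _ _)⟩
  obtain ⟨u, g, d, hu, huS⟩ := hex j (hj₀.trans hj)
  have heq : ∀ x ∈ Icc (-1:ℝ) 1, ∀ t ∈ Icc 0 t₁, u x t = U x t := fun x hx t ht =>
    hUS.eq_of_abs_deriv_le hp hj huS (fun y hy => by rw [hu.ic y hy, hU.ic y hy]) hGd hx ht
  have hgG : ∀ x ∈ Ioo (-1:ℝ) 1, ∀ t ∈ Icc 0 t₀, |g x t| ≤ j := fun x hx t ht => by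
    have ht' : t ∈ Icc 0 t₁ := ⟨ht.1, ht.2.trans ht₀.2⟩
    have he : (fun y => u y t) =ᶠ[𝓝 x] fun y => U y t := by
      filter_upwards [isOpen_Ioo.mem_nhds hx] with y hy
      exact heq y (Ioo_subset_Icc_self hy) t ht'
    rw [((hU.grad x hx t ht.1).congr_of_eventuallyEq he).unique (hu.grad x hx t ht.1) |>.symm]
    exact (hG x hx t ht').trans (Nat.cast_le.2 hj)
  refine hblow ⟨u, hu.isClassicalSol hp fun x hx t ht =>
    hu.abs_grad_le huS ht₀.1.le hgG (fun y hy s hs => ?_) hx ht.le⟩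
  have := hslope j hj _ (huS.shift ht₀.1.le) (fun z hz => by
    rw [zero_add, heq z hz t₀ (Ioc_subset_Icc_self ht₀)]; exact hUw z hz) y hy (s - t₀)
    (by linarith)
  rw [sub_add_cancel] at this
  exact ⟨this.1.trans (mul_le_mul_of_nonneg_right hMj (by linarith [hy.1])),
    this.2.trans (mul_le_mul_of_nonneg_right hMj (by linarith [hy.2]))⟩

end
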